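/- Let p₁ ≡ 3 (mod 8) be a prime with p₁ ≠ 3, let m ≥ 1, and set N = 2p₁^m. Let h be the class number of Q(√(−p₁)), and assume 1 + p₁ = 4p^h, where p is a prime with p ≡ 1 (mod 4) and ord_N(p) = φ(N)/2. Let f = ord_N(p) and q = p^f. Let J ⊆ Z_{2p₁} be J = ⟨p⟩ ∪ 2⟨p⟩ ∪ {0}, where ⟨p⟩ is the subgroup of Z_{2p₁}^* generated by p. Then there exists a primitive element γ of F_q such that, with C_i = γ^i⟨γ^N⟩ the cyclotomic classes of order N, the set D = ⋃_{i=0}^{p₁^{m−1}−1} ⋃_{j∈J} C_{2i + p₁^{m−1}j} is a Paley type partial difference set in the additive group of F_q. -/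

import Mathlib

open scoped Classical

/-- The cyclotomic class `C_i = γ^i ⟨γ^N⟩ = {γ^{i+Nk} : k ∈ ℤ}` of order `N` of a finite
field, with respect to the primitive element `γ`. -/
def cycClass {F : Type*} [Field F] (γ : Fˣ) (N i : ℕ) : Set F :=
  {x : F | ∃ k : ℤ, x = ((γ ^ ((i : ℤ) + (N : ℤ) * k) : Fˣ) : F)}

/-- `D` is a Paley type partial difference set in the finite abelian group `(G, +)` of
order `v`: `0 ∉ D`, `-D = D`, and every nonzero `g ∈ G` has exactly `(v-5)/4` resp.
`(v-1)/4` representations `g = d₁ - d₂` with `d₁, d₂ ∈ D`, according as `g ∈ D` or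
`g ∉ D`. -/
def IsPaleyTypePDS {G : Type*} [AddCommGroup G] [Fintype G] (D : Set G) : Prop :=
  (0 : G) ∉ D ∧ (∀ g : G, -g ∈ D ↔ g ∈ D) ∧
    ∀ g : G, g ≠ 0 →
      (g ∈ D → 4 * Nat.card {x : G × G // x.1 ∈ D ∧ x.2 ∈ D ∧ x.1 - x.2 = g} + 5 =
        Fintype.card G) ∧
      (g ∉ D → 4 * Nat.card {x : G × G // x.1 ∈ D ∧ x.2 ∈ D ∧ x.1 - x.2 = g} + 1 =
        Fintype.card G)

theorem conv_of_ft {F : Type*} [Field F] [Fintype F] {E : Type*} [Field E] [CharZero E]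
    (ψ : AddChar F E) (hψ : ψ.IsPrimitive) (s : F → E)
    (h0 : ∑ x, s x = 0) (hs : ∀ x, s (-x) = s x)
    (h : ∀ a, a ≠ 0 → (∑ x, s x * ψ (a * x)) ^ 2 = Fintype.card F) (g : F) (hg : g ≠ 0) :
    ∑ x, s x * s (x - g) = -1 := by
  have key : ∑ a, (∑ x, s x * ψ (a * x)) ^ 2 * ψ (-(a * g)) =
      Fintype.card F * ∑ x, s x * s (x - g) := by
    have : ∀ a, (∑ x, s x * ψ (a * x)) ^ 2 * ψ (-(a * g)) =
        ∑ x, ∑ y, s x * s y * ψ (a * (x + y - g)) := by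
      intro a
      rw [sq, Finset.sum_mul_sum, Finset.sum_mul]
      refine Finset.sum_congr rfl fun x _ => ?_
      rw [Finset.sum_mul]
      refine Finset.sum_congr rfl fun y _ => ?_
      rw [show a * (x + y - g) = a * x + a * y + -(a * g) by ring, AddChar.map_add_eq_mul,
        AddChar.map_add_eq_mul]
      ring
    simp_rw [this]
    rw [Finset.sum_comm, Finset.mul_sum]
    refine Finset.sum_congr rfl fun x _ => ?_
    rw [Finset.sum_comm]
    simp_rw [← Finset.mul_sum]
    have h2 : ∀ y, ∑ a, ψ (a * (x + y - g)) = if y = g - x then (Fintype.card F : E) else 0 := by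
      intro y
      rw [AddChar.sum_mulShift _ hψ]
      have : x + y - g = 0 ↔ y = g - x := by
        constructor <;> intro h
        · linear_combination h
        · linear_combination h
      simp [this]
    simp_rw [h2]
    simp only [mul_ite, mul_zero, Finset.sum_ite_eq', Finset.mem_univ, if_true]
    rw [← hs (g - x), neg_sub]
    ring
  have h3 : ∑ a, (∑ x, s x * ψ (a * x)) ^ 2 * ψ (-(a * g)) =
      ∑ a, (Fintype.card F : E) * ψ (a * (-g)) - Fintype.card F := by
    rw [← Finset.add_sum_erase _ _ (Finset.mem_univ (0 : F)),
      ← Finset.add_sum_erase Finset.univ (fun a => (Fintype.card F : E) * ψ (a * (-g)))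
        (Finset.mem_univ (0 : F))]
    simp only [zero_mul, AddChar.map_zero_eq_one, mul_one, h0]
    rw [Finset.sum_congr rfl (g := fun a => (Fintype.card F : E) * ψ (a * (-g)))]
    · simp
    · intro a ha
      rw [h a (Finset.ne_of_mem_erase ha), mul_neg]
  rw [← Finset.mul_sum, AddChar.sum_mulShift _ hψ, if_neg (neg_ne_zero.mpr hg), key] at h3
  have hq : (Fintype.card F : E) ≠ 0 := by exact_mod_cast Fintype.card_ne_zero
  have : (Fintype.card F : E) * (∑ x, s x * s (x - g) + 1) = 0 := by
    rw [mul_add, h3]; simp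
  rcases mul_eq_zero.mp this with h | h
  · exact absurd h hq
  · linear_combination h

theorem pds_of_ft {F : Type*} [Field F] [Fintype F] {E : Type*} [Field E] [CharZero E]
    (ψ : AddChar F E) (hψ : ψ.IsPrimitive) (D : Set F) (s : F → E)
    (hD0 : (0 : F) ∉ D) (hDn : ∀ g, -g ∈ D ↔ g ∈ D)
    (hs0 : s 0 = 0) (hs1 : ∀ x ∈ D, s x = 1) (hs2 : ∀ x, x ∉ D → x ≠ 0 → s x = -1)
    (h0 : ∑ x, s x = 0)
    (h : ∀ a, a ≠ 0 → (∑ x, s x * ψ (a * x)) ^ 2 = Fintype.card F) :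
    (0 : F) ∉ D ∧ (∀ g : F, -g ∈ D ↔ g ∈ D) ∧
    ∀ g : F, g ≠ 0 →
      (g ∈ D → 4 * Nat.card {x : F × F // x.1 ∈ D ∧ x.2 ∈ D ∧ x.1 - x.2 = g} + 5 =
        Fintype.card F) ∧
      (g ∉ D → 4 * Nat.card {x : F × F // x.1 ∈ D ∧ x.2 ∈ D ∧ x.1 - x.2 = g} + 1 =
        Fintype.card F) := by
  refine ⟨hD0, hDn, fun g hg => ?_⟩
  have hs : ∀ x, s (-x) = s x := by
    intro x
    by_cases hx : x = 0
    · simp [hx]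
    by_cases hxD : x ∈ D
    · rw [hs1 x hxD, hs1 _ ((hDn x).2 hxD)]
    · rw [hs2 x hxD hx, hs2 _ (fun h => hxD ((hDn x).1 h)) (neg_ne_zero.mpr hx)]
  have hc := conv_of_ft ψ hψ s h0 hs h g hg
  have hcount : (Nat.card {x : F × F // x.1 ∈ D ∧ x.2 ∈ D ∧ x.1 - x.2 = g} : E) =
      ∑ x : F, (if x ∈ D then (1 : E) else 0) * (if x - g ∈ D then 1 else 0) := by
    have e : {x : F × F // x.1 ∈ D ∧ x.2 ∈ D ∧ x.1 - x.2 = g} ≃ {x : F // x ∈ D ∧ x - g ∈ D} :=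
      { toFun := fun x => ⟨x.1.1, x.2.1, by
          have : x.1.1 - g = x.1.2 := by linear_combination x.2.2.2
          rw [this]; exact x.2.2.1⟩
        invFun := fun x => ⟨(x.1, x.1 - g), x.2.1, x.2.2, by simp⟩
        left_inv := fun x => by
          have : x.1.1 - g = x.1.2 := by linear_combination x.2.2.2
          ext <;> simp [this]
        right_inv := fun x => by simp }
    rw [Nat.card_congr e, Nat.card_eq_fintype_card, Fintype.card_subtype, Finset.card_filter]
    push_cast
    refine Finset.sum_congr rfl fun x _ => ?_
    by_cases h1 : x ∈ D <;> by_cases h2 : x - g ∈ D <;> simp [h1, h2]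
  have hind : ∀ x, 2 * (if x ∈ D then (1 : E) else 0) = s x + 1 - (if x = 0 then 1 else 0) := by
    intro x
    by_cases hx : x = 0
    · subst hx; simp [hD0, hs0]
    by_cases hxD : x ∈ D
    · simp [hx, hxD, hs1 x hxD]; norm_num
    · simp [hx, hxD, hs2 x hxD hx]
  have hshift : ∑ x, s (x - g) = 0 := by
    rw [← h0]; exact Fintype.sum_equiv (Equiv.subRight g) _ _ (fun x => rfl)
  have main : (4 * Nat.card {x : F × F // x.1 ∈ D ∧ x.2 ∈ D ∧ x.1 - x.2 = g} : E) =
      Fintype.card F - 3 - 2 * s g := by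
    rw [hcount, Finset.mul_sum]
    have : ∀ x : F, 4 * ((if x ∈ D then (1 : E) else 0) * (if x - g ∈ D then 1 else 0)) =
        s x * s (x - g) + s x + s (x - g) + 1 - (if x = 0 then s (x - g) + 1 else 0)
          - (if x = g then s x + 1 else 0) := by
      intro x
      have h1 := hind x
      have h2 := hind (x - g)
      have : 4 * ((if x ∈ D then (1 : E) else 0) * (if x - g ∈ D then 1 else 0)) =
        (2 * (if x ∈ D then (1 : E) else 0)) * (2 * (if x - g ∈ D then 1 else 0)) := by ring
      rw [this, h1, h2]
      by_cases hx : x = 0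
      · subst hx
        have : ¬ (0 : F) - g = 0 := by simpa using hg
        simp [hs0, Ne.symm hg]
      · by_cases hxg : x = g
        · subst hxg; simp [hx]; ring
        · have : ¬ x - g = 0 := by rwa [sub_eq_zero]
          simp [hx, hxg, this]; ring
    simp_rw [this]
    rw [Finset.sum_sub_distrib, Finset.sum_sub_distrib, Finset.sum_add_distrib,
      Finset.sum_add_distrib, Finset.sum_add_distrib, hc, h0, hshift]
    simp only [Finset.sum_ite_eq', Finset.mem_univ, if_true, Finset.sum_const, Finset.card_univ,
      nsmul_eq_mul, zero_sub, hs]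
    ring
  constructor
  · intro hgD
    rw [hs1 g hgD] at main
    have : ((4 * Nat.card {x : F × F // x.1 ∈ D ∧ x.2 ∈ D ∧ x.1 - x.2 = g} + 5 : ℕ) : E) =
      (Fintype.card F : ℕ) := by push_cast; rw [main]; ring
    exact_mod_cast this
  · intro hgD
    rw [hs2 g hgD hg] at main
    have : ((4 * Nat.card {x : F × F // x.1 ∈ D ∧ x.2 ∈ D ∧ x.1 - x.2 = g} + 1 : ℕ) : E) =
      (Fintype.card F : ℕ) := by push_cast; rw [main]; ring
    exact_mod_cast this

theorem norm_form_lemma (p₁ p h : ℕ) (hp : p.Prime) (hp2 : p ≠ 2) (hh : 1 ≤ h)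
    (hodd : p₁ % 2 = 1)
    (hcl : 1 + p₁ = 4 * p ^ h) (E : Type*) [Field E] [CharZero E] (k : ℕ) :
    ∀ (x y : ℤ), x ^ 2 + p₁ * y ^ 2 = 4 * p ^ k →
    ∃ (e s : ℕ) (σ ε : ℤ), (σ = 1 ∨ σ = -1) ∧ (ε = 1 ∨ ε = -1) ∧ 2 * e + h * s = k ∧
      ∀ δ : E, δ ^ 2 = -p₁ → (x : E) + y * δ = 2 * σ * p ^ e * ((1 + ε * δ) / 2) ^ s := by
  induction k using Nat.strong_induction_on with
  | _ k ih =>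
  intro x y hxy
  have hpZ : Prime (p : ℤ) := Nat.prime_iff_prime_int.mp hp
  have hp3 : (3 : ℤ) ≤ p := by
    have := hp.two_le
    have : 3 ≤ p := by omega
    exact_mod_cast this
  have hclZ : (1 + p₁ : ℤ) = 4 * p ^ h := by exact_mod_cast hcl
  have hclE : (1 + p₁ : E) = 4 * p ^ h := by exact_mod_cast hcl
  have hp4 : ¬ (p : ℤ) ∣ 4 := by
    intro hd
    have : (p : ℤ) ∣ 2 * 2 := by norm_num; exact hd
    have : (p : ℤ) ∣ 2 := by rcases hpZ.dvd_or_dvd this with h | h <;> exact h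
    have := Int.le_of_dvd (by norm_num) this
    omega
  have hp2' : ¬ (p : ℤ) ∣ 2 := fun hd => hp4 (by
    rw [show (4 : ℤ) = 2 * 2 by norm_num]; exact Dvd.dvd.mul_right hd 2)
  by_cases hboth : (p : ℤ) ∣ x ∧ (p : ℤ) ∣ y
  · obtain ⟨⟨x', rfl⟩, ⟨y', rfl⟩⟩ := hboth
    have hk : 2 ≤ k := by
      by_contra hk
      have hk' : k = 0 ∨ k = 1 := by omega
      rcases hk' with rfl | rfl
      · apply hp4
        refine ⟨p * (x' ^ 2 + p₁ * y' ^ 2), ?_⟩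
        linear_combination -hxy
      · apply hp4
        refine ⟨(x' ^ 2 + p₁ * y' ^ 2), ?_⟩
        have : (p : ℤ) * 4 = p * (p * (x' ^ 2 + p₁ * y' ^ 2)) := by linear_combination -hxy
        exact mul_left_cancel₀ hpZ.ne_zero this
    obtain ⟨j, rfl⟩ : ∃ j, k = j + 2 := ⟨k - 2, by omega⟩
    have hxy' : x' ^ 2 + p₁ * y' ^ 2 = 4 * p ^ j := by
      have : (p : ℤ) ^ 2 * (x' ^ 2 + p₁ * y' ^ 2) = p ^ 2 * (4 * p ^ j) := by
        linear_combination hxy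
      exact mul_left_cancel₀ (pow_ne_zero 2 hpZ.ne_zero) this
    obtain ⟨e, s, σ, ε, hσ, hε, hes, hδ⟩ := ih j (by omega) x' y' hxy'
    refine ⟨e + 1, s, σ, ε, hσ, hε, by omega, fun δ hd => ?_⟩
    have := hδ δ hd
    push_cast
    linear_combination (p : E) * this
  by_cases hkh : k < h
  · have hlt : (4 * p ^ k : ℤ) < 4 * p ^ h := by
      have : (p : ℤ) ^ k < p ^ h := pow_lt_pow_right₀ (by linarith) hkh
      linarith
    have hp1pos : (0 : ℤ) < p₁ := by
      have : 0 < p₁ := by omega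
      exact_mod_cast this
    have hy1 : y ^ 2 ≤ 1 := by
      by_contra hc
      have : 2 ≤ y ^ 2 := by omega
      nlinarith [sq_nonneg x]
    have hy : y = 0 ∨ y ^ 2 = 1 := by
      have h0 := sq_nonneg y
      rcases (by omega : y ^ 2 = 0 ∨ y ^ 2 = 1) with h | h
      · left; exact pow_eq_zero_iff (two_ne_zero) |>.mp h
      · right; exact h
    rcases hy with rfl | hy
    · have hk0 : k = 0 := by
        by_contra hk
        apply hboth
        refine ⟨?_, dvd_zero _⟩
        apply hpZ.dvd_of_dvd_pow (n := 2)
        have : x ^ 2 = 4 * p ^ k := by linear_combination hxy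
        rw [this]
        exact Dvd.dvd.mul_left (dvd_pow_self _ hk) _
      subst hk0
      have hx : (x - 2) * (x + 2) = 0 := by linear_combination hxy
      rcases mul_eq_zero.mp hx with hx | hx
      · refine ⟨0, 0, 1, 1, Or.inl rfl, Or.inl rfl, by simp, fun δ hd => ?_⟩
        have : x = 2 := by linarith
        subst this; simp
      · refine ⟨0, 0, -1, 1, Or.inr rfl, Or.inl rfl, by simp, fun δ hd => ?_⟩
        have : x = -2 := by linarith
        subst this; simp
    · exfalso
      rw [hy] at hxy
      have : x ^ 2 < 1 := by linarith
      have hx0 : x ^ 2 = 0 := by have := sq_nonneg x; omega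
      rw [hx0] at hxy
      have : (p₁ : ℤ) % 2 = 1 := by omega
      omega
  · push Not at hkh
    have hk1 : k ≠ 0 := by omega
    obtain ⟨j, rfl⟩ : ∃ j, k = j + h := ⟨k - h, by omega⟩
    have hdiv : (p : ℤ) ^ h ∣ (x - y) * (x + y) := by
      refine ⟨4 * p ^ j - 4 * y ^ 2, ?_⟩
      rw [pow_add] at hxy
      linear_combination hxy - y ^ 2 * hclZ
    have hnot : ¬ ((p : ℤ) ∣ x - y ∧ (p : ℤ) ∣ x + y) := by
      rintro ⟨h1, h2⟩
      apply hboth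
      constructor
      · have : (p : ℤ) ∣ 2 * x := by
          have := dvd_add h1 h2
          rwa [show x - y + (x + y) = 2 * x by ring] at this
        exact (hpZ.dvd_or_dvd this).resolve_left hp2'
      · have : (p : ℤ) ∣ 2 * y := by
          have := dvd_sub h2 h1
          rwa [show x + y - (x - y) = 2 * y by ring] at this
        exact (hpZ.dvd_or_dvd this).resolve_left hp2'
    have hdiv2 : (p : ℤ) ^ h ∣ x - y ∨ (p : ℤ) ^ h ∣ x + y := by
      by_cases h1 : (p : ℤ) ∣ x - y
      · have h2 : ¬ (p : ℤ) ∣ x + y := fun h2 => hnot ⟨h1, h2⟩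
        left
        exact (IsCoprime.pow_left ((Prime.coprime_iff_not_dvd hpZ).mpr h2)).dvd_of_dvd_mul_right hdiv
      · right
        exact (IsCoprime.pow_left ((Prime.coprime_iff_not_dvd hpZ).mpr h1)).dvd_of_dvd_mul_left hdiv
    have hpar : (2 : ℤ) ∣ x - y := by
      have h4 : (2 : ℤ) ∣ x ^ 2 + p₁ * y ^ 2 := by
        rw [hxy]; exact ⟨2 * p ^ (j + h), by ring⟩
      have hpp : (p₁ : ℤ) = 2 * (p₁ / 2 : ℤ) + 1 := by omega
      rw [hpp] at h4
      have h5 : (2 : ℤ) ∣ (x - y) ^ 2 := by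
        have : (x - y) ^ 2 = (x ^ 2 + (2 * (p₁ / 2 : ℤ) + 1) * y ^ 2)
          - 2 * (x * y + (p₁ / 2 : ℤ) * y ^ 2) := by ring
        rw [this]
        exact dvd_sub h4 (Dvd.intro _ rfl)
      exact Int.prime_two.dvd_of_dvd_pow h5
    have hcop : IsCoprime (2 : ℤ) ((p : ℤ) ^ h) := by
      apply IsCoprime.pow_right
      exact ((Prime.coprime_iff_not_dvd hpZ).mpr hp2').symm
    -- reduce to one case with a sign
    have hsign : ∃ t : ℤ, (t = 1 ∨ t = -1) ∧ (2 * (p : ℤ) ^ h) ∣ x - t * y := by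
      rcases hdiv2 with h1 | h1
      · exact ⟨1, Or.inl rfl, by rw [one_mul]; exact hcop.mul_dvd hpar h1⟩
      · refine ⟨-1, Or.inr rfl, ?_⟩
        rw [show x - -1 * y = x + y by ring]
        refine hcop.mul_dvd ?_ h1
        rw [show x + y = x - y + 2 * y by ring]
        exact dvd_add hpar (Dvd.intro _ rfl)
    obtain ⟨t, ht, w, hw⟩ := hsign
    have ht2 : t ^ 2 = 1 := by rcases ht with rfl | rfl <;> norm_num
    -- x' = w + 2 t y, y' = - t w
    have hxy' : (w + 2 * t * y) ^ 2 + p₁ * (-(t * w)) ^ 2 = 4 * p ^ j := by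
      have hx : x = t * y + 2 * p ^ h * w := by linear_combination hw
      have hP : (4 * (p : ℤ) ^ h) ≠ 0 := mul_ne_zero (by norm_num) (pow_ne_zero _ hpZ.ne_zero)
      apply mul_left_cancel₀ hP
      rw [pow_add] at hxy
      rw [hx] at hxy
      linear_combination 4 * hxy + (4 * p ^ h * w ^ 2 - 4 * y ^ 2) * hclZ +
        (4 * p ^ h * (p₁ * w ^ 2 + 4 * y ^ 2) - 4 * y ^ 2) * ht2
    obtain ⟨e, s, σ, ε, hσ, hε, hes, hδ⟩ := ih j (by omega) _ _ hxy'
    have htE : (t : E) ^ 2 = 1 := by exact_mod_cast ht2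
    have hstep : ∀ δ : E, δ ^ 2 = -p₁ → (x : E) + y * δ =
        (((w + 2 * t * y : ℤ) : E) + ((-(t * w) : ℤ) : E) * δ) * ((1 + t * δ) / 2) := by
      intro δ hd
      have hx : (x : E) = t * y + 2 * p ^ h * w := by
        have : x = t * y + 2 * p ^ h * w := by linear_combination hw
        rw [this]; push_cast; ring
      rw [hx]
      push_cast
      linear_combination -(w : E) / 2 * hclE + (w / 2 : E) * t ^ 2 * hd
         + (-(w : E) / 2 * p₁ - δ * y) * htE
    by_cases hs : s = 0
    · subst hs
      refine ⟨e, 1, σ, t, hσ, ht, by omega, fun δ hd => ?_⟩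
      rw [hstep δ hd, hδ δ hd]; ring
    by_cases hεt : ε = t
    · subst hεt
      refine ⟨e, s + 1, σ, ε, hσ, ht, by rw [← hes]; ring, fun δ hd => ?_⟩
      rw [hstep δ hd, hδ δ hd]; ring
    · have hεt' : ε = -t := by
        rcases hε with rfl | rfl <;> rcases ht with rfl | rfl <;> simp_all
      obtain ⟨s', rfl⟩ : ∃ s', s = s' + 1 := ⟨s - 1, by omega⟩
      refine ⟨e + h, s', σ, ε, hσ, hε, by rw [← hes]; ring, fun δ hd => ?_⟩
      rw [hstep δ hd, hδ δ hd]
      subst hεt'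
      have : ((1 + ((-t : ℤ) : E) * δ) / 2) * ((1 + t * δ) / 2) = p ^ h := by
        push_cast
        have h4 : (p : E) ^ h = (1 + p₁) / 4 := by rw [hclE]; ring
        rw [h4]
        linear_combination -(t : E) ^ 2 / 4 * hd + (p₁ : E) / 4 * htE
      rw [pow_succ, pow_add]
      linear_combination 2 * (σ : E) * p ^ e * ((1 + ((-t : ℤ) : E) * δ) / 2) ^ s' * this

namespace ClassBound
open NumberField Polynomial

section
variable {K : Type*} [Field K] [NumberField K] {p₁ : ℕ}

noncomputable def idCount (K : Type*) [Field K] [NumberField K] (n : ℕ) : ℕ :=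
  Nat.card {I : Ideal (𝓞 K) // Ideal.absNorm I = n}

instance idFinite (n : ℕ) : Finite {I : Ideal (𝓞 K) // Ideal.absNorm I = n} :=
  (Ideal.finite_setOfPred_absNorm_eq n).to_subtype

theorem idCount_pos (n : ℕ) (I : Ideal (𝓞 K)) (hI : Ideal.absNorm I = n) : 1 ≤ idCount K n := by
  have : Nonempty {I : Ideal (𝓞 K) // Ideal.absNorm I = n} := ⟨⟨I, hI⟩⟩
  exact Nat.card_pos

theorem recover {m n : ℕ} (hmn : m.Coprime n) (I J : Ideal (𝓞 K))
    (hI : Ideal.absNorm I = m) (hJ : Ideal.absNorm J = n) :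
    I * J ⊔ Ideal.span {(m : 𝓞 K)} = I := by
  have hmI : (m : 𝓞 K) ∈ I := hI ▸ Ideal.absNorm_mem I
  have hnJ : (n : 𝓞 K) ∈ J := hJ ▸ Ideal.absNorm_mem J
  apply le_antisymm
  · exact sup_le Ideal.mul_le_left ((Ideal.span_singleton_le_iff_mem _).mpr hmI)
  · intro x hx
    have := Nat.isCoprime_iff_coprime.mpr hmn
    obtain ⟨u, v, huv⟩ := this
    have h2 : (u : 𝓞 K) * m + v * n = 1 := by exact_mod_cast congrArg (Int.cast : ℤ → 𝓞 K) huv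
    have : x = x * (v * n) + (x * u) * m := by linear_combination -x * h2
    rw [this]
    apply Submodule.add_mem_sup
    · exact Ideal.mul_mem_mul hx (J.mul_mem_left _ hnJ)
    · exact Ideal.mul_mem_left _ _ (Ideal.mem_span_singleton_self _)

theorem idCount_mul {m n : ℕ} (hmn : m.Coprime n) :
    idCount K m * idCount K n ≤ idCount K (m * n) := by
  unfold idCount
  rw [← Nat.card_prod]
  apply Nat.card_le_card_of_injective (fun x => ⟨x.1.1 * x.2.1, by
    rw [map_mul, x.1.2, x.2.2]⟩)
  rintro ⟨⟨I, hI⟩, ⟨J, hJ⟩⟩ ⟨⟨I', hI'⟩, ⟨J', hJ'⟩⟩ h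
  simp only [Subtype.mk.injEq] at h
  have h1 := recover hmn I J hI hJ
  have h2 := recover hmn I' J' hI' hJ'
  have h3 := recover hmn.symm J I hJ hI
  have h4 := recover hmn.symm J' I' hJ' hI'
  simp only [Prod.mk.injEq, Subtype.mk.injEq]
  constructor
  · rw [← h1, ← h2, h]
  · rw [← h3, ← h4, mul_comm J, mul_comm J', h]

theorem idCount_pow_of_two {ℓ : ℕ} (hl : ℓ.Prime) (P Q : Ideal (𝓞 K)) (hP : Ideal.absNorm P = ℓ)
    (hQ : Ideal.absNorm Q = ℓ) (hPQ : IsCoprime P Q) (k : ℕ) : k + 1 ≤ idCount K (ℓ ^ k) := by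
  unfold idCount
  have hP0 : P ≠ 0 := by rintro rfl; simp at hP; exact hl.ne_zero hP.symm
  have hQ0 : Q ≠ 0 := by rintro rfl; simp at hQ; exact hl.ne_zero hQ.symm
  have key : ∀ i j : ℕ, i < j → j ≤ k → P ^ i * Q ^ (k - i) ≠ P ^ j * Q ^ (k - j) := by
    intro i j hij hjk he
    have e1 : P ^ j = P ^ i * P ^ (j - i) := by rw [← pow_add]; congr 1; omega
    have e2 : Q ^ (k - i) = Q ^ (k - j) * Q ^ (j - i) := by rw [← pow_add]; congr 1; omega
    rw [e1, e2, mul_assoc] at he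
    have h1 := mul_left_cancel₀ (pow_ne_zero i hP0) he
    rw [mul_comm (P ^ _)] at h1
    have h2 := mul_left_cancel₀ (pow_ne_zero _ hQ0) h1
    have h3 : IsCoprime (P ^ (j - i)) (Q ^ (j - i)) := hPQ.pow
    rw [h2, isCoprime_self, Ideal.isUnit_iff] at h3
    have h4 := congrArg Ideal.absNorm h3
    rw [map_pow, hP, Ideal.absNorm_top] at h4
    have : 1 < ℓ ^ (j - i) := Nat.one_lt_pow (by omega) hl.one_lt
    omega
  have : Nat.card (Fin (k + 1)) = k + 1 := by simp
  rw [← this]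
  apply Nat.card_le_card_of_injective (fun i : Fin (k + 1) => (⟨P ^ (i : ℕ) * Q ^ (k - i), by
    rw [map_mul, map_pow, map_pow, hP, hQ, ← pow_add]; congr 1; omega⟩ :
      {I : Ideal (𝓞 K) // Ideal.absNorm I = ℓ ^ k}))
  intro i j h
  simp only [Subtype.mk.injEq] at h
  rcases lt_trichotomy (i : ℕ) j with h1 | h1 | h1
  · exact absurd h (key i j h1 (by omega))
  · exact Fin.ext h1
  · exact absurd h.symm (key j i h1 (by omega))

theorem split_case {ℓ : ℕ} (hl : ℓ.Prime) (hr : Module.finrank ℤ (𝓞 K) = 2) (a : 𝓞 K)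
    (ha : a ^ 2 = -(p₁ : 𝓞 K)) (hta : Algebra.trace ℤ (𝓞 K) a = 0) (x : ℤ)
    (hx : (ℓ : ℤ) ∣ x ^ 2 + p₁) (h2x : IsCoprime (ℓ : ℤ) (2 * x)) (k : ℕ) :
    k + 1 ≤ idCount K (ℓ ^ k) := by
  obtain ⟨c, hc⟩ := hx
  have hc' : (x : 𝓞 K) ^ 2 + p₁ = ℓ * c := by exact_mod_cast congrArg (Int.cast : ℤ → 𝓞 K) hc
  obtain ⟨u, v, huv⟩ := id h2x
  have huv' : (u : 𝓞 K) * ℓ + v * (2 * x) = 1 := by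
    exact_mod_cast congrArg (Int.cast : ℤ → 𝓞 K) huv
  have htx : ∀ y : ℤ, Algebra.trace ℤ (𝓞 K) (y : 𝓞 K) = 2 * y := by
    intro y
    have := Algebra.trace_algebraMap (R := ℤ) (S := 𝓞 K) y
    rw [hr] at this
    simpa using this
  let P : Ideal (𝓞 K) := Ideal.span {(ℓ : 𝓞 K), a - x}
  let Q : Ideal (𝓞 K) := Ideal.span {(ℓ : 𝓞 K), a + x}
  have hlP : (ℓ : 𝓞 K) ∈ P := Ideal.subset_span (by simp)
  have hlQ : (ℓ : 𝓞 K) ∈ Q := Ideal.subset_span (by simp)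
  have haP : a - x ∈ P := Ideal.subset_span (by simp)
  have haQ : a + x ∈ Q := Ideal.subset_span (by simp)
  have hPQ : P * Q = Ideal.span {(ℓ : 𝓞 K)} := by
    apply le_antisymm
    · rw [Ideal.span_mul_span, Ideal.span_le]
      intro y hy
      simp only [Set.mem_mul, Set.mem_insert_iff, Set.mem_singleton_iff] at hy
      obtain ⟨s, hs, t, ht, rfl⟩ := hy
      rw [SetLike.mem_coe, Ideal.mem_span_singleton]
      rcases hs with rfl | rfl
      · exact dvd_mul_right _ _
      · rcases ht with rfl | rfl
        · exact dvd_mul_left _ _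
        · exact ⟨-c, by linear_combination ha - hc'⟩
    · rw [Ideal.span_singleton_le_iff_mem]
      have : (ℓ : 𝓞 K) = u * (ℓ * ℓ) + v * (ℓ * (a + x) - (a - x) * ℓ) := by
        linear_combination -(ℓ : 𝓞 K) * huv'
      rw [this]
      exact add_mem (Ideal.mul_mem_left _ _ (Ideal.mul_mem_mul hlP hlQ))
        (Ideal.mul_mem_left _ _ (sub_mem (Ideal.mul_mem_mul hlP haQ) (Ideal.mul_mem_mul haP hlQ)))
  have hcop : IsCoprime P Q := by
    rw [Ideal.isCoprime_iff_sup_eq, Ideal.eq_top_iff_one]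
    have : (1 : 𝓞 K) = (-v * (a - x)) + (u * ℓ + v * (a + x)) := by linear_combination -huv'
    rw [this]
    exact Submodule.add_mem_sup (Ideal.mul_mem_left _ _ haP)
      (add_mem (Ideal.mul_mem_left _ _ hlQ) (Ideal.mul_mem_left _ _ haQ))
  have hnd : ¬ (ℓ : ℤ) ∣ 2 * x := by
    intro h
    have := h2x.isUnit_of_dvd' dvd_rfl h
    rw [Int.isUnit_iff] at this
    have := hl.one_lt
    omega
  have hP1 : Ideal.absNorm P ≠ 1 := by
    intro h
    rw [Ideal.absNorm_eq_one_iff] at h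
    rw [h, Ideal.top_mul] at hPQ
    rw [hPQ, Ideal.mem_span_singleton] at haQ
    obtain ⟨d, hd⟩ := haQ
    have h1 := congrArg (Algebra.trace ℤ (𝓞 K)) hd
    rw [map_add, hta, htx, zero_add, show (ℓ : 𝓞 K) * d = (ℓ : ℤ) • d by simp, map_smul,
      smul_eq_mul] at h1
    exact hnd ⟨_, h1⟩
  have hQ1 : Ideal.absNorm Q ≠ 1 := by
    intro h
    rw [Ideal.absNorm_eq_one_iff] at h
    rw [h, Ideal.mul_top] at hPQ
    rw [hPQ, Ideal.mem_span_singleton] at haP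
    obtain ⟨d, hd⟩ := haP
    have h1 := congrArg (Algebra.trace ℤ (𝓞 K)) hd
    rw [map_sub, hta, htx, zero_sub, show (ℓ : 𝓞 K) * d = (ℓ : ℤ) • d by simp, map_smul,
      smul_eq_mul] at h1
    exact hnd ((dvd_neg).mp ⟨_, h1⟩)
  have hprod : Ideal.absNorm P * Ideal.absNorm Q = ℓ ^ 2 := by
    rw [← map_mul, hPQ, Ideal.absNorm_span_natCast, hr]
  obtain ⟨h1, h2⟩ := (Nat.Prime.mul_eq_prime_sq_iff hl hP1 hQ1).mp hprod
  exact idCount_pow_of_two hl P Q h1 h2 hcop k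

/-- the quadratic Dirichlet character -/
noncomputable def chi (p₁ : ℕ) [Fact p₁.Prime] : DirichletCharacter ℂ p₁ :=
  (quadraticChar (ZMod p₁)).ringHomComp (Int.castRingHom ℂ)

theorem chi_apply [Fact p₁.Prime] (x : ZMod p₁) : chi p₁ x = (quadraticChar (ZMod p₁) x : ℂ) := rfl

theorem chi_sq [Fact p₁.Prime] : (chi p₁) ^ 2 = 1 := by
  rw [← MulChar.isQuadratic_iff_sq_eq_one]
  exact (quadraticChar_isQuadratic (ZMod p₁)).comp _

open ComplexOrder in
theorem zetaMul_le [Fact p₁.Prime] (hmod : p₁ % 8 = 3)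
    (hr : Module.finrank ℤ (𝓞 K) = 2) (a : 𝓞 K)
    (ha : a ^ 2 = -(p₁ : 𝓞 K)) (hta : Algebra.trace ℤ (𝓞 K) a = 0) (n : ℕ) (hn : n ≠ 0) :
    (chi p₁).zetaMul n ≤ (idCount K n : ℂ) := by
  have hp : p₁.Prime := Fact.out
  have hchar : ringChar (ZMod p₁) = p₁ := ZMod.ringChar_zmod_n p₁
  have hp2 : p₁ ≠ 2 := by rintro rfl; omega
  revert hn
  induction n using Nat.recOnPosPrimePosCoprime with
  | prime_pow ℓ k hl hk =>
    intro _
    have : (chi p₁).zetaMul (ℓ ^ k) = ∑ i ∈ Finset.range (k + 1), (chi p₁ ℓ) ^ i := by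
      rw [DirichletCharacter.zetaMul, ArithmeticFunction.coe_zeta_mul_apply,
        Nat.sum_divisors_prime_pow hl]
      refine Finset.sum_congr rfl fun i _ => ?_
      have : toArithmeticFunction (fun x : ℕ => chi p₁ x) (ℓ ^ i) =
        if ℓ ^ i = 0 then 0 else chi p₁ ((ℓ ^ i : ℕ) : ZMod p₁) := rfl
      rw [this, if_neg (pow_ne_zero _ hl.ne_zero)]
      push_cast
      rw [map_pow]
    rw [this, chi_apply]
    haveI := Fact.mk hl
    rcases quadraticChar_isQuadratic (ZMod p₁) (ℓ : ZMod p₁) with h | h | h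
    · rw [h]
      have h0 : (ℓ : ZMod p₁) = 0 := quadraticChar_eq_zero_iff.mp h
      have h1 : p₁ ∣ ℓ := (ZMod.natCast_eq_zero_iff _ _).mp h0
      have h2 : p₁ = ℓ := (Nat.prime_dvd_prime_iff_eq hp hl).mp h1
      have h3 : Ideal.absNorm (Ideal.span {a}) = p₁ := by
        have : (Ideal.absNorm (Ideal.span {a})) ^ 2 = p₁ ^ 2 := by
          rw [← map_pow, Ideal.span_singleton_pow, ha, Ideal.span_singleton_neg,
            Ideal.absNorm_span_natCast, hr]
        exact Nat.pow_left_injective (n := 2) (by norm_num) this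
      have h4 := idCount_pos (ℓ ^ k) (Ideal.span {a} ^ k) (by rw [map_pow, h3, h2])
      simp [Finset.sum_range_succ', h4]
    · rw [h]
      have hl2 : ℓ ≠ 2 := by
        rintro rfl
        have h2 : ringChar (ZMod p₁) ≠ 2 := by rwa [hchar]
        have := quadraticChar_two h2
        rw [ZMod.card, ZMod.χ₈_nat_eq_if_mod_eight] at this
        have h5 : (quadraticChar (ZMod p₁)) ((2:ℕ) : ZMod p₁) = -1 := by
          push_cast
          rw [this]
          rw [if_neg (by omega), if_neg (by omega)]
        rw [h] at h5
        norm_num at h5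
      have hlp : p₁ ≠ ℓ := by
        rintro rfl
        rw [ZMod.natCast_self] at h
        simp at h
      have h5 := quadraticChar_odd_prime (F := ZMod p₁) (by rwa [hchar]) hl2 (by rwa [hchar])
      rw [h, ZMod.card, ZMod.χ₄_nat_three_mod_four (by omega)] at h5
      have hne : ((((-1 : ℤ) : ZMod ℓ)) * (p₁ : ZMod ℓ)) ≠ 0 := by
        intro h6
        rw [h6] at h5
        simp at h5
      have h6 := (quadraticChar_one_iff_isSquare hne).mp h5.symm
      obtain ⟨y, hy⟩ := h6
      obtain ⟨x, rfl⟩ := ZMod.intCast_surjective y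
      have hd : (ℓ : ℤ) ∣ x ^ 2 + p₁ := by
        rw [← ZMod.intCast_zmod_eq_zero_iff_dvd]
        push_cast at hy ⊢
        linear_combination -hy
      have hcop : IsCoprime (ℓ : ℤ) (2 * x) := by
        rw [Prime.coprime_iff_not_dvd (Nat.prime_iff_prime_int.mp hl)]
        intro h7
        rcases (Nat.prime_iff_prime_int.mp hl).dvd_or_dvd h7 with h8 | h8
        · have : ℓ ∣ 2 := by exact_mod_cast h8
          exact hl2 ((Nat.prime_dvd_prime_iff_eq hl Nat.prime_two).mp this)
        · apply hne
          rw [hy, (ZMod.intCast_zmod_eq_zero_iff_dvd _ _).mpr h8, mul_zero]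
      have := split_case hl hr a ha hta x hd hcop k
      simp only [Int.cast_one, one_pow, Finset.sum_const, Finset.card_range, nsmul_eq_mul, mul_one]
      exact_mod_cast this
    · rw [h]
      push_cast
      rw [neg_one_geom_sum]
      split_ifs with he
      · exact_mod_cast Nat.zero_le _
      · rw [Nat.even_add_one, not_not] at he
        obtain ⟨j, rfl⟩ := he
        have := idCount_pos (ℓ ^ (j + j)) (Ideal.span {(ℓ : 𝓞 K)} ^ j) (by
          rw [map_pow, Ideal.absNorm_span_natCast, hr, ← pow_mul]; congr 1; omega)
        exact_mod_cast this
  | zero => intro h; exact absurd rfl h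
  | one =>
    intro _
    rw [(chi p₁).isMultiplicative_zetaMul.map_one]
    have := idCount_pos 1 (⊤ : Ideal (𝓞 K)) (by simp)
    exact_mod_cast this
  | coprime m n hm hn hmn ihm ihn =>
    intro _
    rw [(chi p₁).isMultiplicative_zetaMul.map_mul_of_coprime hmn]
    calc _ ≤ (idCount K m : ℂ) * (idCount K n : ℂ) :=
          mul_le_mul (ihm (by omega)) (ihn (by omega))
            (DirichletCharacter.zetaMul_nonneg chi_sq n) (by exact_mod_cast Nat.zero_le _)
      _ ≤ _ := by exact_mod_cast idCount_mul hmn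
end
end ClassBound

namespace ClassBound
open Filter Topology

theorem abel_parts (c u : ℕ → ℂ) (M : ℕ) :
    ∑ n ∈ Finset.range M, c n * u n = (∑ k ∈ Finset.range M, c k) * u M +
      ∑ n ∈ Finset.range M, (∑ k ∈ Finset.range (n + 1), c k) * (u n - u (n + 1)) := by
  induction M with
  | zero => simp
  | succ M ih =>
    rw [Finset.sum_range_succ, ih, Finset.sum_range_succ _ M, Finset.sum_range_succ _ M]
    rw [Finset.sum_range_succ]
    ring

theorem rpow_diff_bound (n : ℕ) (hn : 1 ≤ n) (s : ℝ) (h1 : 1 ≤ s) (h2 : s ≤ 2) :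
    |(n : ℝ) ^ (-s) - ((n + 1 : ℕ) : ℝ) ^ (-s)| ≤ 2 / (n : ℝ) ^ 2 := by
  have hn0 : (1 : ℝ) ≤ n := by exact_mod_cast hn
  have hpos : (0:ℝ) < n := by linarith
  have hA : (n : ℝ) ^ (-s) ≤ 1 / n := by
    calc (n : ℝ) ^ (-s) ≤ (n : ℝ) ^ (-1 : ℝ) := Real.rpow_le_rpow_of_exponent_le hn0 (by linarith)
      _ = 1 / n := by rw [Real.rpow_neg_one, one_div]
  have hA0 : 0 < (n : ℝ) ^ (-s) := Real.rpow_pos_of_pos hpos _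
  have hr : ((n + 1 : ℕ) : ℝ) ^ (-s) = (n : ℝ) ^ (-s) * ((n : ℝ) / (n + 1)) ^ s := by
    rw [Real.div_rpow hpos.le (by linarith), Real.rpow_neg hpos.le, Real.rpow_neg (by positivity)]
    have := (Real.rpow_pos_of_pos hpos s).ne'
    push_cast
    field_simp
  have hq0 : 0 < (n : ℝ) / (n + 1) := by positivity
  have hq1 : (n : ℝ) / (n + 1) ≤ 1 := by rw [div_le_one (by positivity)]; linarith
  have hB : ((n : ℝ) / (n + 1)) ^ s ≤ 1 := Real.rpow_le_one hq0.le hq1 (by linarith)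
  have hC : 1 - 2 / n ≤ ((n : ℝ) / (n + 1)) ^ s := by
    have h3 : ((n : ℝ) / (n + 1)) ^ (2 : ℝ) ≤ ((n : ℝ) / (n + 1)) ^ s :=
      Real.rpow_le_rpow_of_exponent_ge hq0 hq1 h2
    have h4 : 1 - 2 / (n : ℝ) ≤ ((n : ℝ) / (n + 1)) ^ (2 : ℝ) := by
      rw [Real.rpow_two, div_pow, le_div_iff₀ (by positivity)]
      have : (1 - 2 / (n : ℝ)) * ((n : ℝ) + 1) ^ 2 = n ^ 2 - 3 - 2 / n := by field_simp; ring
      rw [this]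
      have : 0 < 2 / (n : ℝ) := by positivity
      linarith
    linarith
  rw [hr]
  have : (n : ℝ) ^ (-s) - (n : ℝ) ^ (-s) * ((n : ℝ) / (n + 1)) ^ s =
    (n : ℝ) ^ (-s) * (1 - ((n : ℝ) / (n + 1)) ^ s) := by ring
  rw [this, abs_of_nonneg (mul_nonneg hA0.le (by linarith))]
  calc _ ≤ 1 / (n : ℝ) * (2 / n) := by
        apply mul_le_mul hA (by linarith) (by linarith) (by positivity)
    _ = _ := by field_simp

theorem exists_limit (c : ℕ → ℂ) (hc0 : c 0 = 0) (B : ℝ)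
    (hB : ∀ n, ‖∑ k ∈ Finset.range n, c k‖ ≤ B) :
    ∃ Lf : ℝ → ℂ, (∀ s, 1 ≤ s → s ≤ 2 →
      Tendsto (fun M => ∑ n ∈ Finset.range M, c n * (((n : ℝ) ^ (-s) : ℝ) : ℂ)) atTop (𝓝 (Lf s))) ∧
      Tendsto Lf (𝓝[>] 1) (𝓝 (Lf 1)) := by
  have hB0 : 0 ≤ B := by simpa using hB 0
  let t : ℝ → ℕ → ℂ := fun s n => (∑ k ∈ Finset.range (n + 1), c k) *
    ((((n : ℝ) ^ (-s) : ℝ) : ℂ) - ((((n + 1 : ℕ) : ℝ) ^ (-s) : ℝ) : ℂ))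
  have hbound : ∀ s, 1 ≤ s → s ≤ 2 → ∀ n, ‖t s n‖ ≤ B * (2 / (n : ℝ) ^ 2) := by
    intro s h1 h2 n
    rcases Nat.eq_zero_or_pos n with rfl | hn
    · simp [t, hc0]
    · simp only [t, norm_mul]
      apply mul_le_mul (hB _) _ (norm_nonneg _) hB0
      rw [← Complex.ofReal_sub, Complex.norm_real, Real.norm_eq_abs]
      exact rpow_diff_bound n hn s h1 h2
  have hsum : Summable (fun n : ℕ => B * (2 / (n : ℝ) ^ 2)) := by
    have := (Real.summable_one_div_nat_pow (p := 2)).mpr (by norm_num)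
    refine (this.mul_left (B * 2)).congr fun n => ?_
    ring
  refine ⟨fun s => ∑' n, t s n, ?_, ?_⟩
  · intro s h1 h2
    have hs := (Summable.of_norm_bounded hsum (hbound s h1 h2)).hasSum.tendsto_sum_nat
    have h3 : Tendsto (fun M : ℕ => (∑ k ∈ Finset.range M, c k) * (((M : ℝ) ^ (-s) : ℝ) : ℂ)) atTop
        (𝓝 0) := by
      rw [tendsto_zero_iff_norm_tendsto_zero]
      have h4 : Tendsto (fun M : ℕ => B * (M : ℝ) ^ (-s)) atTop (𝓝 0) := by
        have := (tendsto_rpow_neg_atTop (y := s) (by linarith)).comp tendsto_natCast_atTop_atTop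
        simpa using this.const_mul B
      refine squeeze_zero (fun _ => norm_nonneg _) (fun M => ?_) h4
      rw [norm_mul, Complex.norm_real, Real.norm_eq_abs, abs_of_nonneg (by positivity)]
      gcongr
      exact hB M
    have h5 := h3.add hs
    rw [zero_add] at h5
    refine h5.congr fun M => ?_
    exact (abel_parts c (fun n => (((n : ℝ) ^ (-s) : ℝ) : ℂ)) M).symm
  · apply tendsto_tsum_of_dominated_convergence hsum
    · intro n
      simp only [t]
      rcases Nat.eq_zero_or_pos n with rfl | hn
      · simp [hc0]
      apply Tendsto.mono_left _ nhdsWithin_le_nhds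
      have hn' : (0:ℝ) < n := by exact_mod_cast hn
      have : Continuous (fun s : ℝ => (∑ k ∈ Finset.range (n + 1), c k) *
        ((((n : ℝ) ^ (-s) : ℝ) : ℂ) - ((((n + 1 : ℕ) : ℝ) ^ (-s) : ℝ) : ℂ))) := by
        refine continuous_const.mul (Continuous.sub ?_ ?_)
        · exact Complex.continuous_ofReal.comp (Real.continuous_const_rpow hn'.ne' |>.comp continuous_neg)
        · exact Complex.continuous_ofReal.comp
            (Real.continuous_const_rpow (by positivity) |>.comp continuous_neg)
      exact this.tendsto 1
    · have : Set.Ioo (1:ℝ) 2 ∈ 𝓝[>] (1:ℝ) := Ioo_mem_nhdsGT (by norm_num)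
      filter_upwards [this] with s hs n
      exact hbound s hs.1.le hs.2.le n
end ClassBound

namespace ClassBound
open NumberField Polynomial

section
variable {K : Type*} [Field K] [NumberField K] {p₁ : ℕ} {α : K}

theorem minpoly_alpha (hp : 0 < p₁) (hα : α ^ 2 = -(p₁ : K)) :
    minpoly ℚ α = X ^ 2 + C (p₁ : ℚ) := by
  have hm : (X ^ 2 + C (p₁ : ℚ)).Monic := monic_X_pow_add_C _ (by norm_num)
  have hd : (X ^ 2 + C (p₁ : ℚ)).natDegree = 2 := natDegree_X_pow_add_C
  symm
  apply minpoly.eq_of_irreducible_of_monic _ _ hm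
  · rw [Polynomial.Monic.irreducible_iff_roots_eq_zero_of_degree_le_three hm (by omega) (by omega)]
    rw [Multiset.eq_zero_iff_forall_notMem]
    intro x hx
    rw [mem_roots hm.ne_zero] at hx
    simp [IsRoot.def] at hx
    have : (0:ℚ) < p₁ := by exact_mod_cast hp
    nlinarith [sq_nonneg x]
  · simp [hα]

theorem finrank_two (hp : 0 < p₁) (hα : α ^ 2 = -(p₁ : K)) (hK : Algebra.adjoin ℚ {α} = ⊤) :
    Module.finrank ℚ K = 2 := by
  have hi : IsIntegral ℚ α := Algebra.IsIntegral.isIntegral α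
  rw [(PowerBasis.ofAdjoinEqTop hi hK).finrank]
  rw [PowerBasis.ofAdjoinEqTop_dim hi hK, minpoly_alpha hp hα, natDegree_X_pow_add_C]

theorem trace_alpha (hp : 0 < p₁) (hα : α ^ 2 = -(p₁ : K)) (hK : Algebra.adjoin ℚ {α} = ⊤) :
    Algebra.trace ℚ K α = 0 := by
  have hi : IsIntegral ℚ α := Algebra.IsIntegral.isIntegral α
  have := (PowerBasis.ofAdjoinEqTop hi hK).trace_gen_eq_nextCoeff_minpoly
  rw [PowerBasis.ofAdjoinEqTop_gen hi hK] at this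
  rw [this, minpoly_alpha hp hα]
  rw [nextCoeff_of_natDegree_pos (by rw [natDegree_X_pow_add_C]; norm_num), natDegree_X_pow_add_C]
  simp [coeff_X_pow, coeff_C]

theorem alpha_int (hα : α ^ 2 = -(p₁ : K)) : IsIntegral ℤ α := by
  refine ⟨X ^ 2 + C (p₁ : ℤ), monic_X_pow_add_C _ (by norm_num), ?_⟩
  simp [hα]

theorem discr_ge (hp : p₁.Prime) (hp2 : p₁ ≠ 2) (hα : α ^ 2 = -(p₁ : K))
    (hK : Algebra.adjoin ℚ {α} = ⊤) : (p₁ : ℤ) ≤ |discr K| := by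
  have hr := finrank_two hp.pos hα hK
  let a : 𝓞 K := ⟨α, alpha_int hα⟩
  have ha : a ^ 2 = -(p₁ : 𝓞 K) := by
    apply RingOfIntegers.ext
    have : ((a ^ 2 : 𝓞 K) : K) = α ^ 2 := rfl
    rw [this, hα]
    simp
  have hc : Fintype.card (Module.Free.ChooseBasisIndex ℤ (𝓞 K)) = 2 := by
    rw [← Module.finrank_eq_card_chooseBasisIndex, RingOfIntegers.rank, hr]
  let b : Module.Basis (Fin 2) ℤ (𝓞 K) :=
    (RingOfIntegers.basis K).reindex (Fintype.equivFinOfCardEq hc)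
  let v : Fin 2 → 𝓞 K := ![1, a]
  have h1 : Algebra.discr ℤ v = (b.toMatrix v).det ^ 2 * Algebra.discr ℤ b := by
    rw [← Algebra.discr_of_matrix_vecMul, Module.Basis.toMatrix_map_vecMul]
  rw [discr_eq_discr] at h1
  have t1 : Algebra.trace ℤ (𝓞 K) 1 = 2 := by
    have := Algebra.coe_trace_int (K := K) (1 : 𝓞 K)
    have h3 : Algebra.trace ℚ K 1 = 2 := by
      have := Algebra.trace_algebraMap (R := ℚ) (S := K) 1
      rw [map_one] at this
      rw [this, hr]; norm_num
    simp [h3] at this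
    exact_mod_cast this
  have t2 : Algebra.trace ℤ (𝓞 K) a = 0 := by
    have := Algebra.coe_trace_int (K := K) a
    have h3 : Algebra.trace ℚ K (a : K) = 0 := trace_alpha hp.pos hα hK
    rw [h3] at this
    exact_mod_cast this
  have t3 : Algebra.trace ℤ (𝓞 K) (-(p₁ : 𝓞 K)) = -2 * p₁ := by
    have : (-(p₁ : 𝓞 K)) = (-(p₁ : ℤ)) • (1 : 𝓞 K) := by simp
    rw [this, map_smul, t1, smul_eq_mul]; ring
  have h2 : Algebra.discr ℤ v = -4 * p₁ := by
    rw [Algebra.discr_def, Matrix.det_fin_two]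
    simp only [Algebra.traceMatrix_apply, Algebra.traceForm_apply, v, Matrix.cons_val_zero,
      Matrix.cons_val_one, mul_one, one_mul, t1, t2]
    rw [← pow_two a, ha, t3]
    ring
  rw [h2] at h1
  have hpi : Prime (p₁ : ℤ) := Nat.prime_iff_prime_int.mp hp
  set k := (b.toMatrix v).det
  have hnk : ¬ (p₁ : ℤ) ∣ k := by
    rintro ⟨c, hc⟩
    rw [hc] at h1
    have h5 : (p₁ : ℤ) ∣ 4 := ⟨-(c ^ 2 * discr K), by
      have : (p₁ : ℤ) ≠ 0 := hpi.ne_zero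
      apply mul_left_cancel₀ this; linarith⟩
    have h6 : (p₁ : ℤ) ∣ 2 := hpi.dvd_of_dvd_pow (n := 2) (by norm_num; exact h5)
    have h7 : p₁ ∣ 2 := by exact_mod_cast h6
    exact hp2 ((Nat.prime_dvd_prime_iff_eq hp Nat.prime_two).mp h7)
  have hd : (p₁ : ℤ) ∣ discr K := by
    have : (p₁ : ℤ) ∣ k ^ 2 * discr K := ⟨-4, by linarith⟩
    rcases hpi.dvd_or_dvd this with h | h
    · exact absurd (hpi.dvd_of_dvd_pow h) hnk
    · exact h
  exact Int.le_of_dvd (abs_pos.mpr (discr_ne_zero K)) ((dvd_abs _ _).mpr hd)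

theorem residue_le (hp : p₁.Prime) (hp2 : p₁ ≠ 2) (hα : α ^ 2 = -(p₁ : K))
    (hK : Algebra.adjoin ℚ {α} = ⊤) :
    dedekindZeta_residue K ≤ Real.pi * classNumber K / Real.sqrt p₁ := by
  have hr := finrank_two hp.pos hα hK
  have hreal : InfinitePlace.nrRealPlaces K = 0 := by
    rw [InfinitePlace.nrRealPlaces, Fintype.card_eq_zero_iff]
    constructor
    rintro ⟨w, hw⟩
    have h1 := InfinitePlace.isReal_iff.mp hw
    set r := ComplexEmbedding.IsReal.embedding h1
    have h2 : (r α) ^ 2 = -(p₁ : ℝ) := by rw [← map_pow, hα]; simp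
    have : (0:ℝ) < p₁ := by exact_mod_cast hp.pos
    nlinarith [sq_nonneg (r α)]
  have hcpx : InfinitePlace.nrComplexPlaces K = 1 := by
    have := InfinitePlace.card_add_two_mul_card_eq_rank K
    omega
  have hreg : Units.regulator K = 1 := by
    have h0 : Units.rank K = 0 := by
      rw [Units.rank, InfinitePlace.card_eq_nrRealPlaces_add_nrComplexPlaces]; omega
    rw [Units.regulator_eq_det']
    have : IsEmpty {w : InfinitePlace K // w ≠ Units.dirichletUnitTheorem.w₀} := by
      have e := Units.equivFinRank K
      rw [h0] at e
      exact e.symm.isEmpty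
    rw [Matrix.det_isEmpty]; simp
  have hw : (2:ℝ) ≤ Units.torsionOrder K := by
    have h1 := Units.even_torsionOrder K
    have h2 := Units.torsionOrder_pos K
    have : 2 ≤ Units.torsionOrder K := by obtain ⟨c, hc⟩ := h1; omega
    exact_mod_cast this
  have hd : Real.sqrt p₁ ≤ Real.sqrt |(discr K : ℝ)| := by
    apply Real.sqrt_le_sqrt
    exact_mod_cast discr_ge hp hp2 hα hK
  have hsq : 0 < Real.sqrt p₁ := Real.sqrt_pos.mpr (by exact_mod_cast hp.pos)
  rw [dedekindZeta_residue_def, hreal, hcpx, hreg]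
  have e : Real.pi * classNumber K / Real.sqrt p₁ =
    (2 ^ 0 * (2 * Real.pi) ^ 1 * 1 * classNumber K) / (2 * Real.sqrt p₁) := by
    field_simp; 
  rw [e]
  have := Real.pi_pos
  gcongr
end
end ClassBound

namespace ClassBound
open Filter Topology

theorem sum_range_zmod {M : Type*} [AddCommMonoid M] (N : ℕ) [NeZero N] (g : ZMod N → M) :
    ∑ k ∈ Finset.range N, g (k : ZMod N) = ∑ x : ZMod N, g x := by
  refine Finset.sum_bij' (fun k _ => (k : ZMod N)) (fun x _ => x.val) ?_ ?_ ?_ ?_ ?_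
  · intro k _; exact Finset.mem_univ _
  · intro x _; exact Finset.mem_range.mpr (ZMod.val_lt x)
  · intro k hk; exact ZMod.val_cast_of_lt (Finset.mem_range.mp hk)
  · intro x _; exact ZMod.natCast_zmod_val x
  · intro k _; rfl

variable {p₁ : ℕ} [Fact p₁.Prime]

theorem chi_ne_one (hp2 : p₁ ≠ 2) : chi p₁ ≠ 1 := by
  have hp : p₁.Prime := Fact.out
  have hchar : ringChar (ZMod p₁) ≠ 2 := by rwa [ZMod.ringChar_zmod_n p₁]
  have h := quadraticChar_ne_one hchar
  intro h1
  apply h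
  ext x
  have := congrArg (fun f : DirichletCharacter ℂ p₁ => f (x : ZMod p₁)) h1
  simp only [chi_apply, MulChar.one_apply_coe] at this ⊢
  exact_mod_cast this

theorem chi_sum_zero (hp2 : p₁ ≠ 2) : ∑ x : ZMod p₁, chi p₁ x = 0 :=
  MulChar.sum_eq_zero_of_ne_one (chi_ne_one hp2)

theorem chi_bound (hp2 : p₁ ≠ 2) (n : ℕ) :
    ‖∑ k ∈ Finset.range n, chi p₁ (k : ZMod p₁)‖ ≤ p₁ := by
  have hp : p₁.Prime := Fact.out
  induction n using Nat.strong_induction_on with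
  | _ n ih =>
    rcases lt_or_ge n p₁ with h | h
    · calc _ ≤ ∑ k ∈ Finset.range n, ‖chi p₁ (k : ZMod p₁)‖ := norm_sum_le _ _
        _ ≤ ∑ k ∈ Finset.range n, 1 := Finset.sum_le_sum fun k _ => (chi p₁).norm_le_one _
        _ ≤ p₁ := by simp; exact_mod_cast h.le
    · obtain ⟨j, rfl⟩ := Nat.exists_eq_add_of_le h
      rw [Finset.sum_range_add, sum_range_zmod p₁ (fun x => chi p₁ x), chi_sum_zero hp2]
      have := ih j (by have := hp.pos; omega)
      simpa using this

theorem Lf_exists (hp2 : p₁ ≠ 2) :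
    Tendsto (fun M => ∑ n ∈ Finset.range M, chi p₁ (n : ZMod p₁) * ((n : ℂ))⁻¹) atTop
      (𝓝 (DirichletCharacter.LFunction (chi p₁) 1)) := by
  obtain ⟨Lf, h1, h2⟩ := exists_limit (fun n => chi p₁ (n : ZMod p₁)) (by simp [chi_apply]) p₁
    (chi_bound hp2)
  have h3 : ∀ᶠ s in 𝓝[>] (1:ℝ), Lf s = DirichletCharacter.LFunction (chi p₁) (s : ℂ) := by
    have : Set.Ioo (1:ℝ) 2 ∈ 𝓝[>] (1:ℝ) := Ioo_mem_nhdsGT (by norm_num)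
    filter_upwards [this] with s hs
    have hre : 1 < (s : ℂ).re := by simpa using hs.1
    rw [DirichletCharacter.LFunction_eq_LSeries _ hre]
    have h4 := (ZMod.LSeriesSummable_of_one_lt_re (chi p₁) hre).hasSum.tendsto_sum_nat
    refine tendsto_nhds_unique (h1 s hs.1.le hs.2.le) (h4.congr fun M => ?_)
    refine Finset.sum_congr rfl fun n _ => ?_
    rcases Nat.eq_zero_or_pos n with rfl | hn
    · simp [chi_apply]
    · rw [LSeries.term_of_ne_zero hn.ne', Complex.ofReal_cpow (by positivity), div_eq_mul_inv]
      push_cast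
      rw [Complex.cpow_neg]
  have h5 : Tendsto (fun s : ℝ => DirichletCharacter.LFunction (chi p₁) (s : ℂ)) (𝓝[>] 1)
      (𝓝 (DirichletCharacter.LFunction (chi p₁) 1)) := by
    apply Tendsto.mono_left _ nhdsWithin_le_nhds
    have := ((DirichletCharacter.differentiable_LFunction (chi_ne_one hp2)).continuous.comp
      Complex.continuous_ofReal).tendsto 1
    simpa [Function.comp_def] using this
  have h6 : Lf 1 = DirichletCharacter.LFunction (chi p₁) 1 :=
    tendsto_nhds_unique (h2.congr' h3) h5
  rw [← h6]
  refine (h1 1 le_rfl (by norm_num)).congr fun M => ?_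
  refine Finset.sum_congr rfl fun n _ => ?_
  rw [Real.rpow_neg_one]; push_cast; rfl

theorem gauss_shift (hp2 : p₁ ≠ 2) (ψ : AddChar (ZMod p₁) ℂ) (n : ZMod p₁) :
    ∑ a, chi p₁ a * ψ (a * n) = chi p₁ n * gaussSum (chi p₁) ψ := by
  by_cases hn : n = 0
  · subst hn
    simp [chi_sum_zero hp2, MulChar.map_zero]
  · have := gaussSum_mulShift (chi p₁) ψ (Units.mk0 n hn)
    rw [← this, Units.val_mk0, ← mul_assoc, ← map_mul]
    have h2 : chi p₁ (n * n) = 1 := by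
      rw [map_mul, ← pow_two]
      have h3 := congrArg (fun f : DirichletCharacter ℂ p₁ => f n) (chi_sq (p₁ := p₁))
      simp only [MulChar.pow_apply' _ (two_ne_zero)] at h3
      rw [h3, MulChar.one_apply (Ne.isUnit hn)]
    rw [h2, one_mul, gaussSum]
    refine Finset.sum_congr rfl fun a _ => ?_
    rw [AddChar.mulShift_apply, mul_comm a n]

theorem log_formula (θ : ℝ) (h0 : 0 < θ) (h1 : θ < 2 * Real.pi) :
    Complex.log (1 - Complex.exp (θ * Complex.I)) =
      Real.log (2 * Real.sin (θ / 2)) + ((θ - Real.pi) / 2 : ℝ) * Complex.I := by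
  have hs : 0 < Real.sin (θ / 2) := Real.sin_pos_of_pos_of_lt_pi (by linarith) (by linarith)
  have e : (1 - Complex.exp (θ * Complex.I)) =
      ((2 * Real.sin (θ / 2) : ℝ) : ℂ) * Complex.exp (((θ - Real.pi) / 2 : ℝ) * Complex.I) := by
    have a1 : (((θ - Real.pi) / 2 : ℝ) : ℂ) * Complex.I =
      (θ / 2 : ℂ) * Complex.I + -(Real.pi / 2 * Complex.I) := by push_cast; ring
    have a2 : (θ : ℂ) * Complex.I = (θ / 2 : ℂ) * Complex.I + (θ / 2 : ℂ) * Complex.I := by ring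
    rw [a1, Complex.exp_add, Complex.exp_neg, Complex.exp_pi_div_two_mul_I, Complex.inv_I, a2,
      Complex.exp_add]
    push_cast
    rw [Complex.sin]
    have a3 : Complex.exp (-(θ / 2 : ℂ) * Complex.I) * Complex.exp ((θ / 2 : ℂ) * Complex.I) = 1 := by
      rw [← Complex.exp_add]; simp
    linear_combination (-1 : ℂ) * a3 + (Complex.exp (-(θ / 2 : ℂ) * Complex.I) - Complex.exp ((θ / 2 : ℂ) * Complex.I)) * Complex.exp ((θ / 2 : ℂ) * Complex.I) * Complex.I_sq
  rw [e, Complex.log_ofReal_mul (by positivity) (Complex.exp_ne_zero _), Complex.log_exp]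
  · simp; linarith [Real.pi_pos]
  · simp; linarith [Real.pi_pos]

theorem std_eq (a : ZMod p₁) : ZMod.stdAddChar a =
    Complex.exp (((2 * Real.pi * a.val / p₁ : ℝ) : ℂ) * Complex.I) := by
  have := ZMod.stdAddChar_coe (N := p₁) (a.val : ℤ)
  rw [Int.cast_natCast, ZMod.natCast_zmod_val] at this
  rw [this]
  congr 1
  push_cast
  ring

theorem L_one_eq (hp4 : p₁ % 4 = 3) :
    gaussSum (chi p₁) ZMod.stdAddChar * DirichletCharacter.LFunction (chi p₁) 1 =
      -(Real.pi / p₁ * Complex.I) * ∑ a : ZMod p₁, chi p₁ a * (a.val : ℂ) := by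
  have hp : p₁.Prime := Fact.out
  have hp2 : p₁ ≠ 2 := by rintro rfl; omega
  set g := gaussSum (chi p₁) ZMod.stdAddChar
  have hp0 : (0:ℝ) < p₁ := by exact_mod_cast hp.pos
  set ψ : AddChar (ZMod p₁) ℂ := ZMod.stdAddChar
  have hnorm : ∀ a, ‖ψ a‖ = 1 := fun a => by
    rw [std_eq, Complex.norm_exp_ofReal_mul_I]
  -- Abel
  have hA := Complex.tendsto_tsum_powerSeries_nhdsWithin_lt (Lf_exists hp2)
  rw [tendsto_map'_iff] at hA
  have hA' := hA.const_mul g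
  have key : ∀ᶠ r : ℝ in 𝓝[<] (1:ℝ), g * ∑' n : ℕ, chi p₁ (n : ZMod p₁) * ((n : ℂ))⁻¹ * (r : ℂ) ^ n =
      ∑ a : ZMod p₁, chi p₁ a * (-Complex.log (1 - r * ψ a)) := by
    have : Set.Ioo (0:ℝ) 1 ∈ 𝓝[<] (1:ℝ) := Ioo_mem_nhdsLT (by norm_num)
    filter_upwards [this] with r hr
    have h1 : HasSum (fun n : ℕ => ∑ a : ZMod p₁, chi p₁ a * ((r * ψ a) ^ n / n))
        (∑ a : ZMod p₁, chi p₁ a * (-Complex.log (1 - r * ψ a))) := by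
      apply hasSum_sum
      intro a _
      apply HasSum.mul_left
      apply Complex.hasSum_taylorSeries_neg_log
      rw [norm_mul, hnorm, mul_one, Complex.norm_real, Real.norm_eq_abs, abs_of_pos hr.1]
      exact hr.2
    rw [← h1.tsum_eq, ← tsum_mul_left]
    congr 1
    ext n
    have h2 := gauss_shift hp2 ψ (n : ZMod p₁)
    rw [show g * (chi p₁ (n : ZMod p₁) * ((n : ℂ))⁻¹ * (r : ℂ) ^ n) =
      (chi p₁ (n : ZMod p₁) * g) * (((n : ℂ))⁻¹ * (r : ℂ) ^ n) by ring, ← h2, Finset.sum_mul]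
    refine Finset.sum_congr rfl fun a _ => ?_
    have h3 : ψ (a * (n : ZMod p₁)) = ψ a ^ n := by
      rw [← AddChar.map_nsmul_eq_pow, nsmul_eq_mul, mul_comm]
    rw [h3, mul_pow]
    ring
  have hlim : Tendsto (fun r : ℝ => ∑ a : ZMod p₁, chi p₁ a * (-Complex.log (1 - r * ψ a)))
      (𝓝[<] 1) (𝓝 (∑ a : ZMod p₁, chi p₁ a * (-Complex.log (1 - ψ a)))) := by
    apply tendsto_finsetSum
    intro a _
    by_cases ha : a = 0
    · subst ha; simp [MulChar.map_zero]
    · apply Tendsto.const_mul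
      apply Tendsto.neg
      have hne : ψ a ≠ 1 := by
        intro h
        apply ha
        apply ZMod.injective_stdAddChar (N := p₁)
        rw [AddChar.map_zero_eq_one]; exact h
      have hslit : 1 - ψ a ∈ Complex.slitPlane := by
        rw [Complex.mem_slitPlane_iff]
        left
        have h1 := hnorm a
        have h2 : (ψ a).re ≤ 1 := h1 ▸ Complex.re_le_norm _
        simp only [Complex.sub_re, Complex.one_re, sub_pos]
        apply lt_of_le_of_ne h2
        intro h3
        apply hne
        have h4 := Complex.sq_norm (ψ a)
        rw [h1, Complex.normSq_apply, h3] at h4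
        apply Complex.ext
        · simpa using h3
        · simp only [Complex.one_im]; nlinarith
      have hc : Tendsto (fun r : ℝ => 1 - (r : ℂ) * ψ a) (𝓝[<] 1) (𝓝 (1 - ψ a)) := by
        apply Tendsto.mono_left _ nhdsWithin_le_nhds
        have : Continuous (fun r : ℝ => 1 - (r : ℂ) * ψ a) := by fun_prop
        simpa using this.tendsto 1
      exact hc.clog hslit
  have hfin := tendsto_nhds_unique (hA'.congr' key) hlim
  rw [hfin]
  have hodd : ∀ a, chi p₁ (-a) = -chi p₁ a := by
    intro a
    rw [chi_apply, chi_apply, neg_eq_neg_one_mul, map_mul]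
    have : quadraticChar (ZMod p₁) (-1) = -1 := by
      rw [quadraticChar_neg_one (by rwa [ZMod.ringChar_zmod_n p₁]), ZMod.card]
      exact ZMod.χ₄_nat_three_mod_four hp4
    rw [this]; push_cast; ring
  have hlog : ∀ a : ZMod p₁, chi p₁ a * (-Complex.log (1 - ψ a)) =
      chi p₁ a * (-(Real.log (2 * Real.sin (Real.pi * a.val / p₁)) : ℂ)) +
      (chi p₁ a * (a.val : ℂ)) * (-(Real.pi / p₁ * Complex.I)) +
      chi p₁ a * (Real.pi / 2 * Complex.I) := by
    intro a
    by_cases ha : a = 0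
    · subst ha; simp [MulChar.map_zero]
    · have hv : 0 < a.val := Nat.pos_of_ne_zero (by rwa [ne_eq, ZMod.val_eq_zero])
      have hv2 : a.val < p₁ := ZMod.val_lt a
      have hv' : (0:ℝ) < a.val := by exact_mod_cast hv
      have hv2' : (a.val : ℝ) < p₁ := by exact_mod_cast hv2
      have hpi := Real.pi_pos
      rw [std_eq, log_formula _ (by positivity) (by
        rw [div_lt_iff₀ hp0]; nlinarith)]
      rw [show 2 * Real.pi * (a.val : ℝ) / p₁ / 2 = Real.pi * a.val / p₁ by ring]
      push_cast
      ring
  rw [Finset.sum_congr rfl (fun a _ => hlog a), Finset.sum_add_distrib, Finset.sum_add_distrib,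
    ← Finset.sum_mul, ← Finset.sum_mul, chi_sum_zero hp2]
  have hz : ∑ a : ZMod p₁, chi p₁ a * (-(Real.log (2 * Real.sin (Real.pi * a.val / p₁)) : ℂ)) = 0 := by
    have h1 : ∑ a : ZMod p₁, chi p₁ a * (-(Real.log (2 * Real.sin (Real.pi * a.val / p₁)) : ℂ)) =
        ∑ a : ZMod p₁, -(chi p₁ a * (-(Real.log (2 * Real.sin (Real.pi * a.val / p₁)) : ℂ))) := by
      refine (Equiv.sum_comp (Equiv.neg (ZMod p₁)) _).symm.trans ?_
      refine Finset.sum_congr rfl fun a _ => ?_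
      rw [Equiv.neg_apply, hodd]
      by_cases ha : a = 0
      · subst ha; simp [MulChar.map_zero]
      · have : (((-a).val : ℕ) : ℝ) = p₁ - a.val := by
          rw [ZMod.neg_val, if_neg ha, Nat.cast_sub (ZMod.val_lt a).le]
        rw [this, show Real.pi * ((p₁ : ℝ) - a.val) / p₁ = Real.pi - Real.pi * a.val / p₁ by
          field_simp, Real.sin_pi_sub]
        ring
    rw [Finset.sum_neg_distrib] at h1
    exact self_eq_neg.mp h1
  rw [hz]
  ring

theorem norm_L_one (hp4 : p₁ % 4 = 3) :
    Real.sqrt p₁ * ‖DirichletCharacter.LFunction (chi p₁) 1‖ =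
      Real.pi / p₁ * |((∑ a : ZMod p₁, quadraticChar (ZMod p₁) a * (a.val : ℤ) : ℤ) : ℝ)| := by
  have hp : p₁.Prime := Fact.out
  have hp2 : p₁ ≠ 2 := by rintro rfl; omega
  have h := congrArg norm (L_one_eq hp4)
  have hg : ‖gaussSum (chi p₁) ZMod.stdAddChar‖ = Real.sqrt p₁ := by
    have h1 : gaussSum (chi p₁) ZMod.stdAddChar ^ 2 = chi p₁ (-1) * Fintype.card (ZMod p₁) :=
      gaussSum_sq (chi_ne_one hp2) (MulChar.isQuadratic_iff_sq_eq_one.mpr chi_sq)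
      (ZMod.isPrimitive_stdAddChar p₁)
    have h2 := congrArg norm h1
    rw [norm_pow, norm_mul, ZMod.card] at h2
    have h3 : ‖chi p₁ (-1)‖ = 1 := by
      rw [chi_apply, quadraticChar_neg_one (by rwa [ZMod.ringChar_zmod_n p₁]), ZMod.card,
        ZMod.χ₄_nat_three_mod_four hp4]
      simp
    rw [h3, one_mul, Complex.norm_natCast] at h2
    rw [← h2, Real.sqrt_sq (norm_nonneg _)]
  rw [norm_mul, hg, norm_mul, norm_neg, norm_mul, Complex.norm_I, mul_one] at h
  rw [h]
  have h5 : (∑ a : ZMod p₁, chi p₁ a * (a.val : ℂ)) =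
    (((∑ a : ZMod p₁, quadraticChar (ZMod p₁) a * (a.val : ℤ) : ℤ) : ℝ) : ℂ) := by
    push_cast
    refine Finset.sum_congr rfl fun a _ => ?_
    rw [chi_apply]
  rw [h5, Complex.norm_real, Real.norm_eq_abs]
  congr 1
  rw [norm_div, Complex.norm_natCast, Complex.norm_real, Real.norm_eq_abs,
    abs_of_pos Real.pi_pos]
end ClassBound

namespace ClassBound
open Filter Topology NumberField

section
variable {p₁ : ℕ} [Fact p₁.Prime]

theorem LSeries_zetaMul_eq {s : ℂ} (hs : 1 < s.re) :
    LSeries (chi p₁).zetaMul s = riemannZeta s * DirichletCharacter.LFunction (chi p₁) s := by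
  rw [DirichletCharacter.zetaMul, ← ArithmeticFunction.coe_mul, LSeries_convolution']
  · rw [DirichletCharacter.LFunction_eq_LSeries _ hs]
    congr 1
    · simp_rw [← ArithmeticFunction.LSeries_zeta_eq_riemannZeta hs, ← ArithmeticFunction.natCoe_apply]
    · exact (LSeries_congr (chi p₁).apply_eq_toArithmeticFunction_apply s).symm
  · exact ArithmeticFunction.LSeriesSummable_zeta_iff.mpr hs
  · exact (LSeriesSummable_congr _ fun h ↦ ((chi p₁).apply_eq_toArithmeticFunction_apply h).symm).mpr <|
      ZMod.LSeriesSummable_of_one_lt_re (chi p₁) hs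

variable {K : Type*} [Field K] [NumberField K] {α : K}

open ComplexOrder in
theorem norm_L_le_residue (hmod : p₁ % 8 = 3) (hα : α ^ 2 = -(p₁ : K))
    (hK : Algebra.adjoin ℚ {α} = ⊤) :
    ‖DirichletCharacter.LFunction (chi p₁) 1‖ ≤ dedekindZeta_residue K := by
  have hp : p₁.Prime := Fact.out
  have hp2 : p₁ ≠ 2 := by rintro rfl; omega
  have hr : Module.finrank ℤ (𝓞 K) = 2 := by
    rw [RingOfIntegers.rank, finrank_two hp.pos hα hK]
  let a : 𝓞 K := ⟨α, alpha_int hα⟩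
  have ha : a ^ 2 = -(p₁ : 𝓞 K) := by
    apply RingOfIntegers.ext
    have : ((a ^ 2 : 𝓞 K) : K) = α ^ 2 := rfl
    rw [this, hα]
    simp
  have hta : Algebra.trace ℤ (𝓞 K) a = 0 := by
    have := Algebra.coe_trace_int (K := K) a
    have h3 : Algebra.trace ℚ K (a : K) = 0 := trace_alpha hp.pos hα hK
    rw [h3] at this
    exact_mod_cast this
  have hle := fun n hn => zetaMul_le hmod hr a ha hta n hn
  have h1 := tendsto_sub_one_mul_dedekindZeta_nhdsGT K
  have h2 : Tendsto (fun s : ℝ => ((s : ℂ) - 1) * (riemannZeta s *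
      DirichletCharacter.LFunction (chi p₁) s)) (𝓝[>] 1)
      (𝓝 (DirichletCharacter.LFunction (chi p₁) 1)) := by
    have e1 : Tendsto (fun s : ℝ => ((s : ℂ) - 1) * riemannZeta s) (𝓝[>] 1) (𝓝 1) := by
      refine riemannZeta_residue_one.comp ?_
      apply tendsto_nhdsWithin_iff.mpr
      constructor
      · apply Tendsto.mono_left _ nhdsWithin_le_nhds
        simpa using Complex.continuous_ofReal.tendsto 1
      · filter_upwards [self_mem_nhdsWithin] with s hs
        have : s ≠ 1 := ne_of_gt hs
        simpa using this
    have e2 : Tendsto (fun s : ℝ => DirichletCharacter.LFunction (chi p₁) (s : ℂ)) (𝓝[>] 1)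
        (𝓝 (DirichletCharacter.LFunction (chi p₁) 1)) := by
      apply Tendsto.mono_left _ nhdsWithin_le_nhds
      have := ((DirichletCharacter.differentiable_LFunction (chi_ne_one hp2)).continuous.comp
        Complex.continuous_ofReal).tendsto 1
      simpa [Function.comp_def] using this
    have := e1.mul e2
    rw [one_mul] at this
    refine this.congr fun s => by ring
  have h3 := h1.norm
  have h4 := h2.norm
  have hres : ‖((dedekindZeta_residue K : ℝ) : ℂ)‖ = dedekindZeta_residue K := by
    rw [Complex.norm_real, Real.norm_eq_abs, abs_of_pos (dedekindZeta_residue_pos K)]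
  rw [hres] at h3
  refine le_of_tendsto_of_tendsto h4 h3 ?_
  have hne : ∀ᶠ s : ℝ in 𝓝[>] 1, ((s : ℂ) - 1) * dedekindZeta K s ≠ 0 :=
    h1.eventually_ne (by exact_mod_cast dedekindZeta_residue_ne_zero K)
  filter_upwards [self_mem_nhdsWithin, hne] with s hs hs0
  have hs1 : (1:ℝ) < s := hs
  have hre : 1 < (s : ℂ).re := by simpa using hs1
  rw [norm_mul, norm_mul ((s : ℂ) - 1) (dedekindZeta K s)]
  have hnn : 0 ≤ ‖(s : ℂ) - 1‖ := norm_nonneg _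
  refine mul_le_mul_of_nonneg_left ?_ hnn
  rw [← LSeries_zetaMul_eq hre]
  have hsumm : LSeriesSummable (fun n ↦ (Nat.card {I : Ideal (𝓞 K) // Ideal.absNorm I = n} : ℂ)) s := by
    by_contra hc
    apply hs0
    rw [dedekindZeta, LSeries, tsum_eq_zero_of_not_summable hc, mul_zero]
  have hz := DirichletCharacter.LSeriesSummable_zetaMul (chi p₁) hre
  have hterm : ∀ (f : ℕ → ℂ) (n : ℕ), n ≠ 0 → 0 ≤ f n →
      LSeries.term f s n = (((f n).re * (n : ℝ) ^ (-s) : ℝ) : ℂ) := by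
    intro f n hn hf
    rw [LSeries.term_of_ne_zero hn, Complex.ofReal_mul, Complex.ofReal_cpow (by positivity)]
    have : f n = ((f n).re : ℂ) := by
      rw [Complex.nonneg_iff] at hf
      apply Complex.ext
      · simp
      · simp [← hf.2]
    push_cast
    rw [Complex.cpow_neg, ← this, div_eq_mul_inv]
  have hT : dedekindZeta K s = ((∑' n, ‖LSeries.term (fun n ↦ (Nat.card {I : Ideal (𝓞 K) // Ideal.absNorm I = n} : ℂ)) s n‖ : ℝ) : ℂ) := by
    rw [dedekindZeta, LSeries, Complex.ofReal_tsum]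
    congr 1
    ext n
    rcases eq_or_ne n 0 with rfl | hn
    · simp
    · rw [hterm _ n hn (by exact_mod_cast Nat.zero_le _)]
      rw [Complex.norm_real, Real.norm_eq_abs, abs_of_nonneg]
      simp only [Complex.natCast_re]
      positivity
  rw [hT, Complex.norm_real, Real.norm_eq_abs, abs_of_nonneg (tsum_nonneg fun _ => norm_nonneg _)]
  calc ‖LSeries (chi p₁).zetaMul s‖ ≤ ∑' n, ‖LSeries.term (chi p₁).zetaMul s n‖ :=
        norm_tsum_le_tsum_norm hz.norm
    _ ≤ _ := by
      apply Summable.tsum_le_tsum _ hz.norm hsumm.norm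
      intro n
      rcases eq_or_ne n 0 with rfl | hn
      · simp
      · apply LSeries.norm_term_le
        have h5 := hle n hn
        have h6 := DirichletCharacter.zetaMul_nonneg (χ := chi p₁) chi_sq n
        have h7 := Complex.re_eq_norm.mpr h6
        have h8 := Complex.re_eq_norm.mpr (h6.trans h5)
        change _ ≤ ‖(idCount K n : ℂ)‖
        rw [← h7, ← h8]
        exact (Complex.le_def.mp h5).1

theorem class_bound (hmod : p₁ % 8 = 3) (hα : α ^ 2 = -(p₁ : K))
    (hK : Algebra.adjoin ℚ {α} = ⊤) :
    |∑ a : ZMod p₁, quadraticChar (ZMod p₁) a * (a.val : ℤ)| ≤ p₁ * classNumber K := by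
  have hp : p₁.Prime := Fact.out
  have hp2 : p₁ ≠ 2 := by rintro rfl; omega
  have h1 := norm_L_one (p₁ := p₁) (by omega)
  have h2 := norm_L_le_residue hmod hα hK
  have h3 := residue_le hp hp2 hα hK
  have hp0 : (0:ℝ) < p₁ := by exact_mod_cast hp.pos
  have hsq := Real.sqrt_pos.mpr hp0
  have hpi := Real.pi_pos
  set S := ∑ a : ZMod p₁, quadraticChar (ZMod p₁) a * (a.val : ℤ)
  have h4 : Real.pi / p₁ * |(S : ℝ)| ≤ Real.pi * classNumber K := by
    rw [← h1]
    calc _ ≤ Real.sqrt p₁ * (Real.pi * classNumber K / Real.sqrt p₁) := by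
          gcongr; exact h2.trans h3
      _ = _ := by field_simp
  have h5 : |(S : ℝ)| ≤ p₁ * classNumber K := by
    have : |(S : ℝ)| = (p₁ / Real.pi) * (Real.pi / p₁ * |(S : ℝ)|) := by field_simp
    rw [this]
    calc _ ≤ (p₁ / Real.pi) * (Real.pi * classNumber K) := by gcongr
      _ = _ := by field_simp
  exact_mod_cast h5
end
end ClassBound

namespace Stick

theorem exists_red (E : Type*) [NormedField E] [IsUltrametricDist E] :
    ∃ (O : Subring E) (_ : ∀ x, x ∈ O ↔ ‖x‖ ≤ 1) (I : Ideal O) (_ : I.IsMaximal),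
      ∀ x : O, x ∈ I ↔ ‖(x : E)‖ < 1 := by
  let O : Subring E :=
    { carrier := {x | ‖x‖ ≤ 1}
      mul_mem' := by
        intro a b ha hb
        simp only [Set.mem_setOf_eq] at *
        rw [norm_mul]; exact mul_le_one₀ ha (norm_nonneg _) hb
      one_mem' := by simp
      add_mem' := by
        intro a b ha hb
        simp only [Set.mem_setOf_eq] at *
        exact (IsUltrametricDist.norm_add_le_max a b).trans (max_le ha hb)
      zero_mem' := by simp
      neg_mem' := by intro a ha; simpa using ha }
  have hO : ∀ x, x ∈ O ↔ ‖x‖ ≤ 1 := fun x => Iff.rfl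
  let I : Ideal O :=
    { carrier := {x | ‖(x : E)‖ < 1}
      add_mem' := by
        intro a b ha hb
        simp only [Set.mem_setOf_eq] at *
        exact (IsUltrametricDist.norm_add_le_max (a : E) b).trans_lt (max_lt ha hb)
      zero_mem' := by simp
      smul_mem' := by
        intro c x hx
        simp only [Set.mem_setOf_eq, smul_eq_mul] at *
        have := (hO c).1 c.2
        push_cast
        rw [norm_mul]
        nlinarith [norm_nonneg (x : E), norm_nonneg (c : E)] }
  have hI : ∀ x : O, x ∈ I ↔ ‖(x : E)‖ < 1 := fun x => Iff.rfl
  refine ⟨O, hO, I, ?_, hI⟩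
  rw [Ideal.isMaximal_iff]
  constructor
  · rw [hI]; simp
  · intro J x hIJ hx hxJ
    have h1 : ‖(x : E)‖ = 1 := by
      have a := (hO x).1 x.2
      rw [hI] at hx
      linarith
    have hx0 : (x : E) ≠ 0 := by
      intro h; rw [h] at h1; simp at h1
    have h2 : (x : E)⁻¹ ∈ O := by rw [hO]; simp [h1]
    have := J.mul_mem_left ⟨_, h2⟩ hxJ
    convert this
    apply Subtype.ext
    simp [hx0]

/-- Teichmüller character. -/
theorem exists_teich {E : Type*} [NormedField E] [IsAlgClosed E] [CharZero E]
    {p f : ℕ} [hp : Fact p.Prime] (hpE : ‖(p : E)‖ < 1)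
    {F : Type*} [Field F] [Fintype F] (hcard : Fintype.card F = p ^ f)
    {O : Subring E} (hO : ∀ x, x ∈ O ↔ ‖x‖ ≤ 1) {k : Type*} [Field k] (red : O →+* k)
    (hred : ∀ x : O, red x = 0 ↔ ‖(x : E)‖ < 1) :
    ∃ (ω : MulChar F E) (hω : ∀ x, ω x ∈ O) (ι : F →+* k), ∀ x, red ⟨ω x, hω x⟩ = ι x := by
  have hkp : CharP k p := by
    rw [CharP.charP_iff_prime_eq_zero hp.out]
    have := (hred (p : O)).2 (by simpa using hpE)
    simpa using this
  have norm_one : ∀ (x : E) (n : ℕ), x ^ n = 1 → n ≠ 0 → ‖x‖ = 1 := by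
    intro x n hx hn
    have := congrArg norm hx
    rw [norm_pow, norm_one] at this
    exact (pow_eq_one_iff_of_nonneg (norm_nonneg _) hn).1 this
  have hFp : CharP F p := by
    obtain ⟨r, hr⟩ := CharP.exists F
    have hrp := CharP.char_is_prime F r
    have hc := FiniteField.card F r
    obtain ⟨n, -, hn⟩ := hc
    rw [hcard] at hn
    have : r ∣ p := by
      apply (Nat.prime_iff.1 hrp).dvd_of_dvd_pow (n := f)
      rw [hn]; exact dvd_pow_self _ n.pos.ne'
    rwa [(Nat.prime_dvd_prime_iff_eq hrp hp.out).1 this] at hr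
  let _ := ZMod.algebra k p
  let _ := ZMod.algebra F p
  set q := Fintype.card F with hq
  have hq1 : 1 < q := Fintype.one_lt_card
  have hu : Fintype.card Fˣ = q - 1 := by rw [Fintype.card_units]
  have : NeZero ((q - 1 : ℕ) : E) := ⟨by exact_mod_cast (by omega : q - 1 ≠ 0)⟩
  obtain ⟨z0, hz0⟩ := HasEnoughRootsOfUnity.exists_primitiveRoot E (q - 1)
  have hz0O : ∀ i : ℕ, z0 ^ i ∈ O := by
    intro i
    have : ‖z0‖ = 1 := norm_one _ _ hz0.pow_eq_one (by omega)
    rw [hO]; simp [this]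
  let z : O := ⟨z0, by simpa using hz0O 1⟩
  have hz : IsPrimitiveRoot z (q - 1) :=
    IsPrimitiveRoot.of_map_of_injective (f := O.subtype) (by exact hz0) O.subtype_injective
  have hfac := X_pow_sub_C_eq_prod hz (by omega : 0 < q - 1) (one_pow (q - 1))
  have hfac' := congrArg (Polynomial.map red) hfac
  simp only [Polynomial.map_sub, Polynomial.map_pow, Polynomial.map_X, Polynomial.map_C,
    Polynomial.map_prod, map_one, mul_one, Polynomial.map_one] at hfac'
  have hsp : ((Polynomial.X ^ q - Polynomial.X : Polynomial (ZMod p)).map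
      (algebraMap (ZMod p) k)).Splits := by
    have : (Polynomial.X ^ q - Polynomial.X : Polynomial (ZMod p)).map (algebraMap (ZMod p) k)
       = Polynomial.X * ∏ i ∈ Finset.range (q - 1), (Polynomial.X - Polynomial.C (red (z ^ i))) := by
      rw [← hfac']
      simp only [Polynomial.map_sub, Polynomial.map_pow, Polynomial.map_X]
      rw [mul_sub, mul_one, ← pow_succ']
      congr 2; omega
    rw [this]
    refine Polynomial.Splits.mul (Polynomial.Splits.X) (Polynomial.Splits.prod fun i _ => Polynomial.Splits.X_sub_C _)
  let ι : F →ₐ[ZMod p] k :=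
    Polynomial.IsSplittingField.lift F (Polynomial.X ^ q - Polynomial.X : Polynomial (ZMod p)) hsp
  obtain ⟨γ, hγ⟩ := IsCyclic.exists_generator (α := Fˣ)
  have hγ1 : (ι γ) ^ (q - 1) = 1 := by
    rw [← map_pow]
    have : (γ : F) ^ (q - 1) = 1 := FiniteField.pow_card_sub_one_eq_one _ γ.ne_zero
    rw [this, map_one]
  have hroot := congrArg (Polynomial.eval (ι γ)) hfac'
  simp only [Polynomial.eval_sub, Polynomial.eval_pow, Polynomial.eval_X, Polynomial.eval_one,
    hγ1, sub_self, Polynomial.eval_prod, Polynomial.eval_C] at hroot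
  obtain ⟨i, -, hi⟩ := Finset.prod_eq_zero_iff.1 hroot.symm
  have hi' : ι γ = red (z ^ i) := sub_eq_zero.1 hi
  have hzu : IsUnit (z0 ^ i) := (hz0.isUnit (by omega)).pow i
  have hmem : hzu.unit ∈ rootsOfUnity (Fintype.card Fˣ) E := by
    rw [mem_rootsOfUnity, hu]
    apply Units.ext
    simp only [Units.val_pow_eq_pow_val, IsUnit.unit_spec, Units.val_one]
    rw [← pow_mul, mul_comm, pow_mul, hz0.pow_eq_one, one_pow]
  let ω : MulChar F E := MulChar.ofRootOfUnity hmem hγ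
  have hωγ : ω γ = z0 ^ i := by
    rw [MulChar.ofRootOfUnity_spec hmem hγ]; simp
  have hω : ∀ x, ω x ∈ O := by
    intro x
    by_cases hx : x = 0
    · rw [hx, MulChar.map_zero]; exact O.zero_mem
    · rw [hO]
      have : ω x ^ (q - 1) = 1 := by
        rw [← map_pow, FiniteField.pow_card_sub_one_eq_one _ hx, map_one]
      rw [norm_one _ _ this (by omega)]
  refine ⟨ω, hω, ι.toRingHom, ?_⟩
  intro x
  by_cases hx : x = 0
  · subst hx
    have : (⟨ω 0, hω 0⟩ : O) = 0 := Subtype.ext (MulChar.map_zero ω)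
    rw [this]; simp
  · have hγf := hγ (Units.mk0 x hx)
    rw [← mem_powers_iff_mem_zpowers] at hγf
    obtain ⟨j, hj⟩ := hγf
    have hxj : x = (γ : F) ^ j := by
      have := congrArg Units.val hj
      simpa using this.symm
    have : (⟨ω x, hω x⟩ : O) = (z ^ i) ^ j := by
      apply Subtype.ext
      simp only [SubmonoidClass.coe_pow]
      rw [hxj, map_pow, hωγ]
    rw [this, map_pow, ← hi', hxj]
    simp

end Stick

namespace Stick

theorem sum_inv_trace {p : ℕ} [hp : Fact p.Prime]
    {F : Type*} [Field F] [Fintype F] [Algebra (ZMod p) F] (hq2 : 2 < Fintype.card F) :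
    ∑ x : Fˣ, ((x⁻¹ : Fˣ) : F) * algebraMap (ZMod p) F (Algebra.trace (ZMod p) F x) = -1 := by
  set d := Module.finrank (ZMod p) F with hd
  have hcard : Fintype.card F = p ^ d := by
    rw [Module.card_eq_pow_finrank (K := ZMod p), ZMod.card]
  have hdpos : 0 < d := Module.finrank_pos
  have h1 : ∀ x : Fˣ, ((x⁻¹ : Fˣ) : F) * algebraMap (ZMod p) F (Algebra.trace (ZMod p) F x) =
      ∑ i ∈ Finset.range d, ((x : F) ^ (p ^ i - 1)) := by
    intro x
    rw [FiniteField.algebraMap_trace_eq_sum_pow, Finset.mul_sum, Nat.card_zmod]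
    refine Finset.sum_congr rfl fun i _ => ?_
    have : 0 < p ^ i := pow_pos hp.out.pos _
    obtain ⟨e, he⟩ : ∃ e, p ^ i = e + 1 := ⟨p ^ i - 1, by omega⟩
    rw [he, Nat.add_sub_cancel, pow_succ']
    rw [← mul_assoc]; simp
  simp_rw [h1]
  rw [Finset.sum_comm]
  have h2 : ∀ i ∈ Finset.range d, ∑ x : Fˣ, ((x : F) ^ (p ^ i - 1)) = if i = 0 then -1 else 0 := by
    intro i hi
    rw [Finset.mem_range] at hi
    rw [FiniteField.sum_pow_units, hcard]
    by_cases h0 : i = 0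
    · simp [h0]
    · have h3 : p ^ i < p ^ d := Nat.pow_lt_pow_right hp.out.one_lt hi
      have h4 : 1 < p ^ i := Nat.one_lt_pow h0 hp.out.one_lt
      rw [if_neg h0, if_neg]
      intro h
      have := Nat.le_of_dvd (by omega) h
      omega
  rw [Finset.sum_congr rfl h2]
  simp [hdpos]

theorem norm_p_le {E : Type*} [NormedField E] [IsUltrametricDist E]
    {p : ℕ} [hp : Fact p.Prime] {ζ : E} (hζ : IsPrimitiveRoot ζ p) :
    ‖(p : E)‖ ≤ ‖ζ - 1‖ ^ (p - 1) := by
  have hp1 : p - 1 + 1 = p := Nat.sub_add_cancel hp.out.one_le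
  have hζ' : IsPrimitiveRoot ζ (p - 1 + 1) := by rwa [hp1]
  have h := hζ'.prod_one_sub_pow_eq_order
  have h2 : (p : E) = ((p - 1 : ℕ) : E) + 1 := by
    rw [← Nat.cast_add_one, hp1]
  have hn : ‖ζ‖ = 1 := by
    have := congrArg norm hζ.pow_eq_one
    rw [norm_pow, norm_one] at this
    exact (pow_eq_one_iff_of_nonneg (norm_nonneg _) hp.out.ne_zero).1 this
  rw [h2, ← h, norm_prod]
  calc _ ≤ ∏ _k ∈ Finset.range (p - 1), ‖ζ - 1‖ := by
        refine Finset.prod_le_prod (fun i _ => norm_nonneg _) fun i _ => ?_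
        rw [norm_sub_rev, ← mul_geom_sum, norm_mul]
        apply mul_le_of_le_one_right (norm_nonneg _)
        apply IsUltrametricDist.norm_sum_le_of_forall_le_of_nonneg zero_le_one
        intro j _
        simp [hn]
    _ = _ := by simp

theorem exists_gauss_base {E : Type*} [NormedField E] [IsUltrametricDist E] [IsAlgClosed E]
    [CharZero E] {p : ℕ} [hp : Fact p.Prime] (hpE : ‖(p : E)‖ < 1)
    {F : Type*} [Field F] [Fintype F] [Algebra (ZMod p) F] (hq2 : 2 < Fintype.card F)
    {ζ : E} (hζ : IsPrimitiveRoot ζ p) (ψ : AddChar F E)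
    (hψ : ∀ x, ψ x = ζ ^ (Algebra.trace (ZMod p) F x).val) :
    ∃ τ : MulChar F E, orderOf τ = Fintype.card F - 1 ∧ ‖ζ - 1‖ = ‖gaussSum τ ψ‖ := by
  obtain ⟨O, hO, I, hI, hmemO⟩ := exists_red E
  let _ : Field (O ⧸ I) := Ideal.Quotient.field I
  set red : O →+* O ⧸ I := Ideal.Quotient.mk I with hreddef
  have hred : ∀ x : O, red x = 0 ↔ ‖(x : E)‖ < 1 := by
    intro x; rw [← hmemO, hreddef, Ideal.Quotient.eq_zero_iff_mem]
  have hcard : Fintype.card F = p ^ (Module.finrank (ZMod p) F) := by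
    rw [Module.card_eq_pow_finrank (K := ZMod p), ZMod.card]
  obtain ⟨ω, hω, ι, hι⟩ := exists_teich hpE hcard hO red hred
  have hkp : CharP (O ⧸ I) p := by
    rw [CharP.charP_iff_prime_eq_zero hp.out]
    have := (hred (p : O)).2 (by simpa using hpE)
    simpa using this
  have hιinj : Function.Injective ι := ι.injective
  -- order
  have hunit : Fintype.card Fˣ = Fintype.card F - 1 := by rw [Fintype.card_units]
  have hord : orderOf ω = Fintype.card F - 1 := by
    apply Nat.dvd_antisymm
    · rw [← hunit]; exact orderOf_dvd_of_pow_eq_one (MulChar.pow_card_eq_one ω)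
    · obtain ⟨γ, hγ⟩ := IsCyclic.exists_generator (α := Fˣ)
      have h1 : orderOf γ = Fintype.card F - 1 := by
        rw [orderOf_eq_card_of_forall_mem_zpowers hγ, Nat.card_eq_fintype_card, hunit]
      rw [← h1]
      apply orderOf_dvd_of_pow_eq_one
      apply Units.ext
      apply hιinj
      rw [Units.val_pow_eq_pow_val, Units.val_one, map_pow, map_one, ← hι, ← map_pow, ← map_one red]
      congr 1
      apply Subtype.ext
      simp only [SubmonoidClass.coe_pow, OneMemClass.coe_one]
      rw [← MulChar.pow_apply_coe, pow_orderOf_eq_one, MulChar.one_apply_coe]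
  have hωinv : ω⁻¹ ≠ 1 := by
    intro h
    rw [inv_eq_one] at h
    rw [h, orderOf_one] at hord
    omega
  -- zeta
  have hn : ‖ζ‖ = 1 := by
    have := congrArg norm hζ.pow_eq_one
    rw [norm_pow, norm_one] at this
    exact (pow_eq_one_iff_of_nonneg (norm_nonneg _) hp.out.ne_zero).1 this
  let z : O := ⟨ζ, by rw [hO, hn]⟩
  have hz1 : red z = 1 := by
    have h1 : z ^ p = 1 := Subtype.ext (by simpa using hζ.pow_eq_one)
    have h2 : (red z - 1) ^ p = 0 := by
      rw [sub_pow_char, one_pow, ← map_pow, h1, map_one, sub_self]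
    exact sub_eq_zero.1 (pow_eq_zero_iff hp.out.ne_zero |>.1 h2)
  let v : F → ℕ := fun x => (Algebra.trace (ZMod p) F x).val
  let A : O := ∑ x : Fˣ, (⟨ω ((x⁻¹ : Fˣ) : F), hω _⟩ : O) * ∑ i ∈ Finset.range (v x), z ^ i
  have hg : gaussSum ω⁻¹ ψ = (ζ - 1) * (A : E) := by
    have h0 : ∑ x : F, ω⁻¹ x = 0 := MulChar.sum_eq_zero_of_ne_one hωinv
    have h1 : gaussSum ω⁻¹ ψ = ∑ x : F, ω⁻¹ x * (ψ x - 1) := by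
      simp_rw [mul_sub, mul_one, Finset.sum_sub_distrib, h0, sub_zero]
      rfl
    have h2 : ∑ x : F, ω⁻¹ x * (ψ x - 1) = ∑ x : Fˣ, ω⁻¹ (x : F) * (ψ x - 1) := by
      rw [← Finset.sum_subset (Finset.subset_univ (Finset.univ.map ⟨fun x : Fˣ => (x : F), Units.val_injective⟩))]
      · simp
      · intro x _ hx
        have : x = 0 := by
          by_contra h
          exact hx (by simp only [Finset.mem_map, Finset.mem_univ, true_and]; exact ⟨Units.mk0 x h, rfl⟩)
        rw [this, MulChar.map_zero, zero_mul]
    rw [h1, h2]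
    simp only [A, AddSubmonoidClass.coe_finset_sum, MulMemClass.coe_mul, Finset.mul_sum,
      SubmonoidClass.coe_pow]
    refine Finset.sum_congr rfl fun x _ => ?_
    rw [hψ, ← mul_geom_sum, MulChar.inv_apply', Finset.mul_sum, Finset.mul_sum]
    refine Finset.sum_congr rfl fun i _ => ?_
    simp only [Units.val_inv_eq_inv_val, z]
    ring
  have hA : red A = -1 := by
    have hs := sum_inv_trace (p := p) hq2
    have := congrArg ι hs
    rw [map_neg, map_one] at this
    rw [← this, map_sum]
    simp only [A, map_sum, map_mul, map_pow, hz1, one_pow, Finset.sum_const, Finset.card_range, hι]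
    refine Finset.sum_congr rfl fun x _ => ?_
    congr 1
    have : algebraMap (ZMod p) F (Algebra.trace (ZMod p) F x) = (v x : F) := by
      conv_lhs => rw [← ZMod.natCast_zmod_val (Algebra.trace (ZMod p) F (x : F))]
      rw [map_natCast]
    rw [this]; simp
  refine ⟨ω⁻¹, by rw [orderOf_inv, hord], ?_⟩
  have hA1 : ‖(A : E)‖ = 1 := by
    have h1 := (hO A).1 A.2
    have h2 : ¬ ‖(A : E)‖ < 1 := by
      rw [← hred, hA]; simp
    linarith
  rw [hg, norm_mul, hA1, mul_one]

end Stick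

namespace Stick

theorem norm_mulChar_le {E : Type*} [NormedField E] {F : Type*} [Field F] [Fintype F]
    (χ : MulChar F E) (x : F) : ‖χ x‖ ≤ 1 := by
  by_cases hx : x = 0
  · rw [hx, MulChar.map_zero]; simp
  · have hq1 : 1 < Fintype.card F := Fintype.one_lt_card
    have : χ x ^ (Fintype.card F - 1) = 1 := by
      rw [← map_pow, FiniteField.pow_card_sub_one_eq_one _ hx, map_one]
    have h2 := congrArg norm this
    rw [norm_pow, norm_one] at h2
    rw [(pow_eq_one_iff_of_nonneg (norm_nonneg _) (by omega)).1 h2]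

theorem norm_jacobiSum_le {E : Type*} [NormedField E] [IsUltrametricDist E]
    {F : Type*} [Field F] [Fintype F] (χ φ : MulChar F E) : ‖jacobiSum χ φ‖ ≤ 1 := by
  apply IsUltrametricDist.norm_sum_le_of_forall_le_of_nonneg zero_le_one
  intro x _
  rw [norm_mul]
  exact mul_le_one₀ (norm_mulChar_le _ _) (norm_nonneg _) (norm_mulChar_le _ _)

theorem norm_gauss_mul_le {E : Type*} [NormedField E] [IsUltrametricDist E]
    {F : Type*} [Field F] [Fintype F] (χ φ : MulChar F E) (h : χ * φ ≠ 1) (ψ : AddChar F E) :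
    ‖gaussSum χ ψ‖ * ‖gaussSum φ ψ‖ ≤ ‖gaussSum (χ * φ) ψ‖ := by
  rw [← norm_mul, ← jacobiSum_mul_nontrivial h, norm_mul]
  exact mul_le_of_le_one_right (norm_nonneg _) (norm_jacobiSum_le _ _)

theorem gauss_frob {E : Type*} [Field E] {p : ℕ} [hp : Fact p.Prime]
    {F : Type*} [Field F] [Fintype F] [CharP F p] (ψ : AddChar F E)
    (hψ : ∀ x, ψ (x ^ p) = ψ x) (χ : MulChar F E) :
    gaussSum (χ ^ p) ψ = gaussSum χ ψ := by
  rw [gaussSum, gaussSum]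
  have hb : Function.Bijective (fun x : F => x ^ p) := by
    have := (frobenius F p).injective
    exact (Finite.injective_iff_bijective).1 this
  rw [← hb.sum_comp (fun x => χ x * ψ x)]
  refine Finset.sum_congr rfl fun x _ => ?_
  rw [MulChar.pow_apply' _ hp.out.ne_zero, map_pow, hψ]

theorem psi_frob {E : Type*} [Field E] {p : ℕ} [hp : Fact p.Prime]
    {F : Type*} [Field F] [Fintype F] [Algebra (ZMod p) F] {ζ : E} (ψ : AddChar F E)
    (hψ : ∀ x, ψ x = ζ ^ (Algebra.trace (ZMod p) F x).val) (x : F) : ψ (x ^ p) = ψ x := by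
  rw [hψ, hψ]
  congr 2
  have hF : CharP F p := charP_of_injective_algebraMap (algebraMap (ZMod p) F).injective p
  have := Algebra.trace_eq_of_algEquiv (FiniteField.frobeniusAlgEquiv (ZMod p) F p) x
  simpa using this

theorem psi_ne_one {E : Type*} [Field E] {p : ℕ} [hp : Fact p.Prime]
    {F : Type*} [Field F] [Fintype F] [Algebra (ZMod p) F] {ζ : E} (hζ : IsPrimitiveRoot ζ p)
    (ψ : AddChar F E)
    (hψ : ∀ x, ψ x = ζ ^ (Algebra.trace (ZMod p) F x).val) : ψ ≠ 1 := by
  intro h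
  obtain ⟨x, hx⟩ := Algebra.trace_surjective (ZMod p) F 1
  have h1 := hψ x
  rw [hx, h, AddChar.one_apply] at h1
  have : Fact (1 < p) := ⟨hp.out.one_lt⟩
  rw [ZMod.val_one, pow_one] at h1
  exact hζ.ne_one hp.out.one_lt h1.symm

theorem gauss_bound {E : Type*} [NormedField E] [IsUltrametricDist E] [IsAlgClosed E]
    [CharZero E] {p : ℕ} [hp : Fact p.Prime] (hpE : ‖(p : E)‖ < 1)
    {F : Type*} [Field F] [Fintype F] [Algebra (ZMod p) F] (hq2 : 2 < Fintype.card F)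
    {f : ℕ} (hcard : Fintype.card F = p ^ f)
    {ζ : E} (hζ : IsPrimitiveRoot ζ p) (ψ : AddChar F E)
    (hψ : ∀ x, ψ x = ζ ^ (Algebra.trace (ZMod p) F x).val)
    (φ : MulChar F E) (n : ℕ) (hn : 0 < n) (hφ : orderOf φ = n) :
    ∃ j : ℕ, j < n ∧ j.Coprime n ∧
      ‖(p : E)‖ ^ (∑ t ∈ Finset.range f, p ^ t * j % n) ≤ ‖gaussSum φ ψ‖ ^ n := by
  have hF : CharP F p := charP_of_injective_algebraMap (algebraMap (ZMod p) F).injective p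
  obtain ⟨τ, hτ, hπ⟩ := exists_gauss_base hpE hq2 hζ ψ hψ
  set q := Fintype.card F with hq
  have hgen : ∀ χ : MulChar F E, χ ∈ Subgroup.zpowers τ := by
    have hex : NeZero (Monoid.exponent Fˣ) := ⟨(Monoid.exponent_pos.2 Monoid.ExponentExists.of_finite).ne'⟩
    have hc : Nat.card (MulChar F E) = q - 1 := by
      rw [MulChar.card_eq_card_units_of_hasEnoughRootsOfUnity, Nat.card_eq_fintype_card, Fintype.card_units]
    have := Subgroup.eq_top_of_card_eq (Subgroup.zpowers τ) (by rw [Nat.card_zpowers, hτ, hc])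
    intro χ; rw [this]; trivial
  obtain ⟨b, hb, hbφ⟩ : ∃ b, b < q - 1 ∧ τ ^ b = φ := by
    have h1 := hgen φ
    rw [← mem_powers_iff_mem_zpowers] at h1
    obtain ⟨c, hc⟩ := h1
    refine ⟨c % (q - 1), Nat.mod_lt _ (by omega), ?_⟩
    rw [← hτ, pow_mod_orderOf]; exact hc
  obtain ⟨j, hj⟩ : q - 1 ∣ b * n := by
    rw [← hτ]
    apply orderOf_dvd_of_pow_eq_one
    rw [pow_mul, hbφ, ← hφ, pow_orderOf_eq_one]
  have hjn : j < n := by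
    by_contra hcon
    have : (q - 1) * n ≤ (q - 1) * j := Nat.mul_le_mul_left _ (by omega)
    have : b * n < (q - 1) * n := Nat.mul_lt_mul_of_pos_right hb hn
    omega
  have hcop : j.Coprime n := by
    have hdn := Nat.gcd_dvd_right j n
    obtain ⟨n', hn'⟩ := hdn
    obtain ⟨j', hj'⟩ := Nat.gcd_dvd_left j n
    have hgpos : 0 < Nat.gcd j n := Nat.gcd_pos_of_pos_right _ hn
    have h1 : φ ^ n' = 1 := by
      have : b * n' = (q - 1) * j' := by
        apply Nat.eq_of_mul_eq_mul_left hgpos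
        calc Nat.gcd j n * (b * n') = b * (Nat.gcd j n * n') := by ring
          _ = (q - 1) * (Nat.gcd j n * j') := by rw [← hn', ← hj', hj]
          _ = _ := by ring
      rw [← hbφ, ← pow_mul, this, pow_mul, ← hτ, pow_orderOf_eq_one, one_pow]
    have h2 := orderOf_dvd_of_pow_eq_one h1
    rw [hφ] at h2
    have hn'0 : 0 < n' := by
      rcases Nat.eq_zero_or_pos n' with h | h
      · rw [h] at hn'; omega
      · exact h
    have h3 := Nat.le_of_dvd hn'0 h2
    have h4 : Nat.gcd j n * n' ≤ 1 * n' := by rw [← hn']; omega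
    have := Nat.le_of_mul_le_mul_right h4 hn'0
    unfold Nat.Coprime; omega
  have hqf : p ^ f * j = b * n + j := by
    rw [← hcard, hj]
    have : q = q - 1 + 1 := by omega
    nlinarith
  let r : ℕ → ℕ := fun t => p ^ t * j % n
  let B : ℕ → ℕ := fun t => p ^ t * j / n
  let c : ℕ → ℕ := fun t => p * r t / n
  have hpt : ∀ t, p ^ t * j = n * B t + r t := fun t => (Nat.div_add_mod _ _).symm
  have hstep : ∀ t, B (t + 1) = p * B t + c t := by
    intro t
    change p ^ (t + 1) * j / n = p * B t + p * r t / n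
    rw [pow_succ', mul_assoc, hpt t, mul_add, show p * (n * B t) = n * (p * B t) by ring,
      Nat.mul_add_div hn]
  have hrstep : ∀ t, n * c t + r (t + 1) = p * r t := by
    intro t
    have h1 := hpt (t + 1)
    rw [pow_succ', mul_assoc, hpt t, hstep] at h1
    nlinarith
  have hBf : B f = b := by
    simp only [B]
    rw [hqf, mul_comm b, Nat.mul_add_div hn, Nat.div_eq_of_lt hjn, add_zero]
  have hrf : r f = j := by
    simp only [r]
    rw [hqf, mul_comm b, Nat.mul_add_mod, Nat.mod_eq_of_lt hjn]
  have hr0 : r 0 = j := by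
    simp only [r]
    rw [pow_zero, one_mul, Nat.mod_eq_of_lt hjn]
  have hBle : ∀ t, t ≤ f → B t < q - 1 := by
    intro t ht
    rw [← hBf] at hb
    refine lt_of_le_of_lt ?_ hb
    exact Nat.div_le_div_right (Nat.mul_le_mul_right _ (Nat.pow_le_pow_right hp.out.pos ht))
  have hτne : ∀ a, 0 < a → a < q - 1 → τ ^ a ≠ 1 := by
    intro a h1 h2 h3
    have := Nat.le_of_dvd h1 (orderOf_dvd_of_pow_eq_one h3)
    omega
  have hadd : ∀ a d, a + d < q - 1 →
      ‖ζ - 1‖ ^ d * ‖gaussSum (τ ^ a) ψ‖ ≤ ‖gaussSum (τ ^ (a + d)) ψ‖ := by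
    intro a d
    induction d with
    | zero => intro _; simp
    | succ d ih =>
      intro h
      have h1 := ih (by omega)
      have h2 := norm_gauss_mul_le (τ ^ (a + d)) τ
        (by rw [← pow_succ]; exact hτne _ (by omega) (by omega)) ψ
      rw [← pow_succ, ← hπ] at h2
      rw [← add_assoc]
      refine le_trans ?_ h2
      rw [pow_succ]
      nlinarith [norm_nonneg (ζ - 1)]
  have hmain : ∀ t, t ≤ f → ‖ζ - 1‖ ^ (∑ i ∈ Finset.range t, c i) ≤ ‖gaussSum (τ ^ B t) ψ‖ := by
    intro t
    induction t with
    | zero =>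
      intro _
      have : B 0 = 0 := by simp only [B]; rw [pow_zero, one_mul, Nat.div_eq_of_lt hjn]
      rw [this, pow_zero, gaussSum_one_left (psi_ne_one hζ ψ hψ)]
      simp
    | succ t ih =>
      intro h
      have h1 := ih (by omega)
      have h2 := hadd (p * B t) (c t) (by rw [← hstep]; exact hBle _ h)
      rw [← hstep, mul_comm p, pow_mul, gauss_frob ψ (psi_frob ψ hψ)] at h2
      refine le_trans ?_ h2
      rw [Finset.sum_range_succ, pow_add, mul_comm]
      exact mul_le_mul_of_nonneg_left h1 (by positivity)
  have hsum : ∀ t, n * ∑ i ∈ Finset.range t, c i + r t + ∑ i ∈ Finset.range t, r i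
      = p * ∑ i ∈ Finset.range t, r i + r 0 := by
    intro t
    induction t with
    | zero => simp
    | succ t ih =>
      rw [Finset.sum_range_succ, Finset.sum_range_succ]
      have := hrstep t
      nlinarith
  have hsf : n * ∑ i ∈ Finset.range f, c i = (p - 1) * ∑ i ∈ Finset.range f, r i := by
    have h1 := hsum f
    rw [hrf, hr0] at h1
    have h2 : p = p - 1 + 1 := by have := hp.out.pos; omega
    generalize p - 1 = p' at *
    rw [h2] at h1
    nlinarith
  refine ⟨j, hjn, hcop, ?_⟩
  have h1 := hmain f le_rfl
  rw [hBf, hbφ] at h1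
  calc ‖(p : E)‖ ^ (∑ t ∈ Finset.range f, r t)
      ≤ (‖ζ - 1‖ ^ (p - 1)) ^ (∑ t ∈ Finset.range f, r t) :=
        pow_le_pow_left₀ (norm_nonneg _) (norm_p_le hζ) _
    _ = (‖ζ - 1‖ ^ (∑ i ∈ Finset.range f, c i)) ^ n := by
        rw [← pow_mul, ← hsf, mul_comm, pow_mul]
    _ ≤ _ := pow_le_pow_left₀ (by positivity) h1 _

end Stick

namespace Elem

theorem chi_neg_one {p₁ : ℕ} [Fact p₁.Prime] (hmod : p₁ % 8 = 3) :
    quadraticChar (ZMod p₁) (-1) = -1 := by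
  have h2 : ringChar (ZMod p₁) ≠ 2 := by rw [ZMod.ringChar_zmod_n]; omega
  rw [quadraticChar_neg_one h2, ZMod.card, ZMod.χ₄_nat_three_mod_four (by omega)]

theorem chi_two {p₁ : ℕ} [Fact p₁.Prime] (hmod : p₁ % 8 = 3) :
    quadraticChar (ZMod p₁) 2 = -1 := by
  have h2 : ringChar (ZMod p₁) ≠ 2 := by rw [ZMod.ringChar_zmod_n]; omega
  rw [quadraticChar_two h2, ZMod.card, ZMod.χ₈_nat_eq_if_mod_eight]
  simp [hmod]; omega

theorem chi_sq {p₁ : ℕ} [Fact p₁.Prime] {k : ℕ} (hk : k.Coprime p₁) :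
    quadraticChar (ZMod p₁) (k : ZMod p₁) ^ 2 = 1 := by
  apply quadraticChar_sq_one
  rw [Ne, ZMod.natCast_eq_zero_iff]
  intro h
  have h1 := Nat.eq_one_of_dvd_coprimes hk h dvd_rfl
  exact (Fact.out : p₁.Prime).one_lt.ne' h1

theorem chi_p {p₁ m p f : ℕ} [Fact p₁.Prime] (hm : 1 ≤ m) (hcop : p.Coprime p₁)
    (hf : orderOf (p : ZMod (p₁ ^ m)) = f) (hodd : f % 2 = 1) :
    quadraticChar (ZMod p₁) (p : ZMod p₁) = 1 := by
  have h1 : ((p : ZMod p₁)) ^ f = 1 := by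
    have h2 : (p : ZMod (p₁ ^ m)) ^ f = 1 := by rw [← hf, pow_orderOf_eq_one]
    have h3 := congrArg (ZMod.castHom (dvd_pow_self p₁ (by omega)) (ZMod p₁)) h2
    rwa [map_pow, map_natCast, map_one] at h3
  have h4 := congrArg (quadraticChar (ZMod p₁)) h1
  rw [map_pow, map_one] at h4
  have h5 := chi_sq hcop
  obtain ⟨e, he⟩ : ∃ e, f = 2 * e + 1 := ⟨f / 2, by omega⟩
  rw [he, pow_succ, pow_mul, h5, one_pow, one_mul] at h4
  exact h4

theorem exists_pow {p₁ m p f : ℕ} [hp₁ : Fact p₁.Prime] (hmod : p₁ % 8 = 3) (hm : 1 ≤ m)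
    (hcop : p.Coprime p₁) (hf : orderOf (p : ZMod (p₁ ^ m)) = f) (hodd : f % 2 = 1)
    (htot : 2 * f = Nat.totient (p₁ ^ m)) (k l : ℕ) (hk : k.Coprime p₁) (hl : l.Coprime p₁)
    (h : quadraticChar (ZMod p₁) (k : ZMod p₁) = quadraticChar (ZMod p₁) (l : ZMod p₁)) :
    ∃ t < f, (k : ZMod (p₁ ^ m)) = p ^ t * l := by
  have hχp := chi_p hm hcop hf hodd
  have : NeZero (p₁ ^ m) := ⟨(pow_pos hp₁.out.pos m).ne'⟩
  let P : (ZMod (p₁ ^ m))ˣ := ZMod.unitOfCoprime p (hcop.pow_right m)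
  let κ : (ZMod (p₁ ^ m))ˣ := ZMod.unitOfCoprime k (hk.pow_right m)
  let ll : (ZMod (p₁ ^ m))ˣ := ZMod.unitOfCoprime l (hl.pow_right m)
  have hPo : orderOf P = f := by
    rw [← hf, ← orderOf_units, ZMod.coe_unitOfCoprime]
  let c := ZMod.castHom (dvd_pow_self p₁ (by omega : m ≠ 0)) (ZMod p₁)
  let X : (ZMod (p₁ ^ m))ˣ → ℤ := fun u => quadraticChar (ZMod p₁) (c u)
  have hXmul : ∀ u v, X (u * v) = X u * X v := by intro u v; simp [X, -quadraticChar_apply, -quadraticChar_apply]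
  have hXP : ∀ u ∈ Subgroup.zpowers P, X u = 1 := by
    intro u hu
    rw [← mem_powers_iff_mem_zpowers] at hu
    obtain ⟨t, rfl⟩ := hu
    simp [X, -quadraticChar_apply, P, hχp]
  have hidx : (Subgroup.zpowers P).index = 2 := by
    have h1 := (Subgroup.zpowers P).card_mul_index
    rw [Nat.card_zpowers, hPo, Nat.card_eq_fintype_card, ZMod.card_units_eq_totient, ← htot] at h1
    have : 0 < f := by omega
    nlinarith
  have hneg : (-1 : (ZMod (p₁ ^ m))ˣ) ∉ Subgroup.zpowers P := by
    intro h1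
    have := hXP _ h1
    simp [X, -quadraticChar_apply, chi_neg_one hmod] at this
  have hmem : κ * ll⁻¹ ∈ Subgroup.zpowers P := by
    by_contra hcon
    have h1 : (-1) * (κ * ll⁻¹) ∈ Subgroup.zpowers P := by
      rw [Subgroup.mul_mem_iff_of_index_two hidx]
      tauto
    have h2 := hXP _ h1
    rw [hXmul, hXmul] at h2
    have h3 : X (-1) = -1 := by simp [X, -quadraticChar_apply, chi_neg_one hmod]
    have h4 : X ll⁻¹ * X ll = 1 := by rw [← hXmul]; simp [X, -quadraticChar_apply, -quadraticChar_apply]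
    have h5 : X κ = X ll := by simpa [X, -quadraticChar_apply, κ, ll] using h
    rw [h3, h5, mul_comm (X ll), h4] at h2
    omega
  rw [← mem_powers_iff_mem_zpowers] at hmem
  obtain ⟨t, ht⟩ := hmem
  refine ⟨t % f, Nat.mod_lt _ (by omega), ?_⟩
  have h1 : P ^ (t % f) = κ * ll⁻¹ := by rw [← hPo, pow_mod_orderOf]; exact ht
  have h2 : κ = P ^ (t % f) * ll := by rw [h1]; simp
  have h3 := congrArg Units.val h2
  simpa [κ, ll, P] using h3

theorem sum_chi_mul {p₁ : ℕ} [hp₁ : Fact p₁.Prime] (hmod : p₁ % 8 = 3) (M : ℕ) :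
    ∑ k ∈ Finset.range (p₁ * M), quadraticChar (ZMod p₁) (k : ZMod p₁) * (k : ℤ) =
      M * ∑ a : ZMod p₁, quadraticChar (ZMod p₁) a * (a.val : ℤ) := by
  have h0 : ∑ k ∈ Finset.range p₁, quadraticChar (ZMod p₁) (k : ZMod p₁) = 0 := by
    rw [ClassBound.sum_range_zmod p₁ (fun a => quadraticChar (ZMod p₁) a)]
    apply quadraticChar_sum_zero
    rw [ZMod.ringChar_zmod_n]; omega
  have h1 : ∑ k ∈ Finset.range p₁, quadraticChar (ZMod p₁) (k : ZMod p₁) * (k : ℤ) =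
      ∑ a : ZMod p₁, quadraticChar (ZMod p₁) a * (a.val : ℤ) := by
    rw [← ClassBound.sum_range_zmod p₁ (fun a => quadraticChar (ZMod p₁) a * (a.val : ℤ))]
    refine Finset.sum_congr rfl fun k hk => ?_
    rw [ZMod.val_natCast_of_lt (Finset.mem_range.1 hk)]
  induction M with
  | zero => simp
  | succ M ih =>
    rw [mul_add, mul_one, Finset.sum_range_add, ih]
    have : ∀ x ∈ Finset.range p₁, quadraticChar (ZMod p₁) ((p₁ * M + x : ℕ) : ZMod p₁) *
        ((p₁ * M + x : ℕ) : ℤ) = (p₁ * M : ℤ) * quadraticChar (ZMod p₁) (x : ZMod p₁) +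
          quadraticChar (ZMod p₁) (x : ZMod p₁) * (x : ℤ) := by
      intro x _
      push_cast
      rw [CharP.cast_eq_zero, zero_mul, zero_add]
      ring
    rw [Finset.sum_congr rfl this, Finset.sum_add_distrib, ← Finset.mul_sum, h0, h1]
    push_cast
    ring

theorem sum_coprime (n : ℕ) (hn : 2 < n) :
    2 * ∑ u ∈ (Finset.range n).filter (fun u => u.Coprime n), u = n * Nat.totient n := by
  have hS : (Finset.range n).filter (fun u => u.Coprime n) =
      (Finset.range n).filter (fun u => n.Coprime u) := by
    ext u; simp [Nat.coprime_comm]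
  rw [hS]
  have h1 : ∑ u ∈ (Finset.range n).filter (fun u => n.Coprime u), u =
      ∑ u ∈ (Finset.range n).filter (fun u => n.Coprime u), (n - u) := by
    refine Finset.sum_bij (fun u _ => n - u) ?_ ?_ ?_ ?_
    · intro u hu
      simp only [Finset.mem_filter, Finset.mem_range] at *
      have : u ≠ 0 := by
        rintro rfl
        have := hu.2
        rw [Nat.coprime_zero_right] at this; omega
      refine ⟨by omega, ?_⟩
      rw [Nat.coprime_self_sub_right (by omega)]; exact hu.2
    · intro a ha b hb hab
      simp only [Finset.mem_filter, Finset.mem_range] at *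
      omega
    · intro u hu
      simp only [Finset.mem_filter, Finset.mem_range] at hu
      have : u ≠ 0 := by
        rintro rfl
        have := hu.2
        rw [Nat.coprime_zero_right] at this; omega
      refine ⟨n - u, ?_, by omega⟩
      simp only [Finset.mem_filter, Finset.mem_range]
      refine ⟨by omega, ?_⟩
      rw [Nat.coprime_self_sub_right (by omega)]; exact hu.2
    · intro u hu
      simp only [Finset.mem_filter, Finset.mem_range] at *
      omega
  rw [two_mul]
  nth_rw 2 [h1]
  rw [← Finset.sum_add_distrib]
  rw [Nat.totient, mul_comm, ← smul_eq_mul, ← Finset.sum_const]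
  refine Finset.sum_congr rfl fun u hu => ?_
  simp only [Finset.mem_filter, Finset.mem_range] at *
  omega

theorem R_bound {p₁ m p f h : ℕ} [hp₁ : Fact p₁.Prime] (hmod : p₁ % 8 = 3) (hm : 1 ≤ m)
    (hcop : p.Coprime p₁) (hf : orderOf (p : ZMod (p₁ ^ m)) = f) (hodd : f % 2 = 1)
    (htot : 2 * f = Nat.totient (p₁ ^ m))
    (hcb : |∑ a : ZMod p₁, quadraticChar (ZMod p₁) a * (a.val : ℤ)| ≤ p₁ * h)
    (j : ℕ) (hj : j.Coprime (p₁ ^ m)) :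
    2 * ∑ t ∈ Finset.range f, p ^ t * j % p₁ ^ m ≤ p₁ ^ m * (f + h) := by
  set n := p₁ ^ m with hn
  have hnpos : 0 < n := pow_pos hp₁.out.pos m
  have hp₁n : p₁ ≤ n := Nat.le_of_dvd hnpos (dvd_pow_self p₁ (by omega))
  have hcopn : ∀ u : ℕ, u.Coprime n ↔ u.Coprime p₁ := by
    intro u; rw [hn, Nat.coprime_pow_right_iff (by omega)]
  have hχp := chi_p hm hcop hf hodd
  set X : ℕ → ℤ := fun u => quadraticChar (ZMod p₁) (u : ZMod p₁) with hX
  have hXmod : ∀ u, X (u % n) = X u := by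
    intro u
    simp only [hX]
    congr 1
    rw [ZMod.natCast_eq_natCast_iff]
    exact (Nat.mod_modEq u n).of_dvd (dvd_pow_self p₁ (by omega))
  have hXp : ∀ t, X (p ^ t * j) = X j := by
    intro t; simp only [hX]; push_cast; rw [map_mul, map_pow, hχp]; simp
  have hR : ∑ t ∈ Finset.range f, p ^ t * j % n =
      ∑ u ∈ (Finset.range n).filter (fun u => u.Coprime n ∧ X u = X j), u := by
    refine Finset.sum_bij (fun t _ => p ^ t * j % n) ?_ ?_ ?_ ?_
    · intro t ht
      simp only [Finset.mem_filter, Finset.mem_range]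
      refine ⟨Nat.mod_lt _ hnpos, ?_, by rw [hXmod, hXp]⟩
      have : (p ^ t * j).Coprime n := Nat.Coprime.mul_left (((hcopn p).2 hcop).pow_left t) hj
      rw [Nat.Coprime, ← Nat.gcd_rec, Nat.gcd_comm]; exact this
    · intro a ha b hb hab
      rw [Finset.mem_range] at ha hb
      have h1 : p ^ a * j ≡ p ^ b * j [MOD n] := hab
      have h2 : p ^ a ≡ p ^ b [MOD n] := Nat.ModEq.cancel_right_of_coprime (by rw [Nat.gcd_comm]; exact hj) h1
      rw [← ZMod.natCast_eq_natCast_iff] at h2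
      push_cast at h2
      rw [← hf] at ha hb
      have hpu : IsUnit (p : ZMod n) := (ZMod.isUnit_iff_coprime p n).2 ((hcopn p).2 hcop)
      have h3 : hpu.unit ^ a = hpu.unit ^ b := Units.ext (by simpa using h2)
      have h4 : orderOf hpu.unit = orderOf (p : ZMod n) := by
        rw [← orderOf_units, IsUnit.unit_spec]
      exact pow_injOn_Iio_orderOf (by rw [h4]; exact ha) (by rw [h4]; exact hb) h3
    · intro u hu
      simp only [Finset.mem_filter, Finset.mem_range] at hu
      obtain ⟨t, ht, he⟩ := exists_pow hmod hm hcop hf hodd htot u j ((hcopn u).1 hu.2.1)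
        ((hcopn j).1 hj) hu.2.2
      refine ⟨t, Finset.mem_range.2 ht, ?_⟩
      have : ((u : ℕ) : ZMod n) = ((p ^ t * j : ℕ) : ZMod n) := by push_cast; exact he
      rw [ZMod.natCast_eq_natCast_iff] at this
      have h2 : u % n = p ^ t * j % n := this
      rw [← h2, Nat.mod_eq_of_lt hu.1]
    · intro t _; rfl
  have hXj : X j ^ 2 = 1 := chi_sq ((hcopn j).1 hj)
  have hT : ∑ u ∈ (Finset.range n).filter (fun u => u.Coprime n), X u * (u : ℤ) =
      (p₁ ^ (m - 1) : ℕ) * ∑ a : ZMod p₁, quadraticChar (ZMod p₁) a * (a.val : ℤ) := by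
    rw [← sum_chi_mul hmod]
    have : p₁ * p₁ ^ (m - 1) = n := by rw [← pow_succ', hn]; congr 1; omega
    rw [this, Finset.sum_filter]
    refine Finset.sum_congr rfl fun u _ => ?_
    split_ifs with hu
    · rfl
    · have : (u : ZMod p₁) = 0 := by
        rw [ZMod.natCast_eq_zero_iff]
        rw [hcopn, Nat.coprime_comm] at hu
        by_contra hc
        exact hu ((Nat.Prime.coprime_iff_not_dvd hp₁.out).2 hc)
      rw [this]; simp
  have h2R : 2 * ((∑ t ∈ Finset.range f, p ^ t * j % n : ℕ) : ℤ) =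
      ((∑ u ∈ (Finset.range n).filter (fun u => u.Coprime n), u : ℕ) : ℤ) +
      X j * ∑ u ∈ (Finset.range n).filter (fun u => u.Coprime n), X u * (u : ℤ) := by
    rw [hR, ← Finset.filter_filter, Finset.sum_filter]
    push_cast
    rw [Finset.mul_sum, Finset.mul_sum, ← Finset.sum_add_distrib]
    refine Finset.sum_congr rfl fun u hu => ?_
    simp only [Finset.mem_filter, Finset.mem_range] at hu
    have hXu : X u ^ 2 = 1 := chi_sq ((hcopn u).1 hu.2)
    rcases sq_eq_one_iff.1 hXu with h1 | h1 <;>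
    rcases sq_eq_one_iff.1 hXj with h2 | h2 <;> simp [h1, h2] <;> ring
  have hS := sum_coprime n (by omega)
  rw [← htot] at hS
  have hS' : ((∑ u ∈ (Finset.range n).filter (fun u => u.Coprime n), u : ℕ) : ℤ) = n * f := by
    have : ∑ u ∈ (Finset.range n).filter (fun u => u.Coprime n), u = n * f := by nlinarith
    rw [this]; push_cast; rfl
  rw [hT, hS'] at h2R
  have hfin : X j * ((p₁ ^ (m - 1) : ℕ) * ∑ a : ZMod p₁, quadraticChar (ZMod p₁) a * (a.val : ℤ)) ≤ n * h := by
    have hnM : (n : ℤ) = (p₁ ^ (m - 1) : ℕ) * p₁ := by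
      have : p₁ ^ (m - 1) * p₁ = n := by rw [← pow_succ, hn]; congr 1; omega
      rw [← this]; push_cast; rfl
    have habs : |X j| = 1 := by
      rcases sq_eq_one_iff.1 hXj with h2 | h2 <;> simp [h2]
    refine (le_abs_self _).trans ?_
    rw [abs_mul, habs, one_mul, abs_mul, Nat.abs_cast, hnM, mul_assoc]
    exact mul_le_mul_of_nonneg_left hcb (by positivity)
  zify
  push_cast at h2R ⊢
  rw [h2R, mul_add]
  push_cast at hfin
  linarith

theorem gauss_sq_bound {E : Type*} [NormedField E] [IsUltrametricDist E] [IsAlgClosed E]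
    [CharZero E] {p₁ m p f h : ℕ} [hp₁ : Fact p₁.Prime] (hmod : p₁ % 8 = 3) (hm : 1 ≤ m)
    (hcop : p.Coprime p₁) (hf : orderOf (p : ZMod (p₁ ^ m)) = f) (hodd : f % 2 = 1)
    (htot : 2 * f = Nat.totient (p₁ ^ m))
    (hcb : |∑ a : ZMod p₁, quadraticChar (ZMod p₁) a * (a.val : ℤ)| ≤ p₁ * h)
    [hp : Fact p.Prime] (hpE : ‖(p : E)‖ < 1)
    {F : Type*} [Field F] [Fintype F] [Algebra (ZMod p) F] (hq2 : 2 < Fintype.card F)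
    (hcard : Fintype.card F = p ^ f)
    {ζ : E} (hζ : IsPrimitiveRoot ζ p) (ψ : AddChar F E)
    (hψ : ∀ x, ψ x = ζ ^ (Algebra.trace (ZMod p) F x).val)
    (φ : MulChar F E) (hφ : orderOf φ = p₁ ^ m) :
    ‖(p : E)‖ ^ (f + h) ≤ ‖gaussSum φ ψ‖ ^ 2 := by
  have hnpos : 0 < p₁ ^ m := pow_pos hp₁.out.pos m
  obtain ⟨j, -, hj, hb⟩ := Stick.gauss_bound hpE hq2 hcard hζ ψ hψ φ _ hnpos hφ
  have hR := R_bound hmod hm hcop hf hodd htot hcb j hj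
  rw [← pow_le_pow_iff_left₀ (by positivity) (by positivity) hnpos.ne']
  calc (‖(p : E)‖ ^ (f + h)) ^ (p₁ ^ m) = ‖(p : E)‖ ^ (p₁ ^ m * (f + h)) := by
        rw [← pow_mul, mul_comm]
    _ ≤ ‖(p : E)‖ ^ (2 * ∑ t ∈ Finset.range f, p ^ t * j % p₁ ^ m) :=
        pow_le_pow_of_le_one (norm_nonneg _) hpE.le hR
    _ = (‖(p : E)‖ ^ (∑ t ∈ Finset.range f, p ^ t * j % p₁ ^ m)) ^ 2 := by rw [mul_comm, pow_mul]
    _ ≤ (‖gaussSum φ ψ‖ ^ (p₁ ^ m)) ^ 2 := pow_le_pow_left₀ (by positivity) hb 2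
    _ = _ := by rw [← pow_mul, ← pow_mul, mul_comm]

end Elem

namespace Elem

/-- The quadratic Gauss sum attached to a `p₁`-th root of unity `w`. -/
noncomputable def delta (p₁ : ℕ) [Fact p₁.Prime] {E : Type*} [Field E] (w : E) : E :=
  ∑ a ∈ Finset.range p₁, ((quadraticChar (ZMod p₁) (a : ZMod p₁) : ℤ) : E) * w ^ a

theorem delta_eq {p₁ : ℕ} [hp₁ : Fact p₁.Prime] {E : Type*} [Field E] {w : E} (hw : w ^ p₁ = 1) :
    delta p₁ w = gaussSum ((quadraticChar (ZMod p₁)).ringHomComp (Int.castRingHom E))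
      (AddChar.zmodChar p₁ hw) := by
  rw [gaussSum, ← ClassBound.sum_range_zmod p₁
    (fun a => ((quadraticChar (ZMod p₁)).ringHomComp (Int.castRingHom E)) a *
      (AddChar.zmodChar p₁ hw) a), delta]
  refine Finset.sum_congr rfl fun a _ => ?_
  rw [AddChar.zmodChar_apply']
  rfl

theorem delta_pow {p₁ : ℕ} [hp₁ : Fact p₁.Prime] (hmod : p₁ % 8 = 3) {E : Type*} [Field E] {w : E}
    (hw : w ^ p₁ = 1) (l : ℕ) :
    delta p₁ (w ^ l) = ((quadraticChar (ZMod p₁) (l : ZMod p₁) : ℤ) : E) * delta p₁ w := by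
  by_cases hl : (l : ZMod p₁) = 0
  · rw [hl, MulChar.map_zero, Int.cast_zero, zero_mul]
    rw [ZMod.natCast_eq_zero_iff] at hl
    obtain ⟨e, rfl⟩ := hl
    rw [pow_mul, hw, one_pow, delta]
    simp only [one_pow, mul_one]
    rw [← Int.cast_sum, ClassBound.sum_range_zmod p₁ (fun a => quadraticChar (ZMod p₁) a),
      quadraticChar_sum_zero, Int.cast_zero]
    rw [ZMod.ringChar_zmod_n]; omega
  · have hwl : (w ^ l) ^ p₁ = 1 := by rw [← pow_mul, mul_comm, pow_mul, hw, one_pow]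
    rw [delta_eq hwl, delta_eq hw]
    have h1 : AddChar.zmodChar p₁ hwl = (AddChar.zmodChar p₁ hw).mulShift ((Units.mk0 _ hl : (ZMod p₁)ˣ) : ZMod p₁) := by
      ext a
      rw [AddChar.mulShift_apply, Units.val_mk0, ← ZMod.natCast_zmod_val a, ← Nat.cast_mul,
        AddChar.zmodChar_apply', AddChar.zmodChar_apply', pow_mul]
    rw [h1, gaussSum_mulShift_eq]
    congr 1
    rw [MulChar.IsQuadratic.inv ((quadraticChar_isQuadratic _).comp _)]
    rfl

theorem delta_sq {p₁ : ℕ} [hp₁ : Fact p₁.Prime] (hmod : p₁ % 8 = 3) {E : Type*} [Field E]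
    [CharZero E] {w : E} (hw : IsPrimitiveRoot w p₁) : delta p₁ w ^ 2 = -(p₁ : E) := by
  have h2 : ringChar (ZMod p₁) ≠ 2 := by rw [ZMod.ringChar_zmod_n]; omega
  rw [delta_eq hw.pow_eq_one, gaussSum_sq]
  · rw [ZMod.card, MulChar.ringHomComp_apply, chi_neg_one hmod]; simp
  · rw [MulChar.ringHomComp_ne_one_iff (Int.castRingHom E).injective_int]
    exact quadraticChar_ne_one h2
  · exact (quadraticChar_isQuadratic _).comp _
  · exact AddChar.zmodChar_primitive_of_primitive_root p₁ hw

theorem sum_chi_block {p₁ : ℕ} [hp₁ : Fact p₁.Prime] {E : Type*} [Field E] (y : E) (M : ℕ) :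
    ∑ k ∈ Finset.range (p₁ * M), ((quadraticChar (ZMod p₁) (k : ZMod p₁) : ℤ) : E) * y ^ k =
      (∑ b ∈ Finset.range M, (y ^ p₁) ^ b) * delta p₁ y := by
  induction M with
  | zero => simp
  | succ M ih =>
    rw [mul_add, mul_one, Finset.sum_range_add, ih, Finset.sum_range_succ, add_mul]
    congr 1
    rw [delta, Finset.mul_sum]
    refine Finset.sum_congr rfl fun a _ => ?_
    push_cast
    rw [CharP.cast_eq_zero, zero_mul, zero_add, pow_add, pow_mul]
    ring

theorem geom_zero {E : Type*} [Field E] {y : E} {M : ℕ} (h : y ^ M = 1) (h1 : y ≠ 1) :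
    ∑ b ∈ Finset.range M, y ^ b = 0 := by
  rw [geom_sum_eq h1, h]; simp

theorem sum_pow_root {E : Type*} [Field E] {ξ : E} {n : ℕ} (hξ : IsPrimitiveRoot ξ n) (l : ℕ) :
    ∑ k ∈ Finset.range n, (ξ ^ l) ^ k = if n ∣ l then (n : E) else 0 := by
  split_ifs with h
  · rw [(hξ.pow_eq_one_iff_dvd l).2 h]; simp
  · apply geom_zero
    · rw [← pow_mul, mul_comm, pow_mul, hξ.pow_eq_one, one_pow]
    · rwa [Ne, hξ.pow_eq_one_iff_dvd l]

theorem sum_chi_root {p₁ : ℕ} [hp₁ : Fact p₁.Prime] (hmod : p₁ % 8 = 3) {E : Type*} [Field E]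
    {ξ : E} {M : ℕ} (hM : 0 < M) (hξ : IsPrimitiveRoot ξ (p₁ * M)) (l : ℕ) :
    ∑ k ∈ Finset.range (p₁ * M), ((quadraticChar (ZMod p₁) (k : ZMod p₁) : ℤ) : E) * (ξ ^ l) ^ k =
      if M ∣ l then (M : E) * ((quadraticChar (ZMod p₁) ((l / M : ℕ) : ZMod p₁) : ℤ) : E) *
        delta p₁ (ξ ^ M) else 0 := by
  rw [sum_chi_block]
  split_ifs with h
  · obtain ⟨c, rfl⟩ := h
    have hw : (ξ ^ M) ^ p₁ = 1 := by rw [← pow_mul, mul_comm, hξ.pow_eq_one]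
    rw [Nat.mul_div_cancel_left _ hM, pow_mul ξ M c, delta_pow hmod hw, ← pow_mul (ξ ^ M),
      mul_comm c, pow_mul (ξ ^ M), hw]
    simp [mul_assoc]
  · rw [geom_zero, zero_mul]
    · rw [← pow_mul, ← pow_mul, mul_comm, pow_mul, hξ.pow_eq_one, one_pow]
    · rw [← pow_mul, Ne, hξ.pow_eq_one_iff_dvd, mul_comm l, Nat.mul_dvd_mul_iff_left hp₁.out.pos]
      exact h

/-- Ramanujan sums are integers. -/
theorem sum_coprime_root {p₁ : ℕ} [hp₁ : Fact p₁.Prime] {E : Type*} [Field E]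
    {ξ : E} {M : ℕ} (hξ : ξ ^ (p₁ * M) = 1) (l : ℕ) :
    ∃ z : ℤ, ∑ k ∈ (Finset.range (p₁ * M)).filter (fun k => k.Coprime p₁), (ξ ^ l) ^ k = z := by
  have key : ∀ (y : E) (M : ℕ), ∑ k ∈ (Finset.range (p₁ * M)).filter (fun k => ¬ k.Coprime p₁), y ^ k =
      ∑ b ∈ Finset.range M, (y ^ p₁) ^ b := by
    intro y M
    induction M with
    | zero => simp
    | succ M ih =>
      rw [Finset.sum_filter] at ih ⊢
      rw [mul_add, mul_one, Finset.sum_range_add, ih, Finset.sum_range_succ]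
      congr 1
      rw [Finset.sum_eq_single 0]
      · rw [if_pos, add_zero, pow_mul]
        rw [add_zero, Nat.coprime_comm, Nat.Prime.coprime_iff_not_dvd hp₁.out]; simp
      · intro b hb hb0
        rw [if_neg]
        rw [not_not, Nat.coprime_comm, Nat.Prime.coprime_iff_not_dvd hp₁.out]
        intro h
        have h1 : p₁ ∣ b := (Nat.dvd_add_right (dvd_mul_right _ _)).1 h
        have := Nat.le_of_dvd (by omega) h1
        rw [Finset.mem_range] at hb; omega
      · intro h; exact absurd (Finset.mem_range.2 hp₁.out.pos) h
  have int : ∀ (y : E) (r : ℕ), y ^ r = 1 → ∃ z : ℤ, ∑ b ∈ Finset.range r, y ^ b = z := by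
    intro y r hy
    by_cases h : y = 1
    · exact ⟨r, by simp [h]⟩
    · exact ⟨0, by rw [geom_zero hy h]; simp⟩
  have hy : (ξ ^ l) ^ (p₁ * M) = 1 := by rw [← pow_mul, mul_comm, pow_mul, hξ, one_pow]
  obtain ⟨z1, h1⟩ := int (ξ ^ l) (p₁ * M) hy
  obtain ⟨z2, h2⟩ := int ((ξ ^ l) ^ p₁) M (by rw [← pow_mul, hy])
  refine ⟨z1 - z2, ?_⟩
  have := Finset.sum_filter_add_sum_filter_not (Finset.range (p₁ * M)) (fun k => k.Coprime p₁)
    (fun k => (ξ ^ l) ^ k)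
  rw [key, h2, h1] at this
  push_cast
  rw [← this]; ring

end Elem

namespace Elem

theorem xi_prim {E : Type*} [Field E] {F : Type*} [Field F] [Fintype F] (φ : MulChar F E)
    {γ : Fˣ} (hγ : ∀ x : Fˣ, x ∈ Subgroup.zpowers γ) : IsPrimitiveRoot (φ γ) (orderOf φ) := by
  constructor
  · rw [← MulChar.pow_apply_coe, pow_orderOf_eq_one, MulChar.one_apply_coe]
  · intro l hl
    apply orderOf_dvd_of_pow_eq_one
    rw [MulChar.eq_iff hγ, MulChar.pow_apply_coe, MulChar.one_apply_coe, hl]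

theorem exists_nat_pow {F : Type*} [Field F] [Fintype F]
    {γ : Fˣ} (hγ : ∀ x : Fˣ, x ∈ Subgroup.zpowers γ) (x : F) (hx : x ≠ 0) :
    ∃ l : ℕ, x = (γ : F) ^ l := by
  have h := hγ (Units.mk0 x hx)
  rw [← mem_powers_iff_mem_zpowers] at h
  obtain ⟨j, hj⟩ := h
  exact ⟨j, by simpa using (congrArg Units.val hj).symm⟩

theorem phi_base {E : Type*} [Field E] {p n : ℕ} [hp : Fact p.Prime]
    {F : Type*} [Field F] [Fintype F] [Algebra (ZMod p) F] (φ : MulChar F E)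
    (hφ : φ ^ n = 1) (hc : (p - 1).Coprime n) (c : ZMod p) (hc0 : c ≠ 0) :
    φ (algebraMap (ZMod p) F c) = 1 := by
  have hc' : algebraMap (ZMod p) F c ≠ 0 := by
    rwa [Ne, map_eq_zero]
  have h1 : φ (algebraMap (ZMod p) F c) ^ (p - 1) = 1 := by
    rw [← map_pow, ← map_pow, ZMod.pow_card_sub_one_eq_one hc0, map_one, map_one]
  have h2 : φ (algebraMap (ZMod p) F c) ^ n = 1 := by
    have := MulChar.pow_apply_coe φ n (Units.mk0 _ hc')
    rw [hφ, MulChar.one_apply_coe] at this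
    exact this.symm
  have h3 := (pow_gcd_eq_one (a := φ (algebraMap (ZMod p) F c))).2 ⟨h1, h2⟩
  rwa [Nat.Coprime.gcd_eq_one hc, pow_one] at h3

theorem sum_psi_int {E : Type*} [Field E] {p : ℕ} [hp : Fact p.Prime]
    {F : Type*} [Field F] [Fintype F] [Algebra (ZMod p) F] {ζ : E} (hζ : IsPrimitiveRoot ζ p)
    (ψ : AddChar F E) (hψ : ∀ x, ψ x = ζ ^ (Algebra.trace (ZMod p) F x).val) (x : F) :
    ∃ z : ℤ, ∑ c : (ZMod p)ˣ, ψ (algebraMap (ZMod p) F c * x) = z := by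
  have h1 : ∀ c : ZMod p, ψ (algebraMap (ZMod p) F c * x) =
      AddChar.zmodChar p hζ.pow_eq_one (c * Algebra.trace (ZMod p) F x) := by
    intro c
    rw [hψ, ← Algebra.smul_def, map_smul, AddChar.zmodChar_apply, smul_eq_mul]
  have h2 := AddChar.sum_mulShift (Algebra.trace (ZMod p) F x)
    (AddChar.zmodChar_primitive_of_primitive_root p hζ)
  simp_rw [← h1] at h2
  have h3 : ∑ c : ZMod p, ψ (algebraMap (ZMod p) F c * x) =
      1 + ∑ c : (ZMod p)ˣ, ψ (algebraMap (ZMod p) F c * x) := by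
    rw [← Finset.add_sum_erase _ _ (Finset.mem_univ (0 : ZMod p))]
    congr 1
    · simp
    · symm
      refine Finset.sum_bij (fun c _ => (c : ZMod p)) ?_ ?_ ?_ ?_
      · intro c _; simp
      · intro a _ b _ h; exact Units.ext h
      · intro b hb
        have : b ≠ 0 := Finset.ne_of_mem_erase hb
        exact ⟨Units.mk0 b this, Finset.mem_univ _, rfl⟩
      · intro c _; rfl
  rw [h3] at h2
  refine ⟨(if Algebra.trace (ZMod p) F x = 0 then (p : ℤ) else 0) - 1, ?_⟩
  rw [ZMod.card] at h2
  split_ifs at h2 ⊢ <;> push_cast <;> linear_combination h2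

theorem weighted_gauss {E : Type*} [Field E] {p n : ℕ} [hp : Fact p.Prime]
    {F : Type*} [Field F] [Fintype F] [Algebra (ZMod p) F] {ζ : E} (hζ : IsPrimitiveRoot ζ p)
    (ψ : AddChar F E) (hψ : ∀ x, ψ x = ζ ^ (Algebra.trace (ZMod p) F x).val)
    (φ : MulChar F E) (hφ : φ ^ n = 1) (hc : (p - 1).Coprime n)
    {γ : Fˣ} (hγ : ∀ x : Fˣ, x ∈ Subgroup.zpowers γ)
    (S : Finset ℕ) (w : ℕ → E) (d : E)
    (hw : ∀ l : ℕ, ∃ z : ℤ, ∑ k ∈ S, w k * ((φ γ) ^ l) ^ k = z * d) :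
    ∃ z : ℤ, ((p - 1 : ℕ) : E) * ∑ k ∈ S, w k * gaussSum (φ ^ k) ψ = z * d := by
  have h1 : ∀ k, ((p - 1 : ℕ) : E) * gaussSum (φ ^ k) ψ =
      ∑ c : (ZMod p)ˣ, ∑ x : F, (φ ^ k) x * ψ (algebraMap (ZMod p) F c * x) := by
    intro k
    have h2 : ∀ c : (ZMod p)ˣ, ∑ x : F, (φ ^ k) x * ψ (algebraMap (ZMod p) F c * x) =
        gaussSum (φ ^ k) ψ := by
      intro c
      have h3 := gaussSum_mulShift (φ ^ k) ψ (Units.map (algebraMap (ZMod p) F).toMonoidHom c)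
      rw [← h3]
      have h4 : (φ ^ k) ((Units.map (algebraMap (ZMod p) F).toMonoidHom c : Fˣ) : F) = 1 := by
        rw [MulChar.pow_apply_coe]
        have := phi_base φ hφ hc (c : ZMod p) c.ne_zero
        rw [Units.coe_map]
        erw [this]
        rw [one_pow]
      rw [h4, one_mul]
      rfl
    rw [Finset.sum_congr rfl fun c _ => h2 c]
    simp [ZMod.card_units_eq_totient, Nat.totient_prime hp.out]
  have h2 : ((p - 1 : ℕ) : E) * ∑ k ∈ S, w k * gaussSum (φ ^ k) ψ =
      ∑ x : F, (∑ k ∈ S, w k * (φ ^ k) x) * ∑ c : (ZMod p)ˣ, ψ (algebraMap (ZMod p) F c * x) := by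
    rw [Finset.mul_sum]
    have : ∀ k ∈ S, ((p - 1 : ℕ) : E) * (w k * gaussSum (φ ^ k) ψ) =
        ∑ x : F, w k * (φ ^ k) x * ∑ c : (ZMod p)ˣ, ψ (algebraMap (ZMod p) F c * x) := by
      intro k _
      rw [mul_left_comm, h1, Finset.sum_comm, Finset.mul_sum]
      refine Finset.sum_congr rfl fun x _ => ?_
      rw [← Finset.mul_sum]; ring
    rw [Finset.sum_congr rfl this, Finset.sum_comm]
    refine Finset.sum_congr rfl fun x _ => ?_
    rw [Finset.sum_mul]
  have h3 : ∀ x : F, ∃ z : ℤ,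
      (∑ k ∈ S, w k * (φ ^ k) x) * ∑ c : (ZMod p)ˣ, ψ (algebraMap (ZMod p) F c * x) = z * d := by
    intro x
    by_cases hx : x = 0
    · refine ⟨0, ?_⟩
      have : ∑ k ∈ S, w k * (φ ^ k) x = 0 := by
        refine Finset.sum_eq_zero fun k _ => ?_
        rw [hx, MulChar.map_zero, mul_zero]
      rw [this]; simp
    · obtain ⟨l, hl⟩ := exists_nat_pow hγ x hx
      obtain ⟨z1, hz1⟩ := hw l
      obtain ⟨z2, hz2⟩ := sum_psi_int hζ ψ hψ x
      refine ⟨z1 * z2, ?_⟩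
      have : ∑ k ∈ S, w k * (φ ^ k) x = z1 * d := by
        rw [← hz1]
        refine Finset.sum_congr rfl fun k _ => ?_
        rw [hl, map_pow, MulChar.pow_apply_coe, ← pow_mul, ← pow_mul, mul_comm k]
      rw [this, hz2]; push_cast; ring
  choose z hz using h3
  refine ⟨∑ x, z x, ?_⟩
  rw [h2, Finset.sum_congr rfl fun x _ => hz x]
  push_cast
  rw [Finset.sum_mul]

theorem gauss_pow_eq {E : Type*} [Field E] {p₁ m p f : ℕ} [hp₁ : Fact p₁.Prime]
    (hmod : p₁ % 8 = 3) (hm : 1 ≤ m)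
    (hcop : p.Coprime p₁) (hf : orderOf (p : ZMod (p₁ ^ m)) = f) (hodd : f % 2 = 1)
    (htot : 2 * f = Nat.totient (p₁ ^ m)) [hp : Fact p.Prime]
    {F : Type*} [Field F] [Fintype F] [CharP F p] (ψ : AddChar F E)
    (hψ : ∀ x, ψ (x ^ p) = ψ x) (φ : MulChar F E) (hφ : φ ^ (p₁ ^ m) = 1)
    (k l : ℕ) (hk : k.Coprime p₁) (hl : l.Coprime p₁)
    (h : quadraticChar (ZMod p₁) (k : ZMod p₁) = quadraticChar (ZMod p₁) (l : ZMod p₁)) :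
    gaussSum (φ ^ k) ψ = gaussSum (φ ^ l) ψ := by
  obtain ⟨t, -, ht⟩ := exists_pow hmod hm hcop hf hodd htot k l hk hl h
  have h1 : ((k : ℕ) : ZMod (p₁ ^ m)) = ((p ^ t * l : ℕ) : ZMod (p₁ ^ m)) := by
    push_cast; exact ht
  rw [ZMod.natCast_eq_natCast_iff] at h1
  have h2 : φ ^ k = φ ^ (p ^ t * l) := by
    rw [pow_eq_pow_mod k hφ, pow_eq_pow_mod (p ^ t * l) hφ, h1]
  have h3 : ∀ t, gaussSum ((φ ^ l) ^ p ^ t) ψ = gaussSum (φ ^ l) ψ := by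
    intro t
    induction t with
    | zero => simp
    | succ t ih => rw [pow_succ, pow_mul, Stick.gauss_frob ψ hψ, ih]
  rw [h2, mul_comm, pow_mul, h3]

theorem int_of_integral {E : Type*} [Field E] [CharZero E] {x : E} (hx : IsIntegral ℤ x)
    {a z : ℤ} (ha : a ≠ 0) (h : (a : E) * x = z) : ∃ y : ℤ, x = y := by
  have haE : (a : E) ≠ 0 := by exact_mod_cast ha
  have h1 : x = algebraMap ℚ E ((z : ℚ) / a) := by
    rw [map_div₀, map_intCast, map_intCast, ← h]; field_simp
  rw [h1, isIntegral_algebraMap_iff (algebraMap ℚ E).injective] at hx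
  obtain ⟨y, hy⟩ := IsIntegrallyClosed.isIntegral_iff.1 hx
  refine ⟨y, ?_⟩
  rw [h1, ← hy]; simp

theorem gauss_integral {E : Type*} [Field E] {p : ℕ} [hp : Fact p.Prime]
    {F : Type*} [Field F] [Fintype F] [Algebra (ZMod p) F] {ζ : E} (hζ : IsPrimitiveRoot ζ p)
    (ψ : AddChar F E) (hψ : ∀ x, ψ x = ζ ^ (Algebra.trace (ZMod p) F x).val)
    (φ : MulChar F E) : IsIntegral ℤ (gaussSum φ ψ) := by
  apply IsIntegral.sum
  intro x _
  apply IsIntegral.mul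
  · by_cases hx : x = 0
    · rw [hx, MulChar.map_zero]; exact isIntegral_zero
    · have hq1 : 1 < Fintype.card F := Fintype.one_lt_card
      apply IsIntegral.of_pow (n := Fintype.card F - 1) (by omega)
      rw [← map_pow, FiniteField.pow_card_sub_one_eq_one _ hx, map_one]
      exact isIntegral_one
  · rw [hψ]
    apply IsIntegral.pow
    exact hζ.isIntegral hp.out.pos

theorem gauss_form {E : Type*} [Field E] [CharZero E] {p₁ m p f : ℕ} [hp₁ : Fact p₁.Prime]
    (hmod : p₁ % 8 = 3) (hm : 1 ≤ m)
    (hcop : p.Coprime p₁) (hf : orderOf (p : ZMod (p₁ ^ m)) = f) (hodd : f % 2 = 1)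
    (htot : 2 * f = Nat.totient (p₁ ^ m)) [hp : Fact p.Prime] (hp2 : p ≠ 2)
    (hc : (p - 1).Coprime p₁)
    {F : Type*} [Field F] [Fintype F] [Algebra (ZMod p) F] (hcard : Fintype.card F = p ^ f)
    {ζ : E} (hζ : IsPrimitiveRoot ζ p)
    (ψ : AddChar F E) (hψ : ∀ x, ψ x = ζ ^ (Algebra.trace (ZMod p) F x).val)
    (hprim : ψ.IsPrimitive)
    (φ : MulChar F E) (hφ : orderOf φ = p₁ ^ m)
    {γ : Fˣ} (hγ : ∀ x : Fˣ, x ∈ Subgroup.zpowers γ) :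
    ∃ x y : ℤ, x ^ 2 + p₁ * y ^ 2 = 4 * p ^ f ∧
      2 * gaussSum φ ψ = x + y * delta p₁ (φ γ ^ p₁ ^ (m - 1)) ∧
      2 * gaussSum φ⁻¹ ψ = x - y * delta p₁ (φ γ ^ p₁ ^ (m - 1)) := by
  have hF : CharP F p := charP_of_injective_algebraMap (algebraMap (ZMod p) F).injective p
  set n := p₁ ^ m with hn
  set M := p₁ ^ (m - 1) with hM
  have hnM : n = p₁ * M := by rw [hM, ← pow_succ', hn]; congr 1; omega
  have hMpos : 0 < M := pow_pos hp₁.out.pos _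
  have hnpos : 0 < n := pow_pos hp₁.out.pos _
  have hφn : φ ^ n = 1 := by rw [← hφ, pow_orderOf_eq_one]
  have hξ : IsPrimitiveRoot (φ γ) (p₁ * M) := by rw [← hnM, ← hφ]; exact xi_prim φ hγ
  set ξ := φ γ with hξdef
  have hw : IsPrimitiveRoot (ξ ^ M) p₁ := hξ.pow (Nat.mul_pos hp₁.out.pos hMpos) (by rw [mul_comm])
  set δ := delta p₁ (ξ ^ M) with hδ
  have hδ2 : δ ^ 2 = -(p₁ : E) := delta_sq hmod hw
  have hcn : (p - 1).Coprime n := by rw [hn]; exact hc.pow_right m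
  set S := (Finset.range (p₁ * M)).filter (fun k => k.Coprime p₁) with hS
  let X : ℕ → E := fun k => ((quadraticChar (ZMod p₁) (k : ZMod p₁) : ℤ) : E)
  have hXS : ∀ (g : ℕ → E), ∑ k ∈ S, X k * g k = ∑ k ∈ Finset.range (p₁ * M), X k * g k := by
    intro g
    rw [hS, Finset.sum_filter]
    refine Finset.sum_congr rfl fun u _ => ?_
    split_ifs with hu
    · rfl
    · have : (u : ZMod p₁) = 0 := by
        rw [ZMod.natCast_eq_zero_iff]
        rw [Nat.coprime_comm] at hu
        by_contra hc
        exact hu ((Nat.Prime.coprime_iff_not_dvd hp₁.out).2 hc)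
      simp only [X]
      rw [this]; simp
  have hscard : S.card = 2 * f := by
    rw [htot, Nat.totient, hS, ← hnM]
    congr 1
    ext k
    simp only [Finset.mem_filter]
    rw [Nat.coprime_comm, hn, Nat.coprime_pow_left_iff (by omega)]
  have hsX : ∑ k ∈ S, X k = 0 := by
    have h1 := hXS (fun k => (1 : E) ^ k)
    have h2 := sum_chi_block (p₁ := p₁) (1 : E) M
    have h3 : delta p₁ (1 : E) = 0 := by
      have := delta_pow hmod (one_pow p₁ : (1 : E) ^ p₁ = 1) 0
      simpa using this
    rw [h2, h3, mul_zero] at h1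
    simpa using h1
  have hXsq : ∀ k ∈ S, X k * X k = 1 := by
    intro k hk
    rw [hS, Finset.mem_filter] at hk
    have := chi_sq hk.2
    simp only [X]
    rw [← Int.cast_mul, ← sq, this, Int.cast_one]
  -- the two Gauss sums
  set G := gaussSum φ ψ with hG
  set G' := gaussSum φ⁻¹ ψ with hG'
  have hp₁2 : 2 < p₁ := by
    have := hp₁.out.two_le; omega
  have hn1 : n - 1 + 1 = n := by omega
  have hinv : φ⁻¹ = φ ^ (n - 1) := by
    rw [inv_eq_iff_mul_eq_one, ← pow_succ', hn1, hφn]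
  have hcop1 : (n - 1).Coprime p₁ := by
    have h1 : (n - 1).Coprime n := by
      rw [Nat.coprime_comm]
      have := Nat.coprime_self_sub_right (show 1 ≤ n by omega)
      rw [this]; simp
    rw [hnM] at h1 ⊢
    exact Nat.Coprime.coprime_mul_right_right h1
  have hχn1 : quadraticChar (ZMod p₁) ((n - 1 : ℕ) : ZMod p₁) = -1 := by
    rw [← chi_neg_one hmod]
    congr 1
    rw [Nat.cast_sub (by omega), hnM]; simp
  have hGk : ∀ k ∈ S, gaussSum (φ ^ k) ψ = (G + G') / 2 + X k * ((G - G') / 2) := by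
    intro k hk
    rw [hS, Finset.mem_filter] at hk
    have h1 := chi_sq hk.2
    have hpf := Stick.psi_frob ψ hψ
    rcases sq_eq_one_iff.1 h1 with h2 | h2
    · have h3 := gauss_pow_eq hmod hm hcop hf hodd htot ψ hpf φ hφn k 1 hk.2
        (Nat.coprime_one_left _) (by rw [h2]; simp)
      rw [h3, pow_one]
      simp only [X, h2]
      push_cast; ring
    · have h3 := gauss_pow_eq hmod hm hcop hf hodd htot ψ hpf φ hφn k (n - 1) hk.2
        hcop1 (by rw [h2, hχn1])
      rw [h3, ← hinv]
      simp only [X, h2]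
      push_cast; ring
  -- sums
  obtain ⟨z1, hz1⟩ := weighted_gauss hζ ψ hψ φ hφn hcn hγ S (fun _ => 1) 1 (by
    intro l
    obtain ⟨z, hz⟩ := sum_coprime_root hξ.pow_eq_one l
    exact ⟨z, by simpa using hz⟩)
  obtain ⟨z2, hz2⟩ := weighted_gauss hζ ψ hψ φ hφn hcn hγ S X δ (by
    intro l
    have h1 := sum_chi_root hmod hMpos hξ l
    rw [hXS (fun k => (φ γ ^ l) ^ k)]
    simp only [X]
    rw [h1]
    split_ifs
    · exact ⟨M * quadraticChar (ZMod p₁) ((l / M : ℕ) : ZMod p₁), by push_cast; rfl⟩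
    · exact ⟨0, by simp⟩)
  have hsum1 : ∑ k ∈ S, (1 : E) * gaussSum (φ ^ k) ψ = f * (G + G') := by
    have : ∀ k ∈ S, (1 : E) * gaussSum (φ ^ k) ψ = (G + G') / 2 + X k * ((G - G') / 2) := by
      intro k hk; rw [one_mul, hGk k hk]
    rw [Finset.sum_congr rfl this, Finset.sum_add_distrib, ← Finset.sum_mul, hsX,
      Finset.sum_const, hscard]
    simp; ring
  have hsum2 : ∑ k ∈ S, X k * gaussSum (φ ^ k) ψ = f * (G - G') := by
    have : ∀ k ∈ S, X k * gaussSum (φ ^ k) ψ = X k * ((G + G') / 2) + ((G - G') / 2) := by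
      intro k hk; rw [hGk k hk, mul_add, ← mul_assoc, hXsq k hk, one_mul]
    rw [Finset.sum_congr rfl this, Finset.sum_add_distrib, ← Finset.sum_mul, hsX,
      Finset.sum_const, hscard]
    simp; ring
  rw [hsum1] at hz1
  rw [hsum2] at hz2
  have hGi : IsIntegral ℤ G := gauss_integral hζ ψ hψ φ
  have hGi' : IsIntegral ℤ G' := gauss_integral hζ ψ hψ φ⁻¹
  have hδi : IsIntegral ℤ δ := by
    apply IsIntegral.of_pow (n := 2) (by norm_num)
    rw [hδ2]
    exact (isIntegral_natCast _).neg
  have hane : (((p - 1) * f : ℕ) : ℤ) ≠ 0 := by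
    have h1 := hp.out.two_le
    have : 0 < (p - 1) * f := Nat.mul_pos (by omega) (by omega)
    exact_mod_cast this.ne'
  obtain ⟨x, hx⟩ := int_of_integral (hGi.add hGi') hane (z := z1) (by
    push_cast
    rw [mul_one] at hz1
    rw [← hz1]; ring)
  obtain ⟨Y, hY⟩ := int_of_integral ((hGi.sub hGi').mul hδi) hane (z := -z2 * p₁) (by
    push_cast
    linear_combination δ * hz2 + z2 * hδ2)
  -- norm
  have hφne : φ ≠ 1 := by
    intro h
    rw [h, orderOf_one] at hφ
    have : p₁ ≤ n := by rw [hnM]; exact Nat.le_mul_of_pos_right _ hMpos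
    omega
  have hnorm : G * G' = p ^ f := by
    have h1 := gaussSum_mul_gaussSum_eq_card hφne hprim
    have hneg : φ⁻¹ (-1) = 1 := MulChar.val_neg_one_eq_one_of_odd_order (n := n)
      (by rw [hn]; exact Odd.pow (Nat.odd_iff.2 (by omega))) (by rw [inv_pow, hφn, inv_one])
    have h2 := gaussSum_mulShift φ⁻¹ ψ (-1)
    have h3 : ψ.mulShift ((-1 : Fˣ) : F) = ψ⁻¹ := by
      rw [Units.val_neg, Units.val_one, AddChar.inv_mulShift]
    rw [h3, Units.val_neg, Units.val_one, hneg, one_mul] at h2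
    rw [h2, hcard] at h1
    rw [hG, hG', h1]; push_cast; rfl
  have hp₁0 : (p₁ : E) ≠ 0 := by exact_mod_cast hp₁.out.ne_zero
  have hYeq : (p₁ : ℤ) * (4 * p ^ f - x ^ 2) = Y ^ 2 := by
    have : ((p₁ : ℤ) * (4 * p ^ f - x ^ 2) : E) = (Y : E) ^ 2 := by
      push_cast
      rw [← hnorm, ← hx, ← hY]
      linear_combination (-(G - G') ^ 2) * hδ2
    exact_mod_cast this
  have hdvd : (p₁ : ℤ) ∣ Y := by
    have h1 : (p₁ : ℤ) ∣ Y ^ 2 := ⟨_, hYeq.symm⟩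
    exact (Nat.prime_iff_prime_int.1 hp₁.out).dvd_of_dvd_pow h1
  obtain ⟨y, rfl⟩ := hdvd
  have hGG : G - G' = -y * δ := by
    apply mul_left_cancel₀ hp₁0
    push_cast at hY
    linear_combination (-δ) * hY + (G - G') * hδ2
  refine ⟨x, -y, ?_, ?_, ?_⟩
  · have h0 : (p₁ : ℤ) ≠ 0 := by exact_mod_cast hp₁.out.ne_zero
    apply mul_left_cancel₀ h0
    linear_combination (-1) * hYeq
  · push_cast; linear_combination hx + hGG
  · push_cast; linear_combination hx - hGG

end Elem

namespace Elem

theorem ultra_aux {E : Type*} [NormedField E] [IsUltrametricDist E] {a b : E} {r : ℝ}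
    (hab : a + b = 1) (ha : ‖a‖ < 1) (hr : ‖a * b‖ = r) : ‖a‖ = r := by
  have hb : ‖b‖ = 1 := by
    have h1 : b = 1 - a := by linear_combination hab
    have h2 : ‖(1 : E) + -a‖ = max ‖(1 : E)‖ ‖-a‖ :=
      IsUltrametricDist.norm_add_eq_max_of_norm_ne_norm (by rw [norm_neg, norm_one]; exact ha.ne')
    rw [h1, sub_eq_add_neg, h2, norm_one, norm_neg, max_eq_left ha.le]
  rw [← hr, norm_mul, hb, mul_one]

theorem exp_aux {E : Type*} [NormedField E] {p f h e s : ℕ} {σ : ℤ} (hσ : σ = 1 ∨ σ = -1)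
    (hp0 : 0 < ‖(p : E)‖) (hp1 : ‖(p : E)‖ < 1) {a G : E} (ha : ‖a‖ = ‖(p : E)‖ ^ h)
    (hG : G = σ * p ^ e * a ^ s) (hb : ‖(p : E)‖ ^ (f + h) ≤ ‖G‖ ^ 2)
    (hf : 2 * e + h * s = f) (hh : 1 ≤ h) : s ≤ 1 := by
  have h1 : ‖G‖ ^ 2 = ‖(p : E)‖ ^ (2 * e + 2 * (h * s)) := by
    have h2 : ‖((σ : ℤ) : E)‖ = 1 := by rcases hσ with h | h <;> simp [h]
    rw [hG, norm_mul, norm_mul, h2, norm_pow, norm_pow, ha]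
    ring
  rw [h1, pow_le_pow_iff_right_of_lt_one₀ hp0 hp1] at hb
  by_contra hs
  have : h * 2 ≤ h * s := Nat.mul_le_mul_left h (by omega)
  omega

theorem gauss_shape {E : Type*} [NormedField E] [IsUltrametricDist E] [IsAlgClosed E]
    [CharZero E] {p₁ m p f h : ℕ} [hp₁ : Fact p₁.Prime] (hmod : p₁ % 8 = 3) (hm : 1 ≤ m)
    (hcop : p.Coprime p₁) (hf : orderOf (p : ZMod (p₁ ^ m)) = f) (hodd : f % 2 = 1)
    (htot : 2 * f = Nat.totient (p₁ ^ m))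
    (hcb : |∑ a : ZMod p₁, quadraticChar (ZMod p₁) a * (a.val : ℤ)| ≤ p₁ * h)
    [hp : Fact p.Prime] (hp2 : p ≠ 2) (hpE : ‖(p : E)‖ < 1)
    (hh : 1 ≤ h) (hcl : 1 + p₁ = 4 * p ^ h) (hc : (p - 1).Coprime p₁)
    {F : Type*} [Field F] [Fintype F] [Algebra (ZMod p) F] (hq2 : 2 < Fintype.card F)
    (hcard : Fintype.card F = p ^ f)
    {ζ : E} (hζ : IsPrimitiveRoot ζ p)
    (ψ : AddChar F E) (hψ : ∀ x, ψ x = ζ ^ (Algebra.trace (ZMod p) F x).val)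
    (hprim : ψ.IsPrimitive)
    (φ : MulChar F E) (hφ : orderOf φ = p₁ ^ m)
    {γ : Fˣ} (hγ : ∀ x : Fˣ, x ∈ Subgroup.zpowers γ) :
    ∃ (u : E) (ε : ℤ), (ε = 1 ∨ ε = -1) ∧ u ≠ 0 ∧
      gaussSum φ ψ = u * (1 + ε * delta p₁ (φ γ ^ p₁ ^ (m - 1))) ∧
      gaussSum φ⁻¹ ψ = u * (1 - ε * delta p₁ (φ γ ^ p₁ ^ (m - 1))) := by
  obtain ⟨x, y, hxy, hG, hG'⟩ := gauss_form hmod hm hcop hf hodd htot hp2 hc hcard hζ ψ hψ hprim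
    φ hφ hγ
  have hnM : p₁ ^ m = p₁ ^ (m - 1) * p₁ := by rw [← pow_succ]; congr 1; omega
  have hξ : IsPrimitiveRoot (φ γ) (p₁ ^ m) := by rw [← hφ]; exact xi_prim φ hγ
  have hw : IsPrimitiveRoot (φ γ ^ p₁ ^ (m - 1)) p₁ := hξ.pow (pow_pos hp₁.out.pos _) hnM
  have hδ2 := delta_sq (E := E) hmod hw
  set δ := delta p₁ (φ γ ^ p₁ ^ (m - 1)) with hδ
  obtain ⟨e, s, σ, ε, hσ, hε, hes, hform⟩ := norm_form_lemma p₁ p h hp.out hp2 hh (by omega) hcl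
    E f x y hxy
  have h1 := hform δ hδ2
  have h2 := hform (-δ) (by rw [neg_sq, hδ2])
  have h20 : (2 : E) ≠ 0 := two_ne_zero
  have hp0 : (p : E) ≠ 0 := by exact_mod_cast hp.out.ne_zero
  have hσ0 : (σ : E) ≠ 0 := by rcases hσ with h | h <;> simp [h]
  set a := (1 + ε * δ) / 2 with ha
  set b := (1 + ε * -δ) / 2 with hb
  have hGa : gaussSum φ ψ = σ * p ^ e * a ^ s := by
    apply mul_left_cancel₀ h20; rw [hG, h1]; ring
  have hGb : gaussSum φ⁻¹ ψ = σ * p ^ e * b ^ s := by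
    apply mul_left_cancel₀ h20; rw [hG', sub_eq_add_neg, ← mul_neg, h2]; ring
  have hab : a + b = 1 := by rw [ha, hb]; ring
  have hε2 : (ε : E) ^ 2 = 1 := by rcases hε with h | h <;> simp [h]
  have hclE : (1 : E) + p₁ = 4 * p ^ h := by exact_mod_cast hcl
  have hprod : a * b = p ^ h := by
    have : a * b * 4 = p ^ h * 4 := by
      rw [ha, hb]; linear_combination hclE - δ ^ 2 * hε2 - hδ2
    exact mul_right_cancel₀ (by norm_num) this
  have hpn0 : 0 < ‖(p : E)‖ := norm_pos_iff.2 hp0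
  have hprodn : ‖a * b‖ = ‖(p : E)‖ ^ h := by rw [hprod, norm_pow]
  have hlt : ‖a‖ * ‖b‖ < 1 := by
    rw [← norm_mul, hprodn]; exact pow_lt_one₀ hpn0.le hpE (by omega)
  have hs1 : s ≤ 1 := by
    by_cases ha1 : ‖a‖ < 1
    · exact exp_aux hσ hpn0 hpE (ultra_aux hab ha1 hprodn) hGa
        (gauss_sq_bound hmod hm hcop hf hodd htot hcb hpE hq2 hcard hζ ψ hψ φ hφ) hes hh
    · have hb1 : ‖b‖ < 1 := by
        by_contra hb1
        have := one_le_mul_of_one_le_of_one_le (not_lt.1 ha1) (not_lt.1 hb1)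
        linarith
      exact exp_aux hσ hpn0 hpE (ultra_aux (by rw [add_comm]; exact hab) hb1
        (by rw [mul_comm]; exact hprodn)) hGb
        (gauss_sq_bound hmod hm hcop hf hodd htot hcb hpE hq2 hcard hζ ψ hψ φ⁻¹
          (by rw [orderOf_inv, hφ])) hes hh
  have hs : s = 1 := by
    rcases Nat.le_one_iff_eq_zero_or_eq_one.1 hs1 with h0 | h0
    · rw [h0] at hes; omega
    · exact h0
  refine ⟨σ * p ^ e / 2, ε, hε, ?_, ?_, ?_⟩
  · exact div_ne_zero (mul_ne_zero hσ0 (pow_ne_zero _ hp0)) h20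
  · rw [hGa, hs, ha]; ring
  · rw [hGb, hs, hb]; ring

/-- normalised version: the sign is absorbed in the choice of the generator. -/
theorem gauss_shape' {E : Type*} [NormedField E] [IsUltrametricDist E] [IsAlgClosed E]
    [CharZero E] {p₁ m p f h : ℕ} [hp₁ : Fact p₁.Prime] (hmod : p₁ % 8 = 3) (hm : 1 ≤ m)
    (hcop : p.Coprime p₁) (hf : orderOf (p : ZMod (p₁ ^ m)) = f) (hodd : f % 2 = 1)
    (htot : 2 * f = Nat.totient (p₁ ^ m))
    (hcb : |∑ a : ZMod p₁, quadraticChar (ZMod p₁) a * (a.val : ℤ)| ≤ p₁ * h)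
    [hp : Fact p.Prime] (hp2 : p ≠ 2) (hpE : ‖(p : E)‖ < 1)
    (hh : 1 ≤ h) (hcl : 1 + p₁ = 4 * p ^ h) (hc : (p - 1).Coprime p₁)
    {F : Type*} [Field F] [Fintype F] [Algebra (ZMod p) F] (hq2 : 2 < Fintype.card F)
    (hcard : Fintype.card F = p ^ f)
    {ζ : E} (hζ : IsPrimitiveRoot ζ p)
    (ψ : AddChar F E) (hψ : ∀ x, ψ x = ζ ^ (Algebra.trace (ZMod p) F x).val)
    (hprim : ψ.IsPrimitive)
    (φ : MulChar F E) (hφ : orderOf φ = p₁ ^ m) :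
    ∃ (γ : Fˣ) (u : E), (∀ x : Fˣ, x ∈ Subgroup.zpowers γ) ∧ u ≠ 0 ∧
      ∀ k : ℕ, k.Coprime p₁ → gaussSum (φ ^ k) ψ =
        u * (1 + (quadraticChar (ZMod p₁) (k : ZMod p₁) : ℤ) *
          delta p₁ (φ γ ^ p₁ ^ (m - 1))) := by
  have hF : CharP F p := charP_of_injective_algebraMap (algebraMap (ZMod p) F).injective p
  obtain ⟨γ, hγ⟩ := IsCyclic.exists_generator (α := Fˣ)
  obtain ⟨u, ε, hε, hu, h1, h2⟩ := gauss_shape hmod hm hcop hf hodd htot hcb hp2 hpE hh hcl hc hq2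
    hcard hζ ψ hψ hprim φ hφ hγ
  have hnM : p₁ ^ m = p₁ ^ (m - 1) * p₁ := by rw [← pow_succ]; congr 1; omega
  have hξ : IsPrimitiveRoot (φ γ) (p₁ ^ m) := by rw [← hφ]; exact xi_prim φ hγ
  have hw : IsPrimitiveRoot (φ γ ^ p₁ ^ (m - 1)) p₁ := hξ.pow (pow_pos hp₁.out.pos _) hnM
  have hp₁1 := hp₁.out.two_le
  have hφn : φ ^ (p₁ ^ m) = 1 := by rw [← hφ, pow_orderOf_eq_one]
  obtain ⟨γ', hγ', h1', h2'⟩ : ∃ γ' : Fˣ, (∀ x : Fˣ, x ∈ Subgroup.zpowers γ') ∧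
      gaussSum φ ψ = u * (1 + delta p₁ (φ γ' ^ p₁ ^ (m - 1))) ∧
      gaussSum φ⁻¹ ψ = u * (1 - delta p₁ (φ γ' ^ p₁ ^ (m - 1))) := by
    rcases hε with h | h
    · refine ⟨γ, hγ, ?_, ?_⟩
      · rw [h1, h]; push_cast; ring
      · rw [h2, h]; push_cast; ring
    · have h3 : delta p₁ (φ (γ⁻¹ : Fˣ) ^ p₁ ^ (m - 1)) = - delta p₁ (φ γ ^ p₁ ^ (m - 1)) := by
        have h4 : φ (γ⁻¹ : Fˣ) = (φ γ)⁻¹ := by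
          apply eq_inv_of_mul_eq_one_left
          rw [← map_mul, Units.inv_mul, map_one]
        have h5 : φ (γ⁻¹ : Fˣ) ^ p₁ ^ (m - 1) = (φ γ ^ p₁ ^ (m - 1)) ^ (p₁ - 1) := by
          rw [h4, inv_pow]
          symm
          apply eq_inv_of_mul_eq_one_left
          rw [← pow_succ]
          rw [show p₁ - 1 + 1 = p₁ by omega, hw.pow_eq_one]
        rw [h5, delta_pow hmod hw.pow_eq_one, Nat.cast_sub (by omega)]
        simp [chi_neg_one hmod]
      refine ⟨γ⁻¹, fun x => by rw [Subgroup.zpowers_inv]; exact hγ x, ?_, ?_⟩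
      · rw [h1, h, h3]; push_cast; ring
      · rw [h2, h, h3]; push_cast; ring
  refine ⟨γ', u, hγ', hu, fun k hk => ?_⟩
  have hpf := Stick.psi_frob ψ hψ
  set n := p₁ ^ m with hn
  have hnpos : 0 < n := pow_pos hp₁.out.pos _
  have hinv : φ⁻¹ = φ ^ (n - 1) := by
    rw [inv_eq_iff_mul_eq_one, ← pow_succ', show n - 1 + 1 = n by omega, hφn]
  have hcop1 : (n - 1).Coprime p₁ := by
    have h1 : (n - 1).Coprime n := by
      rw [Nat.coprime_comm]
      have := Nat.coprime_self_sub_right (show 1 ≤ n by omega)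
      rw [this]; simp
    rw [hnM] at h1 ⊢
    exact Nat.Coprime.coprime_mul_left_right h1
  have hχn1 : quadraticChar (ZMod p₁) ((n - 1 : ℕ) : ZMod p₁) = -1 := by
    rw [← chi_neg_one hmod]
    congr 1
    rw [Nat.cast_sub (by omega), hnM]; simp
  rcases sq_eq_one_iff.1 (chi_sq hk) with h3 | h3
  · rw [gauss_pow_eq hmod hm hcop hf hodd htot ψ hpf φ hφn k 1 hk
        (Nat.coprime_one_left _) (by rw [h3]; simp), pow_one, h1', h3]
    push_cast; ring
  · rw [gauss_pow_eq hmod hm hcop hf hodd htot ψ hpf φ hφn k (n - 1) hk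
        hcop1 (by rw [h3, hχn1]), ← hinv, h2', h3]
    push_cast; ring

end Elem

namespace Elem

/-- The quadratic character with values in `E`. -/
noncomputable def eta (F E : Type*) [Field F] [Fintype F] [Field E] : MulChar F E :=
  (quadraticChar F).ringHomComp (Int.castRingHom E)

theorem eta_apply (F E : Type*) [Field F] [Fintype F] [Field E] (x : F) :
    eta F E x = ((quadraticChar F x : ℤ) : E) := rfl

theorem eta_sq (F E : Type*) [Field F] [Fintype F] [Field E] {x : F} (hx : x ≠ 0) :
    eta F E x ^ 2 = 1 := by
  rw [eta_apply, ← Int.cast_pow, quadraticChar_sq_one hx, Int.cast_one]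

theorem eta_sq_one (F E : Type*) [Field F] [Fintype F] [Field E] :
    eta F E ^ 2 = 1 := by
  ext x
  rw [MulChar.pow_apply_coe, eta_sq F E x.ne_zero, MulChar.one_apply_coe]

theorem eta_gen {F E : Type*} [Field F] [Fintype F] [Field E] (hF : ringChar F ≠ 2)
    {γ : Fˣ} (hγ : ∀ x : Fˣ, x ∈ Subgroup.zpowers γ) : eta F E γ = -1 := by
  rw [eta_apply]
  have h1 : quadraticChar F γ ≠ 1 := by
    intro h
    apply quadraticChar_ne_one hF
    rw [MulChar.eq_iff hγ, h, MulChar.one_apply_coe]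
  have h2 := (quadraticChar_dichotomy γ.ne_zero).resolve_left h1
  rw [h2]; simp

theorem sum_sq {F E : Type*} [Field F] [Fintype F] [Field E] (hF : ringChar F ≠ 2)
    (g : F → E) : ∑ y : F, g (y ^ 2) = ∑ z : F, (eta F E z + 1) * g z := by
  have h1 : ∀ z : F, ∑ y ∈ Finset.univ.filter (fun y : F => y ^ 2 = z), g (y ^ 2) =
      (eta F E z + 1) * g z := by
    intro z
    rw [Finset.sum_congr rfl (g := fun _ => g z) (by
      intro y hy; rw [(Finset.mem_filter.1 hy).2]), Finset.sum_const, nsmul_eq_mul]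
    congr 1
    have h2 := quadraticChar_card_sqrts hF z
    have h3 : {x : F | x ^ 2 = z}.toFinset = Finset.univ.filter (fun y : F => y ^ 2 = z) := by
      ext; simp
    rw [h3] at h2
    rw [eta_apply]
    exact_mod_cast congrArg (Int.cast : ℤ → E) h2
  rw [← Finset.sum_congr rfl fun z _ => h1 z]
  exact (Finset.sum_fiberwise Finset.univ (fun y : F => y ^ 2) (fun y => g (y ^ 2))).symm

theorem jacobi_eq {F E : Type*} [Field F] [Fintype F] [Field E] (hF : ringChar F ≠ 2)
    (χ : MulChar F E) (h1 : χ ≠ 1) (h4 : χ 4 = 1) :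
    jacobiSum χ χ = jacobiSum χ (eta F E) := by
  have h2 : (2 : F) ≠ 0 := Ring.two_ne_zero hF
  rw [jacobiSum_comm χ (eta F E)]
  unfold jacobiSum
  have hb : Function.Bijective (fun y : F => (1 + y) / 2) := by
    constructor
    · intro a b h
      simp only at h
      field_simp at h
      linear_combination h
    · intro x
      exact ⟨2 * x - 1, by simp only; field_simp; ring⟩
  rw [← hb.sum_comp]
  have h5 : ∀ y : F, χ ((1 + y) / 2) * χ (1 - (1 + y) / 2) = χ (1 - y ^ 2) := by
    intro y
    rw [← map_mul, ← one_mul (χ _), ← h4, ← map_mul]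
    congr 1
    field_simp
    ring
  rw [Finset.sum_congr rfl fun y _ => h5 y, sum_sq hF (fun z => χ (1 - z))]
  simp_rw [add_mul, one_mul]
  rw [Finset.sum_add_distrib]
  have h6 : ∑ z : F, χ (1 - z) = 0 := by
    rw [← MulChar.sum_eq_zero_of_ne_one h1]
    exact (Equiv.subLeft (1 : F)).sum_comp (fun z => χ z)
  rw [h6, add_zero]

theorem hasse_davenport {F E : Type*} [Field F] [Fintype F] [Field E] (hF : ringChar F ≠ 2)
    (χ : MulChar F E) (h2 : χ * χ ≠ 1) (hη : χ * eta F E ≠ 1) (h4 : χ 4 = 1)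
    (ψ : AddChar F E) (hG : gaussSum χ ψ ≠ 0) :
    gaussSum χ ψ * gaussSum (χ * eta F E) ψ = gaussSum (χ * χ) ψ * gaussSum (eta F E) ψ := by
  have h1 : χ ≠ 1 := by rintro rfl; exact h2 (by simp)
  have e1 := jacobiSum_mul_nontrivial h2 ψ
  have e2 := jacobiSum_mul_nontrivial hη ψ
  rw [← jacobi_eq hF χ h1 h4] at e2
  apply mul_left_cancel₀ hG
  linear_combination (-gaussSum (χ * eta F E) ψ) * e1 + gaussSum (χ * χ) ψ * e2

theorem gauss_eta {E : Type*} [Field E] [CharZero E]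
    {p₁ m p : ℕ} [hp₁ : Fact p₁.Prime] (hmod : p₁ % 8 = 3) (hm : 1 ≤ m)
    [hp : Fact p.Prime] (hp2 : p ≠ 2) (hc : (p - 1).Coprime p₁)
    {F : Type*} [Field F] [Fintype F] [Algebra (ZMod p) F]
    (ψ : AddChar F E) (φ : MulChar F E) (hφ : orderOf φ = p₁ ^ m)
    {u δ : E} (hδ : δ ^ 2 = -(p₁ : E)) (hu : u ≠ 0)
    (hG : ∀ k : ℕ, k.Coprime p₁ → gaussSum (φ ^ k) ψ =
        u * (1 + (quadraticChar (ZMod p₁) (k : ZMod p₁) : ℤ) * δ))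
    (k : ℕ) (hk : k.Coprime p₁) :
    (1 + (quadraticChar (ZMod p₁) (k : ZMod p₁) : ℤ) * δ) * gaussSum (φ ^ k * eta F E) ψ =
    (1 - (quadraticChar (ZMod p₁) (k : ZMod p₁) : ℤ) * δ) * gaussSum (eta F E) ψ := by
  have hchar : CharP F p := charP_of_injective_algebraMap (algebraMap (ZMod p) F).injective p
  have hF : ringChar F ≠ 2 := by rw [ringChar.eq F p]; exact hp2
  have hodd : Odd (p₁ ^ m) := Odd.pow (Nat.odd_iff.2 (by omega))
  have hφn : φ ^ (p₁ ^ m) = 1 := by rw [← hφ, pow_orderOf_eq_one]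
  have hp₁2 : 2 < p₁ := by have := hp₁.out.two_le; omega
  have h2k : (2 * k).Coprime p₁ := by
    refine Nat.Coprime.mul_left ?_ hk
    rw [Nat.coprime_primes Nat.prime_two hp₁.out]; omega
  have hpn : ¬ p₁ ^ m = 1 := by
    have := Nat.one_lt_pow (show m ≠ 0 by omega) (show 1 < p₁ by omega); omega
  have hne : ∀ j : ℕ, j.Coprime p₁ → φ ^ j ≠ 1 := by
    intro j hj h
    have := orderOf_dvd_of_pow_eq_one h
    rw [hφ] at this
    exact hpn (Nat.Coprime.eq_one_of_dvd ((hj.pow_right m).symm) this)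
  have hsq : φ ^ k * φ ^ k = φ ^ (2 * k) := by rw [← pow_add]; congr 1; omega
  have hχsq := chi_sq hk
  have hχE : (((quadraticChar (ZMod p₁) (k : ZMod p₁) : ℤ) : E)) ^ 2 = 1 := by
    rw [← Int.cast_pow, hχsq, Int.cast_one]
  have hne0 : (1 + (quadraticChar (ZMod p₁) (k : ZMod p₁) : ℤ) * δ) ≠ 0 := by
    intro h
    have : (1 : E) + p₁ = 0 := by
      linear_combination (1 - (quadraticChar (ZMod p₁) (k : ZMod p₁) : ℤ) * δ) * h + δ ^ 2 * hχE + hδ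
    have h' : ((1 + p₁ : ℕ) : E) = 0 := by push_cast; exact this
    rw [Nat.cast_eq_zero] at h'
    omega
  have hη : φ ^ k * eta F E ≠ 1 := by
    intro h
    have h1 : (φ ^ k * eta F E) ^ 2 = 1 := by rw [h, one_pow]
    rw [mul_pow, eta_sq_one, mul_one, sq, hsq] at h1
    exact hne _ h2k h1
  have h4 : (φ ^ k) 4 = 1 := by
    have h40 : (4 : ZMod p) ≠ 0 := by
      intro h
      have h' : ((4 : ℕ) : ZMod p) = 0 := by exact_mod_cast h
      rw [ZMod.natCast_eq_zero_iff] at h'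
      have : p ∣ 2 := hp.out.dvd_of_dvd_pow (n := 2) (by simpa using h')
      exact hp2 ((Nat.prime_dvd_prime_iff_eq hp.out Nat.prime_two).1 this)
    have := phi_base φ hφn (hc.pow_right m) (4 : ZMod p) h40
    have e4 : algebraMap (ZMod p) F 4 = 4 := map_ofNat _ 4
    rw [e4] at this
    have hu4 : (4 : F) ≠ 0 := by rw [← e4, Ne, map_eq_zero]; exact h40
    have h5 := MulChar.pow_apply_coe φ k (Units.mk0 4 hu4)
    rw [Units.val_mk0, this, one_pow] at h5
    exact h5
  have hhd := hasse_davenport hF (φ ^ k) (by rw [hsq]; exact hne _ h2k) hη h4 ψ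
    (by rw [hG k hk]; exact mul_ne_zero hu hne0)
  rw [hsq, hG k hk, hG _ h2k] at hhd
  have h2c : quadraticChar (ZMod p₁) ((2 * k : ℕ) : ZMod p₁) = -quadraticChar (ZMod p₁) (k : ZMod p₁) := by
    push_cast
    rw [map_mul, chi_two hmod]; ring
  rw [h2c] at hhd
  push_cast at hhd
  apply mul_left_cancel₀ hu
  linear_combination hhd

end Elem

namespace Elem

/-- The value of the sign function. -/
noncomputable def lamVal (p₁ : ℕ) [Fact p₁.Prime] (σ : ℤ) (l : ℕ) : ℤ :=
  (if p₁ ∣ l then 1 else 0) - σ * quadraticChar (ZMod p₁) (l : ZMod p₁)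

theorem chi_dvd {p₁ : ℕ} [hp₁ : Fact p₁.Prime] {l : ℕ} (h : p₁ ∣ l) :
    quadraticChar (ZMod p₁) (l : ZMod p₁) = 0 := by
  rw [(ZMod.natCast_eq_zero_iff l p₁).2 h]; simp

theorem chi_not_dvd {p₁ : ℕ} [hp₁ : Fact p₁.Prime] {l : ℕ} (h : ¬ p₁ ∣ l) :
    quadraticChar (ZMod p₁) (l : ZMod p₁) = 1 ∨ quadraticChar (ZMod p₁) (l : ZMod p₁) = -1 := by
  apply quadraticChar_dichotomy
  rwa [Ne, ZMod.natCast_eq_zero_iff]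

theorem lamVal_sq {p₁ : ℕ} [hp₁ : Fact p₁.Prime] {σ : ℤ} (hσ : σ = 1 ∨ σ = -1) (l : ℕ) :
    lamVal p₁ σ l ^ 2 = 1 := by
  unfold lamVal
  split_ifs with h
  · rw [chi_dvd h]; simp
  · rcases chi_not_dvd h with h | h <;> rcases hσ with h' | h' <;> rw [h, h'] <;> norm_num

theorem exists_idx {M g : ℕ} (hM : 0 < M) (hg : g.Coprime M) (c : ℕ) :
    ∃ i < M, M ∣ c + g * i := by
  haveI : NeZero M := ⟨hM.ne'⟩
  refine ⟨(-(c : ZMod M) * (g : ZMod M)⁻¹).val, ZMod.val_lt _, ?_⟩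
  rw [← ZMod.natCast_eq_zero_iff]
  push_cast
  rw [ZMod.natCast_zmod_val]
  have := ZMod.coe_mul_inv_eq_one g hg
  linear_combination (-(c : ZMod M)) * this

theorem idx_unique {M g : ℕ} (hg : g.Coprime M) {c i j : ℕ} (hi : i < M) (hj : j < M)
    (h1 : M ∣ c + g * i) (h2 : M ∣ c + g * j) : i = j := by
  have h3 : (M : ℤ) ∣ g * ((i : ℤ) - j) := by
    have a1 : (M : ℤ) ∣ c + g * i := by exact_mod_cast h1
    have a2 : (M : ℤ) ∣ c + g * j := by exact_mod_cast h2
    have := dvd_sub a1 a2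
    have e : (g : ℤ) * ((i : ℤ) - j) = c + g * i - (c + g * j) := by ring
    rwa [e]
  have h4 : (M : ℤ) ∣ (i : ℤ) - j := by
    apply IsCoprime.dvd_of_dvd_mul_left _ h3
    exact (Nat.isCoprime_iff_coprime.2 hg.symm)
  have h5 : (i : ℤ) - j = 0 := by
    apply Int.eq_zero_of_abs_lt_dvd h4
    rw [abs_lt]; constructor <;> omega
  omega

/-- The double character sum. -/
noncomputable def TS {E : Type*} [Field E] (p₁ M g : ℕ) [Fact p₁.Prime] (ξ : E) (σ : ℤ)
    (c : ℕ) : E :=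
  ∑ i ∈ Finset.range M, ∑ k ∈ Finset.range (p₁ * M),
    (1 + σ * ((quadraticChar (ZMod p₁) (k : ZMod p₁) : ℤ) : E) * delta p₁ (ξ ^ M)) *
      (ξ ^ (c + g * i)) ^ k

theorem TS_eval {E : Type*} [Field E] [CharZero E] {p₁ M g : ℕ} [hp₁ : Fact p₁.Prime]
    (hmod : p₁ % 8 = 3) (hM : 0 < M) {ξ : E} (hξ : IsPrimitiveRoot ξ (p₁ * M))
    (hg : g.Coprime M) (σ : ℤ) {c i₀ : ℕ} (hi : i₀ < M) (hd : M ∣ c + g * i₀) :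
    TS p₁ M g ξ σ c = ((p₁ * M : ℕ) : E) * (lamVal p₁ σ ((c + g * i₀) / M) : E) := by
  have hw : IsPrimitiveRoot (ξ ^ M) p₁ := hξ.pow (Nat.mul_pos hp₁.out.pos hM) (by rw [mul_comm])
  have hδ2 := delta_sq (E := E) hmod hw
  set δ := delta p₁ (ξ ^ M) with hδ
  have h1 : ∀ l : ℕ, ∑ k ∈ Finset.range (p₁ * M),
      (1 + σ * ((quadraticChar (ZMod p₁) (k : ZMod p₁) : ℤ) : E) * δ) * (ξ ^ l) ^ k =
      if M ∣ l then ((p₁ * M : ℕ) : E) * (lamVal p₁ σ (l / M) : E) else 0 := by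
    intro l
    have e : ∀ k ∈ Finset.range (p₁ * M),
        (1 + σ * ((quadraticChar (ZMod p₁) (k : ZMod p₁) : ℤ) : E) * δ) * (ξ ^ l) ^ k =
        (ξ ^ l) ^ k + σ * δ * (((quadraticChar (ZMod p₁) (k : ZMod p₁) : ℤ) : E) * (ξ ^ l) ^ k) := by
      intro k _; ring
    rw [Finset.sum_congr rfl e, Finset.sum_add_distrib, ← Finset.mul_sum, sum_pow_root hξ,
      sum_chi_root hmod hM hξ]
    by_cases hl : M ∣ l
    · obtain ⟨t, rfl⟩ := hl
      rw [if_pos (Dvd.intro _ rfl), if_pos (Dvd.intro _ rfl), Nat.mul_div_cancel_left _ hM]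
      have : p₁ * M ∣ M * t ↔ p₁ ∣ t := by
        rw [mul_comm p₁, Nat.mul_dvd_mul_iff_left hM]
      simp only [this, lamVal]
      push_cast
      split_ifs
      · linear_combination (σ * M * (quadraticChar (ZMod p₁) (t : ZMod p₁) : ℤ)) * hδ2
      · linear_combination (σ * M * (quadraticChar (ZMod p₁) (t : ZMod p₁) : ℤ)) * hδ2
    · rw [if_neg hl, if_neg hl, if_neg (fun h => hl ((Dvd.intro_left _ rfl).trans h))]
      simp
  unfold TS
  rw [Finset.sum_congr rfl fun i _ => h1 (c + g * i)]
  rw [Finset.sum_eq_single_of_mem i₀ (Finset.mem_range.2 hi), if_pos hd]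
  intro j hj hne
  rw [if_neg]
  intro h
  exact hne (idx_unique hg (Finset.mem_range.1 hj) hi h hd)

end Elem

namespace Elem

/-- The cyclotomic class, as a set (copy used by the helper lemmas). -/
def cc {F : Type*} [Field F] (γ : Fˣ) (N i : ℕ) : Set F :=
  {x : F | ∃ k : ℤ, x = ((γ ^ ((i : ℤ) + (N : ℤ) * k) : Fˣ) : F)}

theorem mem_cc {F : Type*} [Field F] [Fintype F] {γ : Fˣ}
    (hγ : ∀ x : Fˣ, x ∈ Subgroup.zpowers γ) {N : ℕ} (hN : N ∣ Fintype.card F - 1) (i c : ℕ) :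
    (γ : F) ^ c ∈ cc γ N i ↔ (N : ℤ) ∣ (c : ℤ) - i := by
  have hord : orderOf γ = Fintype.card F - 1 := by
    rw [orderOf_eq_card_of_forall_mem_zpowers hγ, Nat.card_eq_fintype_card, Fintype.card_units]
  unfold cc
  rw [Set.mem_ofPred_eq]
  constructor
  · rintro ⟨k, hk⟩
    have h1 : γ ^ (c : ℤ) = γ ^ ((i : ℤ) + (N : ℤ) * k) := by
      apply Units.ext
      rw [← hk]; simp
    rw [zpow_eq_zpow_iff_modEq, hord] at h1
    have h2 := h1.dvd
    have h3 : (N : ℤ) ∣ ((Fintype.card F - 1 : ℕ) : ℤ) := by exact_mod_cast hN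
    have h4 := h3.trans h2
    have h5 : (c : ℤ) - i = N * k - ((i : ℤ) + N * k - c) := by ring
    rw [h5]
    exact dvd_sub (Dvd.intro _ rfl) h4
  · rintro ⟨k, hk⟩
    refine ⟨k, ?_⟩
    rw [← hk]
    simp

theorem mem_J {p₁ m p f : ℕ} [hp₁ : Fact p₁.Prime] (hmod : p₁ % 8 = 3) (hm : 1 ≤ m)
    (hcop : p.Coprime p₁) (hf : orderOf (p : ZMod (p₁ ^ m)) = f) (hodd : f % 2 = 1)
    (htot : 2 * f = Nat.totient (p₁ ^ m)) (hp2 : p % 2 = 1)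
    (J : Set (ZMod (2 * p₁)))
    (hJ : J = {x : ZMod (2 * p₁) | ∃ k : ℕ, x = (p : ZMod (2 * p₁)) ^ k} ∪
      {x : ZMod (2 * p₁) | ∃ k : ℕ, x = 2 * (p : ZMod (2 * p₁)) ^ k} ∪ {0})
    (j : ZMod (2 * p₁)) : j ∈ J ↔
      (j.val % 2 = 1 ∧ quadraticChar (ZMod p₁) (j.val : ZMod p₁) = 1) ∨
      (j.val % 2 = 0 ∧ (p₁ ∣ j.val ∨ quadraticChar (ZMod p₁) (j.val : ZMod p₁) = -1)) := by
  have hp₁pos := hp₁.out.pos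
  haveI : NeZero (2 * p₁) := ⟨by omega⟩
  have hχp := chi_p hm hcop hf hodd
  have hχ2 := chi_two hmod
  have hp₁2 : p₁ % 2 = 1 := by omega
  have key : ∀ a : ℕ, (((a : ZMod (2 * p₁)).val : ℕ) : ZMod p₁) = a ∧
      ((a : ZMod (2 * p₁)).val) % 2 = a % 2 := by
    intro a
    rw [ZMod.val_natCast]
    constructor
    · rw [ZMod.natCast_eq_natCast_iff]
      exact Nat.mod_mod_of_dvd a (Dvd.intro_left 2 rfl)
    · exact Nat.mod_mod_of_dvd a (Dvd.intro _ rfl)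
  have back : ∀ a : ℕ, ((a : ZMod p₁) = (j.val : ZMod p₁)) → a % 2 = j.val % 2 →
      j = ((a : ℕ) : ZMod (2 * p₁)) := by
    intro a h1 h2
    rw [← ZMod.natCast_zmod_val j, ZMod.natCast_eq_natCast_iff]
    rw [ZMod.natCast_eq_natCast_iff] at h1
    have hc : Nat.Coprime 2 p₁ := (Nat.coprime_primes Nat.prime_two hp₁.out).2 (by omega)
    exact (Nat.modEq_and_modEq_iff_modEq_mul hc).1 ⟨h2.symm, h1.symm⟩
  have hpk : ∀ k, p ^ k % 2 = 1 := fun k => by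
    rw [Nat.pow_mod, hp2, one_pow]
    rfl
  have red : ∀ k l : ℕ, (∃ t < f, (k : ZMod (p₁ ^ m)) = p ^ t * l) →
      ∃ t : ℕ, (k : ZMod p₁) = ((p ^ t * l : ℕ) : ZMod p₁) := by
    rintro k l ⟨t, -, ht⟩
    refine ⟨t, ?_⟩
    have h3 := congrArg (ZMod.castHom (dvd_pow_self p₁ (by omega : m ≠ 0)) (ZMod p₁)) ht
    rw [map_mul, map_pow, map_natCast, map_natCast, map_natCast] at h3
    push_cast; exact h3
  have hcopr : ∀ k : ℕ, quadraticChar (ZMod p₁) (k : ZMod p₁) ≠ 0 → k.Coprime p₁ := by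
    intro k hk
    rw [Nat.coprime_comm, Nat.Prime.coprime_iff_not_dvd hp₁.out]
    intro h
    exact hk (chi_dvd h)
  rw [hJ]
  simp only [Set.mem_union, Set.mem_ofPred_eq, Set.mem_singleton_iff]
  constructor
  · rintro ((⟨k, hk⟩ | ⟨k, hk⟩) | hk)
    · left
      have hk' : j = ((p ^ k : ℕ) : ZMod (2 * p₁)) := by rw [hk]; push_cast; rfl
      rw [hk', (key _).1, (key _).2]
      refine ⟨hpk k, ?_⟩
      push_cast; rw [map_pow, hχp, one_pow]
    · right
      have hk' : j = ((2 * p ^ k : ℕ) : ZMod (2 * p₁)) := by rw [hk]; push_cast; rfl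
      rw [hk', (key _).1, (key _).2]
      refine ⟨by omega, Or.inr ?_⟩
      push_cast; rw [map_mul, map_pow, hχp, one_pow, hχ2]; rfl
    · right
      rw [hk, ZMod.val_zero]
      exact ⟨rfl, Or.inl (dvd_zero _)⟩
  · rintro (⟨h1, h2⟩ | ⟨h1, h2 | h2⟩)
    · left; left
      obtain ⟨t, ht⟩ := red j.val 1 (exists_pow hmod hm hcop hf hodd htot j.val 1
        (hcopr _ (by rw [h2]; norm_num)) (Nat.coprime_one_left _) (by rw [h2]; simp))
      refine ⟨t, ?_⟩
      rw [mul_one] at ht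
      have := back _ ht.symm (by rw [hpk, h1])
      rw [this]; push_cast; rfl
    · right
      have hlt := ZMod.val_lt j
      rw [← ZMod.val_eq_zero]
      obtain ⟨t, ht⟩ := h2
      rw [ht] at hlt h1 ⊢
      have ht2 : t < 2 := by
        by_contra h
        have : p₁ * 2 ≤ p₁ * t := Nat.mul_le_mul_left _ (by omega)
        omega
      interval_cases t
      · simp
      · omega
    · left; right
      obtain ⟨t, ht⟩ := red j.val 2 (exists_pow hmod hm hcop hf hodd htot j.val 2
        (hcopr _ (by rw [h2]; norm_num))
        ((Nat.coprime_primes Nat.prime_two hp₁.out).2 (by omega)) (by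
          rw [h2]; push_cast; rw [hχ2]))
      refine ⟨t, ?_⟩
      have := back _ ht.symm (by rw [h1]; omega)
      rw [this]; push_cast; ring

theorem mem_D {p₁ m p f : ℕ} [hp₁ : Fact p₁.Prime] (hmod : p₁ % 8 = 3) (hm : 1 ≤ m)
    (hcop : p.Coprime p₁) (hf : orderOf (p : ZMod (p₁ ^ m)) = f) (hodd : f % 2 = 1)
    (htot : 2 * f = Nat.totient (p₁ ^ m)) (hp2 : p % 2 = 1)
    (J : Set (ZMod (2 * p₁)))
    (hJ : J = {x : ZMod (2 * p₁) | ∃ k : ℕ, x = (p : ZMod (2 * p₁)) ^ k} ∪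
      {x : ZMod (2 * p₁) | ∃ k : ℕ, x = 2 * (p : ZMod (2 * p₁)) ^ k} ∪ {0})
    {F : Type*} [Field F] [Fintype F] {γ : Fˣ} (hγ : ∀ x : Fˣ, x ∈ Subgroup.zpowers γ)
    (hN : 2 * p₁ ^ m ∣ Fintype.card F - 1)
    {M g : ℕ} (hM : M = p₁ ^ (m - 1)) (hg : g + 2 = p₁ ^ m) (hgM : g.Coprime M)
    {c i₀ : ℕ} (hi₀ : i₀ < M) (hd : M ∣ c + g * i₀) :
    (γ : F) ^ c ∈ (⋃ i < M, ⋃ j ∈ J, cc γ (2 * p₁ ^ m) (2 * i + M * ZMod.val j)) ↔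
      (-1) ^ c * lamVal p₁ 1 ((c + g * i₀) / M) = 1 := by
  have hp₁pos := hp₁.out.pos
  haveI : NeZero (2 * p₁) := ⟨by omega⟩
  have hMpos : 0 < M := by rw [hM]; exact pow_pos hp₁pos _
  have hnM : p₁ ^ m = p₁ * M := by rw [hM, ← pow_succ']; congr 1; omega
  have hMZ : (M : ℤ) ≠ 0 := by exact_mod_cast hMpos.ne'
  have hModd : M % 2 = 1 := by rw [hM, Nat.pow_mod, show p₁ % 2 = 1 by omega, one_pow]; rfl
  have hp₁odd : p₁ % 2 = 1 := by omega
  have hnodd : p₁ ^ m % 2 = 1 := by rw [hnM, Nat.mul_mod, hModd, hp₁odd]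
  obtain ⟨l, hl⟩ := hd
  have hl' : (c + g * i₀) / M = l := by rw [hl, Nat.mul_div_cancel_left _ hMpos]
  rw [hl']
  have hgZ : (g : ℤ) = p₁ * M - 2 := by
    have : ((g + 2 : ℕ) : ℤ) = ((p₁ * M : ℕ) : ℤ) := by rw [hg, hnM]
    push_cast at this; linarith
  have hlZ : (c : ℤ) + g * i₀ = M * l := by exact_mod_cast hl
  have hgodd : g % 2 = 1 := by omega
  -- parity of `l`
  have hpar : (c + i₀) % 2 = l % 2 := by
    have : (c + g * i₀) % 2 = (M * l) % 2 := by rw [hl]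
    rw [Nat.add_mod, Nat.mul_mod, Nat.mul_mod M, hgodd, hModd] at this
    omega
  have hiff : (-1) ^ c * lamVal p₁ 1 l = 1 ↔
      (c % 2 = 1 ∧ quadraticChar (ZMod p₁) (l : ZMod p₁) = 1) ∨
      (c % 2 = 0 ∧ (p₁ ∣ l ∨ quadraticChar (ZMod p₁) (l : ZMod p₁) = -1)) := by
    unfold lamVal
    rcases Nat.mod_two_eq_zero_or_one c with hc | hc
    · rw [(Nat.even_iff.2 hc).neg_one_pow]
      by_cases h : p₁ ∣ l
      · simp [h, chi_dvd h, hc]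
      · rcases chi_not_dvd h with h' | h' <;> simp [h, h', hc]
    · rw [(Nat.odd_iff.2 hc).neg_one_pow]
      by_cases h : p₁ ∣ l
      · simp [h, chi_dvd h, hc]
      · rcases chi_not_dvd h with h' | h' <;> simp [h, h', hc]
  rw [hiff]
  simp only [Set.mem_iUnion, mem_cc hγ hN, exists_prop]
  constructor
  · rintro ⟨i, hi, j, hj, t, ht⟩
    push_cast at ht
    have hnMZ : (p₁ : ℤ) ^ m = p₁ * M := by exact_mod_cast hnM
    rw [hnMZ] at ht
    have hdi : M ∣ c + g * i := by
      have : (M : ℤ) ∣ (c : ℤ) + g * i :=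
        ⟨j.val + 2 * p₁ * t + p₁ * i, by rw [hgZ]; linear_combination ht⟩
      exact_mod_cast this
    have hii : i = i₀ := idx_unique hgM hi hi₀ hdi ⟨l, hl⟩
    subst hii
    have hlj : (l : ℤ) = j.val + p₁ * (2 * t + i) := by
      apply mul_left_cancel₀ hMZ
      rw [← hlZ, hgZ]; linear_combination ht
    have hχ : ((l : ℕ) : ZMod p₁) = ((j.val : ℕ) : ZMod p₁) := by
      have := congrArg (Int.cast : ℤ → ZMod p₁) hlj
      push_cast at this
      simpa using this
    have hcj : c % 2 = j.val % 2 := by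
      have h1 : (l : ℤ) % 2 = ((j.val : ℤ) + i) % 2 := by
        rw [hlj, Int.add_emod, Int.mul_emod]
        have : (p₁ : ℤ) % 2 = 1 := by omega
        rw [this]; omega
      omega
    have hdv : p₁ ∣ l ↔ p₁ ∣ j.val := by
      rw [← ZMod.natCast_eq_zero_iff, hχ, ZMod.natCast_eq_zero_iff]
    rw [mem_J hmod hm hcop hf hodd htot hp2 J hJ] at hj
    rw [hχ, hcj, hdv]
    exact hj
  · intro h
    obtain ⟨j₀, hj1, hj2⟩ : ∃ j₀ : ℕ, (j₀ : ZMod p₁) = l ∧ j₀ % 2 = c % 2 := by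
      by_cases hp : l % 2 = c % 2
      · exact ⟨l, rfl, hp⟩
      · exact ⟨l + p₁, by simp, by omega⟩
    have key : (((j₀ : ZMod (2 * p₁)).val : ℕ) : ZMod p₁) = l ∧
        ((j₀ : ZMod (2 * p₁)).val) % 2 = c % 2 := by
      rw [ZMod.val_natCast, ← hj1, ← hj2]
      constructor
      · rw [ZMod.natCast_eq_natCast_iff]
        exact Nat.mod_mod_of_dvd j₀ (Dvd.intro_left 2 rfl)
      · exact Nat.mod_mod_of_dvd j₀ (Dvd.intro _ rfl)
    generalize (j₀ : ZMod (2 * p₁)) = j at key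
    obtain ⟨k1, k2⟩ := key
    have hdv : p₁ ∣ l ↔ p₁ ∣ j.val := by
      rw [← ZMod.natCast_eq_zero_iff, ← k1, ZMod.natCast_eq_zero_iff]
    refine ⟨i₀, hi₀, j, ?_, ?_⟩
    · rw [mem_J hmod hm hcop hf hodd htot hp2 J hJ, k1, k2, ← hdv]
      exact h
    · have h1 : (p₁ : ℤ) ∣ l - p₁ * i₀ - j.val := by
        rw [← ZMod.intCast_zmod_eq_zero_iff_dvd]
        push_cast
        rw [k1]; simp
      have h2 : (2 : ℤ) ∣ l - p₁ * i₀ - j.val := by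
        have : (p₁ * i₀) % 2 = i₀ % 2 := by rw [Nat.mul_mod, hp₁odd]; omega
        have h3 : ((p₁ * i₀ : ℕ) : ℤ) = (p₁ : ℤ) * i₀ := by push_cast; rfl
        rw [← h3]
        omega
      have hc2 : IsCoprime (2 : ℤ) (p₁ : ℤ) := by
        have := (Nat.coprime_primes Nat.prime_two hp₁.out).2 (by omega)
        exact_mod_cast Nat.isCoprime_iff_coprime.2 this
      obtain ⟨t, ht⟩ := hc2.mul_dvd h2 h1
      refine ⟨t, ?_⟩
      rw [hnM]
      push_cast
      rw [hgZ] at hlZ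
      linear_combination hlZ + M * ht

end Elem

namespace Elem

/-- The sign function written in terms of characters. -/
noncomputable def sgn {F E : Type*} [Field F] [Fintype F] [Field E] (p₁ M g : ℕ) [Fact p₁.Prime]
    (φ : MulChar F E) (ξ : E) (x : F) : E :=
  ((p₁ * M : ℕ) : E)⁻¹ * ∑ i ∈ Finset.range M, ∑ k ∈ Finset.range (p₁ * M),
    (1 + (1 : ℤ) * ((quadraticChar (ZMod p₁) (k : ZMod p₁) : ℤ) : E) * delta p₁ (ξ ^ M)) *
      (ξ ^ (g * i)) ^ k * (φ ^ k * eta F E) x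

theorem sgn_pow {F E : Type*} [Field F] [Fintype F] [Field E] [CharZero E] {p₁ M g : ℕ}
    [hp₁ : Fact p₁.Prime] (hmod : p₁ % 8 = 3) (hM : 0 < M) (hF : ringChar F ≠ 2)
    (φ : MulChar F E) {γ : Fˣ} (hγ : ∀ x : Fˣ, x ∈ Subgroup.zpowers γ)
    (hξ : IsPrimitiveRoot (φ γ) (p₁ * M)) (hg : g.Coprime M)
    {c i₀ : ℕ} (hi : i₀ < M) (hd : M ∣ c + g * i₀) :
    sgn p₁ M g φ (φ γ) ((γ : F) ^ c) = (((-1) ^ c * lamVal p₁ 1 ((c + g * i₀) / M) : ℤ) : E) := by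
  have h0 : ((p₁ * M : ℕ) : E) ≠ 0 := by
    exact_mod_cast (Nat.mul_pos hp₁.out.pos hM).ne'
  have h1 := TS_eval hmod hM hξ hg 1 hi hd
  have h2 : ∀ i ∈ Finset.range M, ∀ k ∈ Finset.range (p₁ * M),
      (1 + ((1 : ℤ) : E) * ((quadraticChar (ZMod p₁) (k : ZMod p₁) : ℤ) : E) *
        delta p₁ (φ γ ^ M)) * (φ γ ^ (g * i)) ^ k * (φ ^ k * eta F E) ((γ : F) ^ c) =
      (-1) ^ c * ((1 + ((1 : ℤ) : E) * ((quadraticChar (ZMod p₁) (k : ZMod p₁) : ℤ) : E) *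
        delta p₁ (φ γ ^ M)) * (φ γ ^ (c + g * i)) ^ k) := by
    intro i _ k _
    rw [MulChar.mul_apply, map_pow, map_pow, eta_gen hF hγ, MulChar.pow_apply_coe]
    ring
  unfold sgn
  rw [Finset.sum_congr rfl fun i hi => Finset.sum_congr rfl (h2 i hi)]
  simp_rw [← Finset.mul_sum]
  unfold TS at h1
  rw [h1, mul_left_comm, inv_mul_cancel_left₀ h0]
  push_cast
  rfl

theorem sgn_zero {F E : Type*} [Field F] [Fintype F] [Field E] {p₁ M g : ℕ}
    [hp₁ : Fact p₁.Prime] (φ : MulChar F E) (ξ : E) : sgn p₁ M g φ ξ 0 = 0 := by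
  unfold sgn
  simp [MulChar.map_zero]

theorem sgn_sum {F E : Type*} [Field F] [Fintype F] [Field E] {p₁ M g : ℕ}
    [hp₁ : Fact p₁.Prime] (φ : MulChar F E) (ξ : E) (hne : ∀ k, φ ^ k * eta F E ≠ 1) :
    ∑ x, sgn p₁ M g φ ξ x = 0 := by
  unfold sgn
  rw [← Finset.mul_sum, Finset.sum_comm]
  rw [Finset.sum_eq_zero, mul_zero]
  intro i _
  rw [Finset.sum_comm]
  apply Finset.sum_eq_zero
  intro k _
  rw [← Finset.mul_sum, MulChar.sum_eq_zero_of_ne_one (hne k), mul_zero]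

theorem sgn_fourier {F E : Type*} [Field F] [Fintype F] [Field E] [CharZero E] {p₁ m M g : ℕ}
    [hp₁ : Fact p₁.Prime] (hmod : p₁ % 8 = 3) (hM : M = p₁ ^ (m - 1)) (hm : 1 ≤ m)
    (hF : ringChar F ≠ 2)
    (φ : MulChar F E) {γ : Fˣ} (hγ : ∀ x : Fˣ, x ∈ Subgroup.zpowers γ)
    (hξ : IsPrimitiveRoot (φ γ) (p₁ * M)) (hg : g + 2 = p₁ ^ m) (hgn : g.Coprime p₁)
    (ψ : AddChar F E) (hprim : ψ.IsPrimitive) (hq : Fintype.card F % 4 = 1)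
    (hGη : ∀ k : ℕ, k.Coprime p₁ →
      (1 + (quadraticChar (ZMod p₁) (k : ZMod p₁) : ℤ) * delta p₁ (φ γ ^ M)) *
        gaussSum (φ ^ k * eta F E) ψ =
      (1 - (quadraticChar (ZMod p₁) (k : ZMod p₁) : ℤ) * delta p₁ (φ γ ^ M)) *
        gaussSum (eta F E) ψ)
    (a : F) (ha : a ≠ 0) :
    (∑ x, sgn p₁ M g φ (φ γ) x * ψ (a * x)) ^ 2 = Fintype.card F := by
  have hMpos : 0 < M := by rw [hM]; exact pow_pos hp₁.out.pos _
  have hnM : p₁ ^ m = p₁ * M := by rw [hM, ← pow_succ']; congr 1; omega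
  have hgM : g.Coprime M := by rw [hM]; exact hgn.pow_right _
  have hgN : g.Coprime (p₁ * M) := Nat.Coprime.mul_right hgn hgM
  have h0 : ((p₁ * M : ℕ) : E) ≠ 0 := by
    exact_mod_cast (Nat.mul_pos hp₁.out.pos hMpos).ne'
  obtain ⟨c, hc⟩ := exists_nat_pow hγ a⁻¹ (inv_ne_zero ha)
  obtain ⟨i₀, hi, hd⟩ := exists_idx hMpos hgM c
  have h1 := TS_eval hmod hMpos hξ hgM (-1) hi hd
  set ξ := φ γ with hξd
  set δ := delta p₁ (ξ ^ M) with hδ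
  -- Fourier transform of a character
  have hchar : ∀ χ : MulChar F E, ∑ x, χ x * ψ (a * x) = χ ((γ : F) ^ c) * gaussSum χ ψ := by
    intro χ
    have h2 := gaussSum_mulShift χ ψ (Units.mk0 a ha)
    rw [← h2, ← hc, Units.val_mk0, ← mul_assoc, ← map_mul, inv_mul_cancel₀ ha, map_one, one_mul]
    rfl
  have hη0 : eta F E ≠ 1 := by
    intro h
    have h2 := eta_gen (E := E) hF hγ
    rw [h, MulChar.one_apply_coe] at h2
    have : (2 : E) = 0 := by linear_combination h2
    exact two_ne_zero this
  -- the inner sum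
  have hk : ∀ k ∈ Finset.range (p₁ * M),
      (∑ i ∈ Finset.range M, (ξ ^ (g * i)) ^ k) *
        ((1 + (quadraticChar (ZMod p₁) (k : ZMod p₁) : ℤ) * δ) * gaussSum (φ ^ k * eta F E) ψ) =
      (∑ i ∈ Finset.range M, (ξ ^ (g * i)) ^ k) *
        ((1 - (quadraticChar (ZMod p₁) (k : ZMod p₁) : ℤ) * δ) * gaussSum (eta F E) ψ) := by
    intro k hkr
    by_cases hkp : p₁ ∣ k
    · by_cases hk0 : k = 0
      · subst hk0; simp
      · have : ∑ i ∈ Finset.range M, (ξ ^ (g * i)) ^ k = 0 := by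
          have e : ∀ i ∈ Finset.range M, (ξ ^ (g * i)) ^ k = (ξ ^ (g * k)) ^ i := by
            intro i _; rw [← pow_mul, ← pow_mul]; congr 1; ring
          rw [Finset.sum_congr rfl e]
          apply geom_zero
          · obtain ⟨t, rfl⟩ := hkp
            rw [← pow_mul, show g * (p₁ * t) * M = p₁ * M * (g * t) by ring, pow_mul,
              hξ.pow_eq_one, one_pow]
          · rw [Ne, hξ.pow_eq_one_iff_dvd]
            intro h
            have h3 := hgN.symm.dvd_of_dvd_mul_left h
            have := Nat.le_of_dvd (by omega) h3
            rw [Finset.mem_range] at hkr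
            omega
        rw [this, zero_mul, zero_mul]
    · have hkc : k.Coprime p₁ := by
        rw [Nat.coprime_comm, Nat.Prime.coprime_iff_not_dvd hp₁.out]; exact hkp
      rw [hGη k hkc]
  have hsum : ∑ x, sgn p₁ M g φ ξ x * ψ (a * x) =
      ((p₁ * M : ℕ) : E)⁻¹ * ((-1) ^ c * gaussSum (eta F E) ψ * TS p₁ M g ξ (-1) c) := by
    unfold sgn TS
    rw [← hδ]
    have e1 : ∀ x : F, (((p₁ * M : ℕ) : E)⁻¹ * ∑ i ∈ Finset.range M, ∑ k ∈ Finset.range (p₁ * M),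
        (1 + ((1 : ℤ) : E) * ((quadraticChar (ZMod p₁) (k : ZMod p₁) : ℤ) : E) * δ) *
        (ξ ^ (g * i)) ^ k * (φ ^ k * eta F E) x) * ψ (a * x) =
        ((p₁ * M : ℕ) : E)⁻¹ * ∑ k ∈ Finset.range (p₁ * M), ∑ i ∈ Finset.range M,
        (1 + ((quadraticChar (ZMod p₁) (k : ZMod p₁) : ℤ) : E) * δ) *
        (ξ ^ (g * i)) ^ k * ((φ ^ k * eta F E) x * ψ (a * x)) := by
      intro x
      rw [mul_assoc, Finset.sum_comm]
      simp_rw [Finset.sum_mul]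
      congr 1
      refine Finset.sum_congr rfl fun k _ => Finset.sum_congr rfl fun i _ => ?_
      push_cast; ring
    rw [Finset.sum_congr rfl fun x _ => e1 x, ← Finset.mul_sum]
    congr 1
    rw [Finset.sum_comm, Finset.sum_comm (s := Finset.range M), Finset.mul_sum]
    refine Finset.sum_congr rfl fun k hkr => ?_
    rw [Finset.sum_comm]
    have e2 : ∀ i ∈ Finset.range M, ∑ x : F,
        (1 + ((quadraticChar (ZMod p₁) (k : ZMod p₁) : ℤ) : E) * δ) *
        (ξ ^ (g * i)) ^ k * ((φ ^ k * eta F E) x * ψ (a * x)) =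
        (ξ ^ (g * i)) ^ k * ((-1) ^ c * (ξ ^ c) ^ k *
          ((1 + (quadraticChar (ZMod p₁) (k : ZMod p₁) : ℤ) * δ) *
            gaussSum (φ ^ k * eta F E) ψ)) := by
      intro i _
      rw [← Finset.mul_sum, hchar, MulChar.mul_apply, map_pow, map_pow, eta_gen hF hγ,
        MulChar.pow_apply_coe]
      ring
    rw [Finset.sum_congr rfl e2, ← Finset.sum_mul]
    have h5 := hk k hkr
    calc _ = (-1) ^ c * (ξ ^ c) ^ k * ((∑ i ∈ Finset.range M, (ξ ^ (g * i)) ^ k) *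
        ((1 + (quadraticChar (ZMod p₁) (k : ZMod p₁) : ℤ) * δ) *
          gaussSum (φ ^ k * eta F E) ψ)) := by ring
      _ = _ := by
        rw [h5, Finset.sum_mul, Finset.mul_sum, Finset.mul_sum]
        refine Finset.sum_congr rfl fun i _ => ?_
        push_cast
        ring
  have hsq : gaussSum (eta F E) ψ ^ 2 = Fintype.card F := by
    rw [gaussSum_sq hη0 ((quadraticChar_isQuadratic F).comp _) hprim, eta_apply,
      quadraticChar_neg_one hF]
    rw [ZMod.χ₄_nat_one_mod_four hq]; simp
  have hl : ((lamVal p₁ (-1) ((c + g * i₀) / M) : ℤ) : E) ^ 2 = 1 := by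
    rw [← Int.cast_pow, lamVal_sq (Or.inr rfl), Int.cast_one]
  rw [hsum, h1]
  have e3 : ((p₁ * M : ℕ) : E)⁻¹ * ((-1) ^ c * gaussSum (eta F E) ψ *
      (((p₁ * M : ℕ) : E) * (lamVal p₁ (-1) ((c + g * i₀) / M) : E))) =
      (-1) ^ c * gaussSum (eta F E) ψ * (lamVal p₁ (-1) ((c + g * i₀) / M) : E) := by
    field_simp
  rw [e3, mul_pow, mul_pow, hl, hsq, ← pow_mul, mul_comm c, pow_mul]
  simp

end Elem

namespace Elem

theorem elem_facts {p₁ m p h f : ℕ} (hp₁ : p₁.Prime) (hmod : p₁ % 8 = 3) (hm : 1 ≤ m)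
    (hp : p.Prime) (hpmod : p % 4 = 1) (hh : 1 ≤ h) (hcl : 1 + p₁ = 4 * p ^ h)
    (hf : f = orderOf (p : ZMod (2 * p₁ ^ m))) (hford : 2 * f = Nat.totient (2 * p₁ ^ m)) :
    p.Coprime p₁ ∧ (p - 1).Coprime p₁ ∧ orderOf (p : ZMod (p₁ ^ m)) = f ∧ f % 2 = 1 ∧
      2 * f = Nat.totient (p₁ ^ m) ∧ 2 * p₁ ^ m ∣ p ^ f - 1 ∧ p ^ f % 4 = 1 ∧ 2 < p ^ f := by
  have hp5 : 5 ≤ p := by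
    have := hp.two_le; omega
  have hple : p ≤ p ^ h := Nat.le_self_pow (by omega) p
  have h1 : (p - 1).Coprime p₁ := by
    exact (Nat.coprime_of_lt_prime (by omega) (by omega) hp₁).symm
  have h0 : p.Coprime p₁ := (Nat.coprime_primes hp hp₁).2 (by omega)
  have hoddn : p₁ ^ m % 2 = 1 := by rw [Nat.pow_mod, show p₁ % 2 = 1 by omega, one_pow]; rfl
  have hc2 : Nat.Coprime 2 (p₁ ^ m) := by
    rw [Nat.coprime_two_left, Nat.odd_iff]; exact hoddn
  have htot : 2 * f = Nat.totient (p₁ ^ m) := by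
    rw [hford, Nat.totient_mul hc2]; simp
  have hpodd : ∀ k, p ^ k % 4 = 1 := fun k => by
    rw [Nat.pow_mod, hpmod, one_pow]; rfl
  have hiff : ∀ k, (p : ZMod (2 * p₁ ^ m)) ^ k = 1 ↔ (p : ZMod (p₁ ^ m)) ^ k = 1 := by
    intro k
    have e1 := ZMod.natCast_eq_natCast_iff (p ^ k) 1 (2 * p₁ ^ m)
    have e2 := ZMod.natCast_eq_natCast_iff (p ^ k) 1 (p₁ ^ m)
    push_cast at e1 e2
    rw [e1, e2, ← Nat.modEq_and_modEq_iff_modEq_mul hc2]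
    have : p ^ k ≡ 1 [MOD 2] := by
      have := hpodd k
      unfold Nat.ModEq; omega
    tauto
  have hord : orderOf (p : ZMod (p₁ ^ m)) = f := by
    rw [hf]
    apply Nat.dvd_antisymm
    · apply orderOf_dvd_of_pow_eq_one
      rw [← hiff, pow_orderOf_eq_one]
    · apply orderOf_dvd_of_pow_eq_one
      rw [hiff, pow_orderOf_eq_one]
  have hMp : 0 < p₁ ^ (m - 1) := pow_pos hp₁.pos _
  have hfeq : f = p₁ ^ (m - 1) * ((p₁ - 1) / 2) := by
    have h2 := Nat.totient_prime_pow hp₁ (show 0 < m by omega)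
    rw [← htot] at h2
    have h3 : p₁ - 1 = 2 * ((p₁ - 1) / 2) := by omega
    rw [h3, mul_left_comm] at h2
    have := Nat.eq_of_mul_eq_mul_left (by norm_num) h2
    exact this
  have hfodd : f % 2 = 1 := by
    rw [hfeq, Nat.mul_mod, Nat.pow_mod, show p₁ % 2 = 1 by omega, one_pow,
      show (p₁ - 1) / 2 % 2 = 1 by omega]
    rfl
  have hdvd : 2 * p₁ ^ m ∣ p ^ f - 1 := by
    have h4 : (p : ZMod (2 * p₁ ^ m)) ^ f = 1 := by rw [hf, pow_orderOf_eq_one]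
    have e1 := ZMod.natCast_eq_natCast_iff 1 (p ^ f) (2 * p₁ ^ m)
    push_cast at e1
    exact (Nat.modEq_iff_dvd' (Nat.one_le_pow _ _ (by omega))).1 (e1.1 h4.symm)
  have hple' : p ≤ p ^ f := Nat.le_self_pow (by omega) p
  exact ⟨h0, h1, hord, hfodd, htot, hdvd, hpodd f, by omega⟩

theorem sgn_neg {F E : Type*} [Field F] [Fintype F] [Field E] {p₁ M g n : ℕ}
    [hp₁ : Fact p₁.Prime] (hF : ringChar F ≠ 2) (hq : Fintype.card F % 4 = 1)
    (φ : MulChar F E) (hn : Odd n) (hφ : φ ^ n = 1) (ξ : E) (x : F) :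
    sgn p₁ M g φ ξ (-x) = sgn p₁ M g φ ξ x := by
  have h1 : φ (-1) = 1 := MulChar.val_neg_one_eq_one_of_odd_order hn hφ
  have h2 : eta F E (-1) = 1 := by
    rw [eta_apply, quadraticChar_neg_one hF, ZMod.χ₄_nat_one_mod_four hq]; simp
  have h3 : ∀ k, (φ ^ k * eta F E) (-x) = (φ ^ k * eta F E) x := by
    intro k
    have h4 : (φ ^ k) (-1) = 1 := by
      have := MulChar.pow_apply_coe φ k (-1)
      rw [Units.val_neg, Units.val_one, h1, one_pow] at this
      exact this
    rw [← neg_one_mul x, map_mul, MulChar.mul_apply (φ ^ k) (eta F E) (-1), h2, h4,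
      one_mul, one_mul]
  unfold sgn
  simp_rw [h3]

end Elem

/-- Corollary 3.5 of the paper, the case `p ≡ 1 (mod 4)`. -/
theorem statement_17 (p₁ m : ℕ) (hp₁ : p₁.Prime) (hp₁mod : p₁ % 8 = 3) (hp₁ne : p₁ ≠ 3)
    (hm : 1 ≤ m) (N : ℕ) (hN : N = 2 * p₁ ^ m)
    -- `h` is the class number of `ℚ(√-p₁)`
    (K : Type*) [Field K] [NumberField K] (α : K)
    (hα : α ^ 2 = -(p₁ : K)) (hKα : Algebra.adjoin ℚ {α} = ⊤)
    (h : ℕ) (hh : h = NumberField.classNumber K)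
    (p : ℕ) (hp : p.Prime) (hpmod : p % 4 = 1) (hcl : 1 + p₁ = 4 * p ^ h)
    (f : ℕ) (hf : f = orderOf ((p : ZMod N))) (hford : 2 * f = Nat.totient N)
    (F : Type*) [Field F] [Fintype F] (hcard : Fintype.card F = p ^ f)
    -- `J = ⟨p⟩ ∪ 2⟨p⟩ ∪ {0} ⊆ Z_{2p₁}`
    (J : Set (ZMod (2 * p₁)))
    (hJ : J = {x : ZMod (2 * p₁) | ∃ k : ℕ, x = (p : ZMod (2 * p₁)) ^ k} ∪
      {x : ZMod (2 * p₁) | ∃ k : ℕ, x = 2 * (p : ZMod (2 * p₁)) ^ k} ∪ {0}) :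
    ∃ γ : Fˣ, (∀ x : Fˣ, x ∈ Subgroup.zpowers γ) ∧
      IsPaleyTypePDS
        (⋃ i < p₁ ^ (m - 1), ⋃ j ∈ J,
          cycClass γ N (2 * i + p₁ ^ (m - 1) * ZMod.val j)) := by
  subst hN
  have _ := hp₁ne
  have fp₁ : Fact p₁.Prime := ⟨hp₁⟩
  have fp : Fact p.Prime := ⟨hp⟩
  have hh1 : 1 ≤ h := by
    rw [hh]; exact Fintype.card_pos
  have hcb := ClassBound.class_bound hp₁mod hα hKα
  rw [← hh] at hcb
  obtain ⟨hcop, hc, hord, hodd, htot, hdvd, hq4, hq2⟩ :=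
    Elem.elem_facts hp₁ hp₁mod hm hp hpmod hh1 hcl hf hford
  have hp2 : p ≠ 2 := by rintro rfl; omega
  have hpo : p % 2 = 1 := by omega
  have hf0 : f ≠ 0 := by rintro rfl; omega
  rw [← hcard] at hdvd hq4 hq2
  have hFp : CharP F p := by
    obtain ⟨r, hr⟩ := CharP.exists F
    have hrp := CharP.char_is_prime F r
    have h1 : r ∣ p ^ f := by
      rw [← CharP.cast_eq_zero_iff F r, ← hcard, Nat.cast_card_eq_zero]
    have h2 := (Nat.prime_dvd_prime_iff_eq hrp hp).1 (hrp.dvd_of_dvd_pow h1)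
    rwa [← h2]
  letI : Algebra (ZMod p) F := ZMod.algebra F p
  have hF : ringChar F ≠ 2 := by rw [ringChar.eq F p]; exact hp2
  have hpE : ‖(p : PadicAlgCl p)‖ < 1 := by
    have h1 := PadicAlgCl.norm_extends p (p : ℚ_[p])
    rw [map_natCast] at h1
    rw [h1]; exact Padic.norm_p_lt_one
  have hnpos : 0 < p₁ ^ m := pow_pos hp₁.pos _
  have : NeZero (p : PadicAlgCl p) := ⟨by exact_mod_cast hp.ne_zero⟩
  have : NeZero ((p₁ ^ m : ℕ) : PadicAlgCl p) := ⟨by exact_mod_cast hnpos.ne'⟩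
  obtain ⟨ζ, hζ⟩ := HasEnoughRootsOfUnity.exists_primitiveRoot (PadicAlgCl p) p
  obtain ⟨ω, hω⟩ := HasEnoughRootsOfUnity.exists_primitiveRoot (PadicAlgCl p) (p₁ ^ m)
  obtain ⟨φ, hφ⟩ := MulChar.exists_mulChar_orderOf F ((Dvd.intro_left 2 rfl).trans hdvd) hω
  let ψ : AddChar F (PadicAlgCl p) := (AddChar.zmodChar p hζ.pow_eq_one).compAddMonoidHom
    (Algebra.trace (ZMod p) F).toAddMonoidHom
  have hψ : ∀ x, ψ x = ζ ^ (Algebra.trace (ZMod p) F x).val := by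
    intro x
    exact AddChar.zmodChar_apply hζ.pow_eq_one _
  have hprim : ψ.IsPrimitive := AddChar.IsPrimitive.of_ne_one (Stick.psi_ne_one hζ ψ hψ)
  obtain ⟨γ, u, hγ, hu, hG⟩ := Elem.gauss_shape' hp₁mod hm hcop hord hodd htot hcb hp2 hpE hh1 hcl
    hc hq2 hcard hζ ψ hψ hprim φ hφ
  refine ⟨γ, hγ, ?_⟩
  obtain ⟨M, hM⟩ : ∃ M, M = p₁ ^ (m - 1) := ⟨_, rfl⟩
  rw [← hM] at hG ⊢
  have hMpos : 0 < M := by rw [hM]; exact pow_pos hp₁.pos _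
  have hnM : p₁ ^ m = p₁ * M := by rw [hM, ← pow_succ']; congr 1; omega
  have hξ : IsPrimitiveRoot (φ γ) (p₁ * M) := by
    rw [← hnM, ← hφ]; exact Elem.xi_prim φ hγ
  have hw : IsPrimitiveRoot (φ γ ^ M) p₁ :=
    hξ.pow (Nat.mul_pos hp₁.pos hMpos) (by rw [mul_comm])
  have hδ2 := Elem.delta_sq (E := PadicAlgCl p) hp₁mod hw
  have hφn : φ ^ (p₁ ^ m) = 1 := by rw [← hφ, pow_orderOf_eq_one]
  have hnodd : Odd (p₁ ^ m) := Odd.pow (Nat.odd_iff.2 (by omega))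
  have hp₁le : p₁ ≤ p₁ ^ m := Nat.le_self_pow (by omega) p₁
  have hp₁3 : 3 ≤ p₁ := by have := hp₁.two_le; omega
  obtain ⟨g, hg⟩ : ∃ g, g + 2 = p₁ ^ m := ⟨p₁ ^ m - 2, by omega⟩
  have hgn : g.Coprime p₁ := by
    rw [Nat.coprime_comm, Nat.Prime.coprime_iff_not_dvd hp₁]
    intro hd
    have h1 : p₁ ∣ g + 2 := by rw [hg]; exact dvd_pow_self _ (by omega)
    have h2 := (Nat.dvd_add_right hd).1 h1
    have := Nat.le_of_dvd (by norm_num) h2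
    omega
  have hgM : g.Coprime M := by rw [hM]; exact hgn.pow_right _
  have hGη := Elem.gauss_eta hp₁mod hm hp2 hc ψ φ hφ hδ2 hu hG
  have hfour := Elem.sgn_fourier hp₁mod hM hm hF φ hγ hξ hg hgn ψ hprim hq4 hGη
  have hne : ∀ k, φ ^ k * Elem.eta F (PadicAlgCl p) ≠ 1 := by
    intro k hk
    have h1 : (φ ^ k * Elem.eta F (PadicAlgCl p)) γ = 1 := by rw [hk, MulChar.one_apply_coe]
    rw [MulChar.mul_apply, MulChar.pow_apply_coe, Elem.eta_gen hF hγ] at h1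
    have h2 : φ γ ^ k = -1 := by linear_combination -h1
    have h3 : (φ γ ^ k) ^ (p₁ ^ m) = 1 := by
      rw [hnM, ← pow_mul, mul_comm, pow_mul, hξ.pow_eq_one, one_pow]
    rw [h2, hnodd.neg_one_pow] at h3
    have : (2 : PadicAlgCl p) = 0 := by linear_combination -h3
    exact two_ne_zero this
  have key : ∀ x : F, x ≠ 0 →
      (Elem.sgn p₁ M g φ (φ γ) x = 1 ∨ Elem.sgn p₁ M g φ (φ γ) x = -1) ∧
      (x ∈ (⋃ i < M, ⋃ j ∈ J, Elem.cc γ (2 * p₁ ^ m) (2 * i + M * ZMod.val j)) ↔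
        Elem.sgn p₁ M g φ (φ γ) x = 1) := by
    intro x hx
    obtain ⟨c, rfl⟩ := Elem.exists_nat_pow hγ x hx
    obtain ⟨i₀, hi, hd⟩ := Elem.exists_idx hMpos hgM c
    rw [Elem.sgn_pow hp₁mod hMpos hF φ hγ hξ hgM hi hd,
      Elem.mem_D hp₁mod hm hcop hord hodd htot hpo J hJ hγ hdvd hM hg hgM hi hd]
    have hsq : ((-1) ^ c * Elem.lamVal p₁ 1 ((c + g * i₀) / M)) ^ 2 = 1 := by
      rw [mul_pow, Elem.lamVal_sq (Or.inl rfl), ← pow_mul, mul_comm c, pow_mul]; simp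
    refine ⟨?_, ?_⟩
    · rcases sq_eq_one_iff.1 hsq with h1 | h1
      · left; rw [h1]; simp
      · right; rw [h1]; simp
    · exact_mod_cast Iff.rfl
  have hD0 : (0 : F) ∉ (⋃ i < M, ⋃ j ∈ J, Elem.cc γ (2 * p₁ ^ m) (2 * i + M * ZMod.val j)) := by
    simp only [Set.mem_iUnion, exists_prop, not_exists, not_and]
    rintro i _ j _ ⟨k, hk⟩
    exact (Units.ne_zero _) hk.symm
  refine pds_of_ft ψ hprim
    (⋃ i < M, ⋃ j ∈ J, Elem.cc γ (2 * p₁ ^ m) (2 * i + M * ZMod.val j))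
    (Elem.sgn p₁ M g φ (φ γ)) hD0 ?_ (Elem.sgn_zero φ _) ?_ ?_ (Elem.sgn_sum φ _ hne) hfour
  · intro x
    by_cases hx : x = 0
    · rw [hx, neg_zero]
    · rw [(key x hx).2, (key (-x) (neg_ne_zero.2 hx)).2,
        Elem.sgn_neg hF hq4 φ hnodd hφn]
  · intro x hx
    have hx0 : x ≠ 0 := by rintro rfl; exact hD0 hx
    exact (key x hx0).2.1 hx
  · intro x hx hx0
    exact ((key x hx0).1).resolve_left (fun h1 => hx ((key x hx0).2.2 h1))
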